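/- arXiv:1010.1394 — 4 statements merged into one kernel-verified Lean document; each statement's English description precedes it below -/
import Mathlib

section
/- Let d, k ≥ 1 be integers and ε ∈ [0, 2^{-kd}]. If μ is a dyadic mean (k,η,ε)-porous Borel probability measure on [0,1)^d with 0 < η ≤ 1, then dim_P(μ) ≤ d − η·t_{d,k}(ε). -/
open MeasureTheory Filter Metric Set
open scoped ENNReal NNReal

/-- The half-open dyadic cube of side `2^{-n}` containing `x`. -/
def dyadicCube (d n : ℕ) (x : EuclideanSpace ℝ (Fin d)) : Set (EuclideanSpace ℝ (Fin d)) :=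
  {y | ∀ j : Fin d, ⌊(2 : ℝ) ^ n * y j⌋ = ⌊(2 : ℝ) ^ n * x j⌋}

/-- `por₂(μ,x,n,ε) ≤ k`: there is `1 ≤ j ≤ k` and a dyadic subcube `R` of `D_n(x)`,
`j` levels below, with `μ(R) ≤ ε·μ(D_n(x))`. -/
def por2Le {d : ℕ} (μ : Measure (EuclideanSpace ℝ (Fin d)))
    (x : EuclideanSpace ℝ (Fin d)) (n k : ℕ) (ε : ℝ) : Prop :=
  ∃ j : ℕ, 1 ≤ j ∧ j ≤ k ∧ ∃ y ∈ dyadicCube d n x,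
    μ (dyadicCube d (n + j) y) ≤ ENNReal.ofReal ε * μ (dyadicCube d n x)

/-- `μ` is dyadic mean `(k,η,ε)`-porous: for `μ`-a.e. `x`,
`liminf_n (1/n)·#{i < n : por₂(μ,x,i,ε) ≤ k} ≥ η`. -/
def DyadicMeanPorousWith {d : ℕ} (μ : Measure (EuclideanSpace ℝ (Fin d)))
    (k : ℕ) (η ε : ℝ) : Prop :=
  ∀ᵐ x ∂μ, η ≤ Filter.liminf
    (fun n : ℕ => (Set.ncard {i : ℕ | i < n ∧ por2Le μ x i k ε} : ℝ) / n) Filter.atTop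

/-- `μ` is dyadic mean `(k,η)`-porous: dyadic mean `(k,η,ε)`-porous for all `ε > 0`. -/
def DyadicMeanPorous {d : ℕ} (μ : Measure (EuclideanSpace ℝ (Fin d))) (k : ℕ) (η : ℝ) : Prop :=
  ∀ ε > 0, DyadicMeanPorousWith μ k η ε

/-- The unit cube `[0,1)^d`. -/
def unitCube (d : ℕ) : Set (EuclideanSpace ℝ (Fin d)) :=
  {x | ∀ j : Fin d, 0 ≤ x j ∧ x j < 1}

/-- The upper local dimension of a measure at a point:
`limsup_{r→0⁺} log μ(B(x,r)) / log r` (closed balls), as an extended real. -/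
noncomputable def upperLocalDim {d : ℕ} (μ : Measure (EuclideanSpace ℝ (Fin d)))
    (x : EuclideanSpace ℝ (Fin d)) : EReal :=
  Filter.limsup
    (fun r : ℝ => ((Real.log ((μ (Metric.closedBall x r)).toReal) / Real.log r : ℝ) : EReal))
    (nhdsWithin (0 : ℝ) (Set.Ioi 0))

/-- The (upper) packing dimension of a measure: the `μ`-essential supremum of the
upper local dimensions. -/
noncomputable def packingDim {d : ℕ} (μ : Measure (EuclideanSpace ℝ (Fin d))) : EReal :=
  essSup (fun x => upperLocalDim μ x) μ

/-- `s_{d,k}(ε)`: the largest real solution `s` of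
`(1−ε)·log((2^d−1)·(Σ_{i=1}^k 2^{-s·i})/(1−ε)) + ε·log(1/ε) = s·ε·log(2^k)`
(with the convention `0·log 0 = 0`). -/
noncomputable def sdk (d k : ℕ) (ε : ℝ) : ℝ :=
  sSup {s : ℝ |
    (1 - ε) * Real.log (((2 : ℝ) ^ d - 1) *
        (∑ i ∈ Finset.range k, (2 : ℝ) ^ (-(s * ((i : ℝ) + 1)))) / (1 - ε))
      + ε * Real.log (1 / ε) = s * ε * Real.log ((2 : ℝ) ^ k)}

/-- `t_{d,k}(ε) = d − s_{d,k}(ε)`. -/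
noncomputable def tdk (d k : ℕ) (ε : ℝ) : ℝ := d - sdk d k ε

/-- Hölder's inequality with exponents `1 - θ` and `θ`. -/
theorem sum_rpow_mul_rpow_le {ι : Type*} (t : Finset ι) {θ : ℝ} (h0 : 0 < θ) (h1 : θ < 1)
    (x a : ι → ℝ) (hx : ∀ i ∈ t, 0 ≤ x i) (ha : ∀ i ∈ t, 0 ≤ a i) :
    ∑ i ∈ t, x i ^ (1 - θ) * a i ^ θ ≤ (∑ i ∈ t, x i) ^ (1 - θ) * (∑ i ∈ t, a i) ^ θ := by
  have hpq : Real.HolderConjugate (1 / (1 - θ)) (1 / θ) := by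
    rw [Real.holderConjugate_iff]
    refine ⟨by rw [lt_div_iff₀] <;> linarith, by simp⟩
  have h := Real.inner_le_Lp_mul_Lq_of_nonneg t hpq
    (f := fun i => x i ^ (1 - θ)) (g := fun i => a i ^ θ)
    (fun i hi => Real.rpow_nonneg (hx i hi) _) (fun i hi => Real.rpow_nonneg (ha i hi) _)
  have e1 : ∑ i ∈ t, (x i ^ (1 - θ)) ^ (1 / (1 - θ)) = ∑ i ∈ t, x i := by
    refine Finset.sum_congr rfl fun i hi => ?_
    rw [one_div, Real.rpow_rpow_inv (hx i hi) (by linarith)]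
  have e2 : ∑ i ∈ t, (a i ^ θ) ^ (1 / θ) = ∑ i ∈ t, a i := by
    refine Finset.sum_congr rfl fun i hi => ?_
    rw [one_div, Real.rpow_rpow_inv (ha i hi) h0.ne']
  rw [e1, e2] at h
  simpa using h

/-- The two-term case of `sum_rpow_mul_rpow_le`. -/
theorem rpow_mul_rpow_add_le {θ : ℝ} (h0 : 0 < θ) (h1 : θ < 1) {x y a b : ℝ}
    (hx : 0 ≤ x) (hy : 0 ≤ y) (ha : 0 ≤ a) (hb : 0 ≤ b) :
    x ^ (1 - θ) * a ^ θ + y ^ (1 - θ) * b ^ θ ≤ (x + y) ^ (1 - θ) * (a + b) ^ θ := by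
  have h := sum_rpow_mul_rpow_le (Finset.univ : Finset (Fin 2)) h0 h1 ![x, y] ![a, b]
    (by simp [Fin.forall_fin_two, hx, hy]) (by simp [Fin.forall_fin_two, ha, hb])
  simpa [Fin.sum_univ_two] using h

/-- The case of `sum_rpow_mul_rpow_le` in which one of the families is constant. -/
theorem sum_rpow_le_card {ι : Type*} (t : Finset ι) {θ : ℝ} (h0 : 0 < θ) (h1 : θ < 1)
    (x : ι → ℝ) (hx : ∀ i ∈ t, 0 ≤ x i) :
    ∑ i ∈ t, x i ^ (1 - θ) ≤ (∑ i ∈ t, x i) ^ (1 - θ) * (t.card : ℝ) ^ θ := by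
  simpa using sum_rpow_mul_rpow_le t h0 h1 x (fun _ => 1) hx (fun _ _ => zero_le_one)

/-- The sum of `g` over the descendants of `v` in generation `m` of the tree with children `ch`,
each weighted by the product of `w` over its proper ancestors from `v` on. -/
noncomputable def treeSum {V : Type*} (ch : V → Finset V) (w g : V → ℝ) : ℕ → V → ℝ
  | 0, v => g v
  | m + 1, v => w v * ∑ u ∈ ch v, treeSum ch w g m u

theorem treeSum_nonneg {V : Type*} {ch : V → Finset V} {w g : V → ℝ} (hw : ∀ v, 0 ≤ w v)
    (hg : ∀ v, 0 ≤ g v) (m : ℕ) (v : V) : 0 ≤ treeSum ch w g m v := by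
  induction m generalizing v with
  | zero => exact hg v
  | succ m ih => exact mul_nonneg (hw v) (Finset.sum_nonneg fun u _ => ih u)

section Tree

variable {V : Type*} {ch : V → Finset V} {w f : V → ℝ}

theorem treeSum_le_card_pow {θ : ℝ} {N : ℕ} (h1 : θ < 1)
    (hf : ∀ v, 0 ≤ f v) (hsum : ∀ v, ∑ u ∈ ch v, f u ≤ f v) (hcard : ∀ v, (ch v).card = N)
    (hw0 : ∀ v, 0 ≤ w v) (hw1 : ∀ v, w v ≤ 1) (m : ℕ) (v : V) :
    treeSum ch w (fun v => f v ^ (1 - θ)) m v ≤ (N : ℝ) ^ m * f v ^ (1 - θ) := by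
  induction m generalizing v with
  | zero => simp [treeSum]
  | succ m ih =>
    have hle : ∑ u ∈ ch v, treeSum ch w (fun v => f v ^ (1 - θ)) m u ≤
        (N : ℝ) ^ (m + 1) * f v ^ (1 - θ) := by
      calc ∑ u ∈ ch v, treeSum ch w (fun v => f v ^ (1 - θ)) m u
          ≤ ∑ u ∈ ch v, (N : ℝ) ^ m * f v ^ (1 - θ) := by
            refine Finset.sum_le_sum fun u hu => (ih u).trans ?_
            gcongr
            · exact hf u
            · exact (Finset.single_le_sum (fun i _ => hf i) hu).trans (hsum v)
        _ = _ := by rw [Finset.sum_const, hcard, nsmul_eq_mul]; ring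
    have h0 : 0 ≤ (N : ℝ) ^ (m + 1) * f v ^ (1 - θ) :=
      mul_nonneg (by positivity) (Real.rpow_nonneg (hf v) _)
    calc treeSum ch w (fun v => f v ^ (1 - θ)) (m + 1) v
        ≤ w v * ((N : ℝ) ^ (m + 1) * f v ^ (1 - θ)) := mul_le_mul_of_nonneg_left hle (hw0 v)
      _ ≤ _ := mul_le_of_le_one_left h0 (hw1 v)

/-- If the sums over shorter generations are at most `D * f ^ (1 - θ)`, then splitting the
descendants of `a 0` along the path `a 0, …, a l` bounds the sum at `a 0`. -/
theorem treeSum_le_of_path {θ b D : ℝ} {N : ℕ} (h0 : 0 < θ) (h1 : θ < 1) (hb : 0 ≤ b)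
    (hN : 1 ≤ N) (hD : 0 ≤ D)
    (hf : ∀ v, 0 ≤ f v) (hsum : ∀ v, ∑ u ∈ ch v, f u ≤ f v) (hcard : ∀ v, (ch v).card = N)
    (hw0 : ∀ v, 0 ≤ w v) (hwb : ∀ v, w v ≤ b ^ θ) (l m : ℕ) (a : ℕ → V)
    (ha : ∀ i, a (i + 1) ∈ ch (a i)) (hlm : l ≤ m)
    (hm : ∀ m' u, m' < m ∨ (l = 0 ∧ m' = m) →
      treeSum ch w (fun v => f v ^ (1 - θ)) m' u ≤ D * f u ^ (1 - θ)) :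
    treeSum ch w (fun v => f v ^ (1 - θ)) m (a 0) ≤
      D * ((f (a 0) - f (a l)) ^ (1 - θ) *
          (((N : ℝ) - 1) * ∑ i ∈ Finset.range l, b ^ (i + 1)) ^ θ
        + f (a l) ^ (1 - θ) * (b ^ l) ^ θ) := by
  classical
  have hN' : (0 : ℝ) ≤ (N : ℝ) - 1 := by
    have : (1 : ℝ) ≤ N := by exact_mod_cast hN
    linarith
  induction l generalizing m a with
  | zero => simpa [Real.zero_rpow h0.ne'] using hm m (a 0) (Or.inr ⟨rfl, rfl⟩)
  | succ l ih =>
    obtain ⟨m, rfl⟩ : ∃ m', m = m' + 1 := ⟨m - 1, by omega⟩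
    have hm' : ∀ u, treeSum ch w (fun v => f v ^ (1 - θ)) m u ≤ D * f u ^ (1 - θ) :=
      fun u => hm m u (Or.inl (by omega))
    have hch := ih m (fun i => a (i + 1)) (fun i => ha (i + 1)) (by omega)
      (fun m' u h => hm m' u (Or.inl (by omega)))
    simp only [zero_add] at hch
    have hanti : ∀ i, f (a (i + 1)) ≤ f (a i) := fun i =>
      (Finset.single_le_sum (fun i _ => hf i) (ha i)).trans (hsum _)
    have hρ : f (a (l + 1)) ≤ f (a 1) :=
      antitone_nat_of_succ_le (f := fun i => f (a i)) hanti (by omega)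
    set ρ := f (a (l + 1)) with hρdef
    set A := ((N : ℝ) - 1) * ∑ i ∈ Finset.range l, b ^ (i + 1) with hA
    have hA0 : 0 ≤ A := mul_nonneg hN' (Finset.sum_nonneg fun i _ => by positivity)
    have hAs : ((N : ℝ) - 1) * ∑ i ∈ Finset.range (l + 1), b ^ (i + 1) = b * (A + (N - 1)) := by
      rw [Finset.sum_range_succ', hA, Finset.sum_congr rfl fun i _ => pow_succ b (i + 1),
        ← Finset.sum_mul]
      ring
    have hsplit := Finset.add_sum_erase (ch (a 0)) f (ha 0)
    have hE0 : 0 ≤ ∑ u ∈ (ch (a 0)).erase (a 1), f u := Finset.sum_nonneg fun i _ => hf i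
    have hsib : ∑ u ∈ (ch (a 0)).erase (a 1), treeSum ch w (fun v => f v ^ (1 - θ)) m u ≤
        D * ((∑ u ∈ (ch (a 0)).erase (a 1), f u) ^ (1 - θ) * ((N : ℝ) - 1) ^ θ) := by
      have hc := sum_rpow_le_card ((ch (a 0)).erase (a 1)) h0 h1 f (fun i _ => hf i)
      rw [Finset.card_erase_of_mem (ha 0), hcard, Nat.cast_sub hN, Nat.cast_one] at hc
      calc _ ≤ ∑ u ∈ (ch (a 0)).erase (a 1), D * f u ^ (1 - θ) :=
            Finset.sum_le_sum fun u _ => hm' u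
        _ ≤ _ := by rw [← Finset.mul_sum]; exact mul_le_mul_of_nonneg_left hc hD
    have hholder := rpow_mul_rpow_add_le h0 h1 (sub_nonneg.2 hρ) hE0 hA0 hN'
    have hmono : (f (a 1) - ρ + ∑ u ∈ (ch (a 0)).erase (a 1), f u) ^ (1 - θ) ≤
        (f (a 0) - ρ) ^ (1 - θ) := by
      refine Real.rpow_le_rpow (add_nonneg (sub_nonneg.2 hρ) hE0) ?_ (by linarith)
      have := hsum (a 0)
      linarith
    have htot : ∑ u ∈ ch (a 0), treeSum ch w (fun v => f v ^ (1 - θ)) m u ≤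
        D * ((f (a 0) - ρ) ^ (1 - θ) * (A + (N - 1)) ^ θ + ρ ^ (1 - θ) * (b ^ l) ^ θ) := by
      rw [← Finset.add_sum_erase _ _ (ha 0)]
      have h2 := mul_le_mul_of_nonneg_right hmono
        (Real.rpow_nonneg (add_nonneg hA0 hN') θ)
      have h3 := mul_le_mul_of_nonneg_left (hholder.trans h2) hD
      linarith
    have hρ0 : 0 ≤ ρ := hf _
    have hr : 0 ≤ D * ((f (a 0) - ρ) ^ (1 - θ) * (A + (N - 1)) ^ θ + ρ ^ (1 - θ) * (b ^ l) ^ θ) := by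
      have hd : 0 ≤ f (a 0) - ρ := by linarith [hanti 0]
      positivity
    calc treeSum ch w (fun v => f v ^ (1 - θ)) (m + 1) (a 0)
        ≤ w (a 0) * (D * ((f (a 0) - ρ) ^ (1 - θ) * (A + (N - 1)) ^ θ
            + ρ ^ (1 - θ) * (b ^ l) ^ θ)) := mul_le_mul_of_nonneg_left htot (hw0 _)
      _ ≤ b ^ θ * (D * ((f (a 0) - ρ) ^ (1 - θ) * (A + (N - 1)) ^ θ
            + ρ ^ (1 - θ) * (b ^ l) ^ θ)) := mul_le_mul_of_nonneg_right (hwb _) hr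
      _ = _ := by
        rw [hAs, Real.mul_rpow hb (add_nonneg hA0 hN'), pow_succ,
          Real.mul_rpow (pow_nonneg hb l) hb]
        ring

/-- If every vertex has weight `N ^ (-θ)`, or weight `b ^ θ` and a descendant `k` generations
below carrying at most the fraction `ε` of its mass, then `treeSum` grows at most like `K ^ m`. -/
theorem treeSum_le {θ b K ε : ℝ} {N k : ℕ} (h0 : 0 < θ) (h1 : θ < 1) (hb : 0 < b) (hb1 : b ≤ 1)
    (hN : 1 ≤ N) (hk : 1 ≤ k) (hK1 : 1 ≤ K) (hNb : (N : ℝ)⁻¹ ≤ b)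
    (hf : ∀ v, 0 ≤ f v) (hsum : ∀ v, ∑ u ∈ ch v, f u ≤ f v) (hcard : ∀ v, (ch v).card = N)
    (hw : ∀ v, w v = ((N : ℝ)⁻¹) ^ θ ∨ w v = b ^ θ ∧ ∃ a : ℕ → V, a 0 = v ∧
      (∀ i, a (i + 1) ∈ ch (a i)) ∧ f (a k) ≤ ε * f v)
    (hK : ∀ p, 0 ≤ p → p ≤ ε → (1 - p) ^ (1 - θ) *
      (((N : ℝ) - 1) * ∑ i ∈ Finset.range k, b ^ (i + 1)) ^ θ + p ^ (1 - θ) * (b ^ k) ^ θ ≤ K)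
    (m : ℕ) (v : V) :
    treeSum ch w (fun v => f v ^ (1 - θ)) m v ≤ (N : ℝ) ^ k * K ^ m * f v ^ (1 - θ) := by
  have hN1 : (1 : ℝ) ≤ N := by exact_mod_cast hN
  have hNθ : ((N : ℝ)⁻¹) ^ θ ≤ b ^ θ := Real.rpow_le_rpow (by positivity) hNb h0.le
  have hw0 : ∀ v, 0 ≤ w v := fun v => by
    rcases hw v with h | ⟨h, -⟩ <;> rw [h] <;> positivity
  have hwb : ∀ v, w v ≤ b ^ θ := fun v => by
    rcases hw v with h | ⟨h, -⟩ <;> rw [h]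
    exact hNθ
  have hw1 : ∀ v, w v ≤ 1 := fun v => (hwb v).trans (Real.rpow_le_one hb.le hb1 h0.le)
  induction m using Nat.strong_induction_on generalizing v with
  | _ m ih =>
  have hfθ : ∀ v, 0 ≤ f v ^ (1 - θ) := fun v => Real.rpow_nonneg (hf v) _
  by_cases hmk : m < k
  · refine (treeSum_le_card_pow h1 hf hsum hcard hw0 hw1 m v).trans ?_
    refine mul_le_mul_of_nonneg_right ?_ (hfθ v)
    calc (N : ℝ) ^ m ≤ (N : ℝ) ^ k := pow_le_pow_right₀ hN1 hmk.le
      _ ≤ _ := le_mul_of_one_le_right (by positivity) (one_le_pow₀ hK1)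
  obtain ⟨m, rfl⟩ : ∃ m', m = m' + 1 := ⟨m - 1, by omega⟩
  have hD : 0 ≤ (N : ℝ) ^ k * K ^ m := by positivity
  rcases hw v with h | ⟨h, a, rfl, ha, hak⟩
  · have hc := sum_rpow_le_card (ch v) h0 h1 f (fun i _ => hf i)
    rw [hcard] at hc
    have hs : (∑ u ∈ ch v, f u) ^ (1 - θ) ≤ f v ^ (1 - θ) :=
      Real.rpow_le_rpow (Finset.sum_nonneg fun i _ => hf i) (hsum v) (by linarith)
    have hNN : ((N : ℝ)⁻¹) ^ θ * (N : ℝ) ^ θ = 1 := by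
      rw [← Real.mul_rpow (by positivity) (by positivity), inv_mul_cancel₀ (by positivity),
        Real.one_rpow]
    calc treeSum ch w (fun v => f v ^ (1 - θ)) (m + 1) v
        = ((N : ℝ)⁻¹) ^ θ * ∑ u ∈ ch v, treeSum ch w (fun v => f v ^ (1 - θ)) m u := by
          rw [treeSum, h]
      _ ≤ ((N : ℝ)⁻¹) ^ θ * ∑ u ∈ ch v, (N : ℝ) ^ k * K ^ m * f u ^ (1 - θ) := by
          gcongr with u hu
          exact ih m (by omega) u
      _ ≤ ((N : ℝ)⁻¹) ^ θ * ((N : ℝ) ^ k * K ^ m * (f v ^ (1 - θ) * (N : ℝ) ^ θ)) := by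
          rw [← Finset.mul_sum]
          gcongr
          exact hc.trans (by gcongr)
      _ = (N : ℝ) ^ k * K ^ m * f v ^ (1 - θ) := by
          linear_combination ((N : ℝ) ^ k * K ^ m * f v ^ (1 - θ)) * hNN
      _ ≤ _ := by
          refine mul_le_mul_of_nonneg_right ?_ (hfθ v)
          gcongr
          omega
  · have hpath := treeSum_le_of_path h0 h1 hb.le hN hD hf hsum hcard hw0 hwb k (m + 1) a ha
      (by omega) (fun m' u hm' => (ih m' (by omega) u).trans (by
        refine mul_le_mul_of_nonneg_right ?_ (hfθ u)
        gcongr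
        omega))
    refine hpath.trans ?_
    have key : (f (a 0) - f (a k)) ^ (1 - θ) *
          (((N : ℝ) - 1) * ∑ i ∈ Finset.range k, b ^ (i + 1)) ^ θ
        + f (a k) ^ (1 - θ) * (b ^ k) ^ θ ≤ K * f (a 0) ^ (1 - θ) := by
      rcases (hf (a 0)).eq_or_lt with hz | hpos
      · have hz' : f (a k) = 0 := le_antisymm (by simpa [← hz] using hak) (hf _)
        simp [← hz, hz', Real.zero_rpow (show (1 - θ) ≠ 0 by linarith)]
      · set p := f (a k) / f (a 0) with hp
        have hp0 : 0 ≤ p := div_nonneg (hf _) hpos.le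
        have hpε : p ≤ ε := by rwa [hp, div_le_iff₀ hpos]
        have hanti : ∀ i, f (a (i + 1)) ≤ f (a i) := fun i =>
          (Finset.single_le_sum (fun i _ => hf i) (ha i)).trans (hsum _)
        have hp1 : p ≤ 1 := by
          rw [hp, div_le_one hpos]
          exact antitone_nat_of_succ_le (f := fun i => f (a i)) hanti (Nat.zero_le k)
        have e1 : f (a k) = p * f (a 0) := by rw [hp]; field_simp
        have e2 : f (a 0) - f (a k) = (1 - p) * f (a 0) := by rw [e1]; ring
        rw [e2, e1, Real.mul_rpow hp0 hpos.le, Real.mul_rpow (by linarith) hpos.le]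
        have := mul_le_mul_of_nonneg_right (hK p hp0 hpε) (hfθ (a 0))
        linarith
    calc _ ≤ (N : ℝ) ^ k * K ^ m * (K * f (a 0) ^ (1 - θ)) := mul_le_mul_of_nonneg_left key hD
      _ = _ := by ring

end Tree

theorem one_le_two_pow_sub_one {d : ℕ} (hd : 1 ≤ d) : (1 : ℝ) ≤ (2 : ℝ) ^ d - 1 := by
  have : (2 : ℝ) ^ 1 ≤ 2 ^ d := pow_le_pow_right₀ (by norm_num) hd
  linarith

theorem lt_one_of_le_two_pow_inv {d k : ℕ} (hd : 1 ≤ d) (hk : 1 ≤ k) {ε : ℝ}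
    (hε : ε ≤ ((2 : ℝ) ^ (k * d))⁻¹) : ε < 1 := by
  have : (1 : ℝ) < 2 ^ (k * d) := one_lt_pow₀ (by norm_num) (Nat.mul_pos hk hd).ne'
  exact hε.trans_lt (inv_lt_one_of_one_lt₀ this)

/-- `sdk d k ε` lies in `[0, d]` and solves its defining equation. -/
theorem sdk_spec {d k : ℕ} (hd : 1 ≤ d) (hk : 1 ≤ k) {ε : ℝ} (hε0 : 0 ≤ ε)
    (hε : ε ≤ ((2 : ℝ) ^ (k * d))⁻¹) :
    0 ≤ sdk d k ε ∧ sdk d k ε ≤ d ∧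
    (1 - ε) * Real.log (((2 : ℝ) ^ d - 1) *
        (∑ i ∈ Finset.range k, (2 : ℝ) ^ (-(sdk d k ε * ((i : ℝ) + 1)))) / (1 - ε))
      + ε * Real.log (1 / ε) = sdk d k ε * ε * Real.log ((2 : ℝ) ^ k) := by
  have hε1 : 0 < 1 - ε := sub_pos.2 (lt_one_of_le_two_pow_inv hd hk hε)
  have hN := one_le_two_pow_sub_one hd
  have hne : (Finset.range k).Nonempty := Finset.nonempty_range_iff.2 (by omega)
  set σ : ℝ → ℝ := fun s => ∑ i ∈ Finset.range k, (2 : ℝ) ^ (-(s * ((i : ℝ) + 1))) with hσ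
  have hσpos : ∀ s, 0 < σ s := fun s => Finset.sum_pos (fun i _ => by positivity) hne
  set G : ℝ → ℝ := fun s => (1 - ε) * Real.log (((2 : ℝ) ^ d - 1) * σ s / (1 - ε))
      + ε * Real.log (1 / ε) - s * ε * Real.log ((2 : ℝ) ^ k) with hG
  have harg : ∀ s, 0 < ((2 : ℝ) ^ d - 1) * σ s / (1 - ε) := fun s => by
    have := hσpos s
    positivity
  have hlogk : 0 ≤ Real.log ((2 : ℝ) ^ k) := Real.log_nonneg (one_le_pow₀ (by norm_num))
  have hanti : StrictAnti G := by
    intro s t hst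
    have hσlt : σ t < σ s := by
      refine Finset.sum_lt_sum_of_nonempty hne fun i _ => ?_
      refine Real.rpow_lt_rpow_of_exponent_lt (by norm_num) ?_
      have : s * ((i : ℝ) + 1) < t * ((i : ℝ) + 1) := by gcongr
      linarith
    have h1 : Real.log (((2 : ℝ) ^ d - 1) * σ t / (1 - ε)) <
        Real.log (((2 : ℝ) ^ d - 1) * σ s / (1 - ε)) :=
      Real.log_lt_log (harg t) (by gcongr)
    have h2 := mul_lt_mul_of_pos_left h1 hε1
    have h3 : s * ε * Real.log ((2 : ℝ) ^ k) ≤ t * ε * Real.log ((2 : ℝ) ^ k) := by gcongr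
    simp only [hG]
    linarith
  have hσcont : Continuous σ := by
    refine continuous_finsetSum _ fun i _ => ?_
    exact Continuous.rpow continuous_const (by fun_prop) (fun _ => Or.inl (by norm_num))
  have hcont : Continuous G := by
    have : Continuous fun s => Real.log (((2 : ℝ) ^ d - 1) * σ s / (1 - ε)) :=
      Continuous.log (by fun_prop) fun s => (harg s).ne'
    fun_prop
  have hG0 : 0 ≤ G 0 := by
    have h1 : 1 ≤ ((2 : ℝ) ^ d - 1) * σ 0 / (1 - ε) := by
      have hk' : (1 : ℝ) ≤ k := by exact_mod_cast hk
      have hσ0 : σ 0 = k := by simp [hσ]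
      rw [hσ0, le_div_iff₀ hε1]
      nlinarith
    have h2 : 0 ≤ ε * Real.log (1 / ε) := by
      rcases hε0.eq_or_lt with rfl | hpos
      · simp
      · refine mul_nonneg hε0 (Real.log_nonneg ?_)
        rw [le_div_iff₀ hpos]
        linarith
    have h3 := mul_nonneg hε1.le (Real.log_nonneg h1)
    simp only [hG]
    linarith
  have hσd : ((2 : ℝ) ^ d - 1) * σ d = 1 - ((2 : ℝ) ^ (k * d))⁻¹ := by
    have e : ∀ i : ℕ, (2 : ℝ) ^ (-((d : ℝ) * ((i : ℝ) + 1))) = ((2 : ℝ) ^ d)⁻¹ ^ (i + 1) := by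
      intro i
      rw [Real.rpow_neg (by norm_num), inv_pow, ← pow_mul, ← Real.rpow_natCast]
      push_cast
      rfl
    have hx : ((2 : ℝ) ^ d)⁻¹ * (2 : ℝ) ^ d = 1 := inv_mul_cancel₀ (by positivity)
    have hgeom := mul_neg_geom_sum ((2 : ℝ) ^ d)⁻¹ k
    simp only [hσ, e, pow_succ _ _, ← Finset.sum_mul]
    rw [mul_comm k d, pow_mul, ← inv_pow _ k, ← hgeom]
    linear_combination (∑ i ∈ Finset.range k, ((2 : ℝ) ^ d)⁻¹ ^ i) * hx
  have hGd : G d ≤ 0 := by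
    have h1 := Real.log_le_sub_one_of_pos (harg d)
    have h2 := mul_le_mul_of_nonneg_left h1 hε1.le
    rw [hσd, mul_sub, mul_div_cancel₀ _ hε1.ne', mul_one] at h2
    simp only [hG, hσd]
    rcases hε0.eq_or_lt with rfl | hpos
    · have : (0 : ℝ) ≤ ((2 : ℝ) ^ (k * d))⁻¹ := by positivity
      simp at h2 ⊢
      linarith
    · have h3 : ε * Real.log (((2 : ℝ) ^ (k * d))⁻¹ / ε) ≤ ((2 : ℝ) ^ (k * d))⁻¹ - ε := by
        have := mul_le_mul_of_nonneg_left
          (Real.log_le_sub_one_of_pos (show 0 < ((2 : ℝ) ^ (k * d))⁻¹ / ε by positivity)) hε0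
        rwa [mul_sub, mul_div_cancel₀ _ hpos.ne', mul_one] at this
      have h4 : Real.log (((2 : ℝ) ^ (k * d))⁻¹ / ε) =
          Real.log (1 / ε) - d * Real.log ((2 : ℝ) ^ k) := by
        rw [Real.log_div (by positivity) hpos.ne', Real.log_inv, one_div, Real.log_inv,
          Real.log_pow, Real.log_pow]
        push_cast
        ring
      rw [h4] at h3
      linarith
  obtain ⟨s, hs, hs0⟩ := intermediate_value_Icc' (Nat.cast_nonneg d) hcont.continuousOn
    (show (0 : ℝ) ∈ Icc (G d) (G 0) from ⟨hGd, hG0⟩)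
  have hset : {s : ℝ | (1 - ε) * Real.log (((2 : ℝ) ^ d - 1) * σ s / (1 - ε))
      + ε * Real.log (1 / ε) = s * ε * Real.log ((2 : ℝ) ^ k)} = {s} := by
    ext t
    rw [mem_ofPred_eq, mem_singleton_iff, ← sub_eq_zero]
    exact ⟨fun h => hanti.injective (h.trans hs0.symm), fun h => h ▸ hs0⟩
  have hsdk : sdk d k ε = s := by
    rw [sdk, hset, csSup_singleton]
  rw [hsdk]
  exact ⟨hs.1, hs.2, sub_eq_zero.1 hs0⟩

/-- A perturbed form of the entropy inequality
`(1 - p) * log (A / (1 - p)) + p * log (B / p) ≤ 0` for `p ≤ ε`. -/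
theorem exists_rpow_add_rpow_le {ε A B : ℝ} (hε0 : 0 ≤ ε) (hε1 : ε < 1) (hA : 0 < A)
    (hB : 0 < B) (hεB : ε ≤ B)
    (heq : (1 - ε) * Real.log (A / (1 - ε)) + ε * Real.log (1 / ε) = -(ε * Real.log B))
    {δ : ℝ} (hδ : 0 < δ) :
    ∃ θ, 0 < θ ∧ θ < 1 ∧ ∀ p, 0 ≤ p → p ≤ ε →
      (1 - p) ^ (1 - θ) * A ^ θ + p ^ (1 - θ) * B ^ θ ≤ 1 + δ * θ := by
  rcases hε0.eq_or_lt with rfl | hpos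
  · refine ⟨1 / 2, by norm_num, by norm_num, fun p hp0 hp => ?_⟩
    obtain rfl : p = 0 := le_antisymm hp hp0
    have hA1 : A = 1 := Real.eq_one_of_pos_of_log_eq_zero hA (by simpa using heq)
    norm_num [hA1]
    exact hδ.le
  have h1ε : 0 < 1 - ε := by linarith
  set x := Real.log (A / (1 - ε)) with hx
  set y := Real.log (B / ε) with hy
  have hxy : (1 - ε) * x + ε * y = 0 := by
    rw [hy, Real.log_div hB.ne' hpos.ne']
    rw [one_div, Real.log_inv] at heq
    linarith
  have hy0 : 0 ≤ y := Real.log_nonneg (by rwa [le_div_iff₀ hpos, one_mul])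
  have hx0 : x ≤ 0 := by nlinarith
  set M := 1 + |x| + |y| with hM
  have hM1 : 1 ≤ M := by have := abs_nonneg x; have := abs_nonneg y; linarith
  have hMx : |x| ≤ M := by have := abs_nonneg y; linarith
  have hMy : |y| ≤ M := by have := abs_nonneg x; linarith
  set θ := min (1 / 2) (min (1 / M) (δ / M ^ 2)) with hθ
  have hθ0 : 0 < θ := by positivity
  have hθ1 : θ < 1 := (min_le_left _ _).trans_lt (by norm_num)
  have hθM : θ * M ≤ 1 := by
    rw [← le_div_iff₀ (by positivity)]
    exact (min_le_right _ _).trans (min_le_left _ _)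
  have hθδ : θ * M ^ 2 ≤ δ := by
    rw [← le_div_iff₀ (by positivity)]
    exact (min_le_right _ _).trans (min_le_right _ _)
  have hexp : ∀ z : ℝ, |z| ≤ M → Real.exp (θ * z) ≤ 1 + θ * z + δ * θ := by
    intro z hz
    have habs : |θ * z| ≤ 1 := by
      rw [abs_mul, abs_of_pos hθ0]
      exact (mul_le_mul_of_nonneg_left hz hθ0.le).trans hθM
    have h1 := (abs_le.1 (Real.abs_exp_sub_one_sub_id_le habs)).2
    have h2 : z ^ 2 ≤ M ^ 2 := sq_le_sq' (by linarith [(abs_le.1 hz).1]) (abs_le.1 hz).2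
    have h3 : (θ * z) ^ 2 ≤ δ * θ := by
      calc (θ * z) ^ 2 = θ * (θ * z ^ 2) := by ring
        _ ≤ θ * (θ * M ^ 2) := by gcongr
        _ ≤ θ * δ := by gcongr
        _ = δ * θ := mul_comm _ _
    linarith
  refine ⟨θ, hθ0, hθ1, fun p hp0 hp => ?_⟩
  have hAθ : A ^ θ = (1 - ε) ^ θ * Real.exp (θ * x) := by
    rw [hx, mul_comm θ, Real.exp_mul, Real.exp_log (by positivity),
      ← Real.mul_rpow h1ε.le (by positivity), mul_div_cancel₀ _ h1ε.ne']
  have hBθ : B ^ θ = ε ^ θ * Real.exp (θ * y) := by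
    rw [hy, mul_comm θ, Real.exp_mul, Real.exp_log (by positivity),
      ← Real.mul_rpow hpos.le (by positivity), mul_div_cancel₀ _ hpos.ne']
  have hg1 := Real.geom_mean_le_arith_mean2_weighted (sub_nonneg.2 hθ1.le) hθ0.le
    (show 0 ≤ 1 - p by linarith) h1ε.le (by ring)
  have hg2 := Real.geom_mean_le_arith_mean2_weighted (sub_nonneg.2 hθ1.le) hθ0.le
    hp0 hpos.le (by ring)
  set q := (1 - θ) * p + θ * ε with hq
  have hqε : q ≤ ε := by nlinarith
  have hq0 : 0 ≤ q := by have := sub_nonneg.2 hθ1.le; positivity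
  have e1 : (1 - θ) * (1 - p) + θ * (1 - ε) = 1 - q := by rw [hq]; ring
  rw [e1] at hg1
  have h1q : 0 ≤ 1 - q := by linarith
  have hlin : (1 - q) * x + q * y ≤ 0 := by nlinarith
  calc (1 - p) ^ (1 - θ) * A ^ θ + p ^ (1 - θ) * B ^ θ
      = ((1 - p) ^ (1 - θ) * (1 - ε) ^ θ) * Real.exp (θ * x)
        + (p ^ (1 - θ) * ε ^ θ) * Real.exp (θ * y) := by rw [hAθ, hBθ]; ring
    _ ≤ (1 - q) * Real.exp (θ * x) + q * Real.exp (θ * y) := by gcongr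
    _ ≤ (1 - q) * (1 + θ * x + δ * θ) + q * (1 + θ * y + δ * θ) := by
        gcongr
        · exact hexp x hMx
        · exact hexp y hMy
    _ = 1 + δ * θ + θ * ((1 - q) * x + q * y) := by ring
    _ ≤ _ := by nlinarith

theorem mem_dyadicCube_self {d n : ℕ} (x : EuclideanSpace ℝ (Fin d)) : x ∈ dyadicCube d n x :=
  fun _ => rfl

theorem floor_two_mul (t : ℝ) : ⌊2 * t⌋ = 2 * ⌊t⌋ ∨ ⌊2 * t⌋ = 2 * ⌊t⌋ + 1 := by
  have h1 := Int.floor_le t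
  have h2 := Int.lt_floor_add_one t
  have h3 : 2 * ⌊t⌋ ≤ ⌊2 * t⌋ := Int.le_floor.2 (by push_cast; linarith)
  have h4 : ⌊2 * t⌋ < 2 * ⌊t⌋ + 2 := Int.floor_lt.2 (by push_cast; linarith)
  omega

/-- The vertex of the dyadic tree given by the cube of level `n` containing `x`. -/
noncomputable def dyadicNode {d : ℕ} (n : ℕ) (x : EuclideanSpace ℝ (Fin d)) : ℕ × (Fin d → ℤ) :=
  (n, fun j => ⌊(2 : ℝ) ^ n * x j⌋)

/-- The dyadic cube with level `v.1` and integer coordinates `v.2`. -/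
def nodeCube {d : ℕ} (v : ℕ × (Fin d → ℤ)) : Set (EuclideanSpace ℝ (Fin d)) :=
  {y | ∀ j, ⌊(2 : ℝ) ^ v.1 * y j⌋ = v.2 j}

/-- The dyadic subcubes one level below a given dyadic cube. -/
def nodeChildren {d : ℕ} (v : ℕ × (Fin d → ℤ)) : Finset (ℕ × (Fin d → ℤ)) :=
  {v.1 + 1} ×ˢ Fintype.piFinset fun j => {2 * v.2 j, 2 * v.2 j + 1}

section Dyadic

variable {d : ℕ}

theorem nodeCube_dyadicNode (n : ℕ) (x : EuclideanSpace ℝ (Fin d)) :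
    nodeCube (dyadicNode n x) = dyadicCube d n x := rfl

theorem dyadicNode_eq {v : ℕ × (Fin d → ℤ)} {x : EuclideanSpace ℝ (Fin d)}
    (hx : x ∈ nodeCube v) : dyadicNode v.1 x = v :=
  Prod.ext rfl (funext hx)

theorem card_nodeChildren (v : ℕ × (Fin d → ℤ)) : (nodeChildren v).card = 2 ^ d := by
  simp [nodeChildren, Fintype.card_piFinset]

theorem mem_nodeChildren {v u : ℕ × (Fin d → ℤ)} :
    u ∈ nodeChildren v ↔ u.1 = v.1 + 1 ∧ ∀ j, u.2 j = 2 * v.2 j ∨ u.2 j = 2 * v.2 j + 1 := by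
  rw [nodeChildren, Finset.mem_product, Fintype.mem_piFinset, Finset.mem_singleton]
  simp only [Finset.mem_insert, Finset.mem_singleton]

theorem dyadicNode_succ_mem (n : ℕ) (x : EuclideanSpace ℝ (Fin d)) :
    dyadicNode (n + 1) x ∈ nodeChildren (dyadicNode n x) := by
  refine mem_nodeChildren.2 ⟨rfl, fun j => ?_⟩
  have h := floor_two_mul ((2 : ℝ) ^ n * x j)
  rwa [← mul_assoc, ← pow_succ'] at h

theorem nodeCube_subset {v u : ℕ × (Fin d → ℤ)} (hu : u ∈ nodeChildren v) :
    nodeCube u ⊆ nodeCube v := by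
  obtain ⟨h1, h2⟩ := mem_nodeChildren.1 hu
  intro x hx j
  have h := floor_two_mul ((2 : ℝ) ^ v.1 * x j)
  rw [← mul_assoc, ← pow_succ', ← h1, hx j] at h
  have := h2 j
  omega

theorem measurableSet_nodeCube (v : ℕ × (Fin d → ℤ)) : MeasurableSet (nodeCube v) := by
  have : nodeCube v = ⋂ j, (fun y : EuclideanSpace ℝ (Fin d) => ⌊(2 : ℝ) ^ v.1 * y j⌋) ⁻¹' {v.2 j} := by
    ext y
    simp [nodeCube]
  rw [this]
  refine MeasurableSet.iInter fun j => ?_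
  have hm : Measurable fun y : EuclideanSpace ℝ (Fin d) => ⌊(2 : ℝ) ^ v.1 * y j⌋ :=
    Int.measurable_floor.comp (by fun_prop)
  exact hm (measurableSet_singleton _)

theorem sum_nodeChildren_le (μ : Measure (EuclideanSpace ℝ (Fin d))) [IsFiniteMeasure μ]
    (v : ℕ × (Fin d → ℤ)) : ∑ u ∈ nodeChildren v, μ.real (nodeCube u) ≤ μ.real (nodeCube v) := by
  rw [← measureReal_biUnion_finset ?_ fun u _ => measurableSet_nodeCube u]
  · exact measureReal_mono (iUnion₂_subset fun u hu => nodeCube_subset hu)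
  · intro u hu u' hu' hne
    refine Set.disjoint_left.2 fun x hx hx' => hne ?_
    have h1 := (mem_nodeChildren.1 hu).1
    have h2 := (mem_nodeChildren.1 hu').1
    rw [← dyadicNode_eq hx, ← dyadicNode_eq hx', h1, h2]

theorem dyadicCube_succ_subset (n : ℕ) (x : EuclideanSpace ℝ (Fin d)) :
    dyadicCube d (n + 1) x ⊆ dyadicCube d n x :=
  nodeCube_subset (dyadicNode_succ_mem n x)

theorem antitone_dyadicCube (x : EuclideanSpace ℝ (Fin d)) :
    Antitone fun n => dyadicCube d n x :=
  antitone_nat_of_succ_le fun n => dyadicCube_succ_subset n x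

theorem unitCube_eq : unitCube d = nodeCube (0, 0) := by
  ext x
  simp [unitCube, nodeCube, Int.floor_eq_iff]

/-- Markov's inequality for the product of the weights along the path of a random point. -/
theorem mul_measureReal_le_treeSum (μ : Measure (EuclideanSpace ℝ (Fin d))) [IsFiniteMeasure μ]
    {θ : ℝ} (h0 : 0 < θ) (h1 : θ < 1) (w : ℕ × (Fin d → ℤ) → ℝ) (hw : ∀ v, 0 < w v) (m : ℕ)
    (v : ℕ × (Fin d → ℤ)) (c : ℝ) :
    c * μ.real {x | x ∈ nodeCube v ∧ c * μ.real (dyadicCube d (v.1 + m) x) ^ θ ≤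
      ∏ i ∈ Finset.range m, w (dyadicNode (v.1 + i) x)} ≤
    treeSum nodeChildren w (fun v => μ.real (nodeCube v) ^ (1 - θ)) m v := by
  induction m generalizing v c with
  | zero =>
    set s := {x | x ∈ nodeCube v ∧ c * μ.real (dyadicCube d (v.1 + 0) x) ^ θ ≤
      ∏ i ∈ Finset.range 0, w (dyadicNode (v.1 + i) x)} with hs
    have hf : 0 ≤ μ.real (nodeCube v) := measureReal_nonneg
    rw [treeSum]
    rcases le_or_gt c 0 with hc | hc
    · exact (mul_nonpos_of_nonpos_of_nonneg hc measureReal_nonneg).trans (Real.rpow_nonneg hf _)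
    rcases s.eq_empty_or_nonempty with he | ⟨x, hx⟩
    · rw [he, measureReal_empty, mul_zero]
      exact Real.rpow_nonneg hf _
    · have hx2 := hx.2
      rw [add_zero, ← nodeCube_dyadicNode, dyadicNode_eq hx.1, Finset.prod_range_zero] at hx2
      have hle : μ.real s ≤ μ.real (nodeCube v) := measureReal_mono fun y hy => hy.1
      calc c * μ.real s ≤ c * μ.real (nodeCube v) := by gcongr
        _ = (c * μ.real (nodeCube v) ^ θ) * μ.real (nodeCube v) ^ (1 - θ) := by
          rw [mul_assoc, ← Real.rpow_add_of_nonneg hf h0.le (by linarith), add_sub_cancel,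
            Real.rpow_one]
        _ ≤ 1 * μ.real (nodeCube v) ^ (1 - θ) := by gcongr
        _ = _ := one_mul _
  | succ m ih =>
    set s : ℕ → ℕ × (Fin d → ℤ) → ℝ → Set (EuclideanSpace ℝ (Fin d)) := fun m v c =>
      {x | x ∈ nodeCube v ∧ c * μ.real (dyadicCube d (v.1 + m) x) ^ θ ≤
        ∏ i ∈ Finset.range m, w (dyadicNode (v.1 + i) x)} with hs
    have hnonneg : 0 ≤ treeSum nodeChildren w (fun v => μ.real (nodeCube v) ^ (1 - θ)) (m + 1) v :=
      treeSum_nonneg (fun v => (hw v).le) (fun v => Real.rpow_nonneg measureReal_nonneg _) _ _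
    rcases le_or_gt c 0 with hc | hc
    · exact (mul_nonpos_of_nonpos_of_nonneg hc measureReal_nonneg).trans hnonneg
    have hsub : s (m + 1) v c ⊆ ⋃ u ∈ nodeChildren v, s m u (c / w v) := by
      rintro x ⟨hxv, hx⟩
      have hv := dyadicNode_eq hxv
      refine mem_iUnion₂.2 ⟨dyadicNode (v.1 + 1) x, ?_, fun _ => rfl, ?_⟩
      · have := dyadicNode_succ_mem v.1 x
        rwa [hv] at this
      · rw [Finset.prod_range_succ', add_zero, hv] at hx
        rw [div_mul_eq_mul_div, div_le_iff₀ (hw v)]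
        simpa only [dyadicNode, add_assoc, add_comm, add_left_comm] using hx
    have hle : μ.real (s (m + 1) v c) ≤ ∑ u ∈ nodeChildren v, μ.real (s m u (c / w v)) :=
      (measureReal_mono hsub (measure_ne_top μ _)).trans (measureReal_biUnion_finset_le _ _)
    calc c * μ.real (s (m + 1) v c)
        ≤ c * ∑ u ∈ nodeChildren v, μ.real (s m u (c / w v)) := by gcongr
      _ = w v * ∑ u ∈ nodeChildren v, c / w v * μ.real (s m u (c / w v)) := by
          rw [← Finset.mul_sum, ← mul_assoc, mul_div_cancel₀ _ (hw v).ne']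
      _ ≤ _ := by
          rw [treeSum]
          gcongr with u hu
          · exact (hw v).le
          · exact ih u (c / w v)

end Dyadic

theorem dyadicCube_subset_closedBall {d n : ℕ} (hd : 1 ≤ d) (x : EuclideanSpace ℝ (Fin d)) {r : ℝ}
    (hr : d * ((2 : ℝ) ^ n)⁻¹ ≤ r) : dyadicCube d n x ⊆ closedBall x r := by
  intro y hy
  have hd' : (1 : ℝ) ≤ d := by exact_mod_cast hd
  refine mem_closedBall.2 (le_trans ?_ hr)
  rw [EuclideanSpace.dist_eq]
  refine Real.sqrt_le_iff.2 ⟨by positivity, ?_⟩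
  have h : ∀ j, dist (y j) (x j) ^ 2 ≤ (((2 : ℝ) ^ n)⁻¹) ^ 2 := by
    intro j
    have h1 := Int.abs_sub_lt_one_of_floor_eq_floor (hy j)
    rw [← mul_sub, abs_mul, abs_of_pos (by positivity : (0 : ℝ) < 2 ^ n)] at h1
    rw [Real.dist_eq]
    refine pow_le_pow_left₀ (abs_nonneg _) ?_ 2
    rw [← one_div, le_div_iff₀' (by positivity)]
    exact h1.le
  calc ∑ j, dist (y j) (x j) ^ 2 ≤ ∑ _j : Fin d, (((2 : ℝ) ^ n)⁻¹) ^ 2 :=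
        Finset.sum_le_sum fun j _ => h j
    _ = d * (((2 : ℝ) ^ n)⁻¹) ^ 2 := by simp
    _ ≤ d ^ 2 * (((2 : ℝ) ^ n)⁻¹) ^ 2 := by
        gcongr
        nlinarith
    _ = _ := by ring

/-- Lower bounds for the masses of the dyadic cubes at `x` bound the upper local dimension. -/
theorem upperLocalDim_le {d : ℕ} (hd : 1 ≤ d) (μ : Measure (EuclideanSpace ℝ (Fin d)))
    [IsProbabilityMeasure μ] (x : EuclideanSpace ℝ (Fin d)) {c : ℝ} (hc : 0 ≤ c)
    (h : ∀ᶠ n : ℕ in atTop, 0 < μ.real (dyadicCube d n x) ∧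
      -Real.log (μ.real (dyadicCube d n x)) ≤ n * (c * Real.log 2)) :
    upperLocalDim μ x ≤ c := by
  refine EReal.le_of_forall_lt_iff_le.1 fun z hz => ?_
  have hcz : c < z := EReal.coe_lt_coe_iff.1 hz
  obtain ⟨n₀, hn₀⟩ := eventually_atTop.1 h
  have hd' : (1 : ℝ) ≤ d := by exact_mod_cast hd
  have hlog2 : 0 < Real.log 2 := Real.log_pos (by norm_num)
  have hlogd : 0 ≤ Real.log d := Real.log_nonneg hd'
  set T : ℝ := max (n₀ * Real.log 2) (c * (Real.log d + Real.log 2) / (z - c)) with hT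
  refine limsup_le_of_le (h := ?_)
  have hlim := (Real.tendsto_log_nhdsNE_zero.mono_left
    (nhdsWithin_mono 0 fun r (hr : 0 < r) => hr.ne')).eventually_le_atBot (-T)
  filter_upwards [hlim, Ioo_mem_nhdsGT (zero_lt_one' ℝ)] with r hr hr01
  obtain ⟨hr0, hr1⟩ := hr01
  rw [EReal.coe_le_coe_iff]
  have hlogr : Real.log r < 0 := Real.log_neg hr0 hr1
  have hT1 : n₀ * Real.log 2 ≤ -Real.log r := (le_max_left _ _).trans (by linarith)
  have hT2 : c * (Real.log d + Real.log 2) ≤ -Real.log r * (z - c) :=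
    (div_le_iff₀ (sub_pos.2 hcz)).1 ((le_max_right _ _).trans (le_neg.2 hr))
  have hldr : Real.log (d / r) = Real.log d - Real.log r :=
    Real.log_div (by positivity) hr0.ne'
  set n := ⌈Real.log (d / r) / Real.log 2⌉₊ with hn
  have hn1 : Real.log (d / r) ≤ n * Real.log 2 := (div_le_iff₀ hlog2).1 (Nat.le_ceil _)
  have hn2 : n * Real.log 2 ≤ Real.log (d / r) + Real.log 2 := by
    have h0 : 0 ≤ Real.log (d / r) / Real.log 2 := div_nonneg (by linarith) hlog2.le
    have := (Nat.ceil_lt_add_one h0).le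
    rwa [div_add_one hlog2.ne', le_div_iff₀ hlog2] at this
  have hn3 : n₀ ≤ n := by
    have : (n₀ : ℝ) * Real.log 2 ≤ n * Real.log 2 := by linarith
    exact_mod_cast le_of_mul_le_mul_right this hlog2
  obtain ⟨hpos, hle⟩ := hn₀ n hn3
  have hsub : dyadicCube d n x ⊆ closedBall x r := by
    refine dyadicCube_subset_closedBall hd x ?_
    rw [← div_eq_mul_inv, div_le_comm₀ (by positivity) hr0, ← Real.log_le_log_iff (by positivity)
      (by positivity), Real.log_pow]
    exact hn1
  have hμ : Real.log (μ.real (dyadicCube d n x)) ≤ Real.log (μ (closedBall x r)).toReal :=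
    Real.log_le_log hpos (measureReal_mono hsub)
  rw [div_le_iff_of_neg hlogr]
  rw [hldr] at hn2
  have := mul_le_mul_of_nonneg_left hn2 hc
  linarith

section Porous

variable {d : ℕ} {μ : Measure (EuclideanSpace ℝ (Fin d))}

theorem dyadicCube_eq_of_mem {n : ℕ} {x y : EuclideanSpace ℝ (Fin d)}
    (h : y ∈ dyadicCube d n x) : dyadicCube d n y = dyadicCube d n x := by
  ext z
  exact forall_congr' fun j => by rw [h j]

theorem por2Le.of_mem_dyadicCube {n k : ℕ} {ε : ℝ} {x y : EuclideanSpace ℝ (Fin d)}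
    (h : y ∈ dyadicCube d n x) (hy : por2Le μ y n k ε) : por2Le μ x n k ε := by
  rwa [por2Le, dyadicCube_eq_of_mem h] at hy

/-- A porous cube has a descendant of small mass exactly `k` generations below. -/
theorem por2Le.exists_path [IsFiniteMeasure μ] {n k : ℕ} {ε : ℝ} (hε0 : 0 ≤ ε)
    {x : EuclideanSpace ℝ (Fin d)} (h : por2Le μ x n k ε) :
    ∃ a : ℕ → ℕ × (Fin d → ℤ), a 0 = dyadicNode n x ∧ (∀ i, a (i + 1) ∈ nodeChildren (a i)) ∧
      μ.real (nodeCube (a k)) ≤ ε * μ.real (dyadicCube d n x) := by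
  obtain ⟨j, -, hjk, y, hy, hμ⟩ := h
  refine ⟨fun i => dyadicNode (n + i) y, dyadicNode_eq (v := dyadicNode n x) hy,
    fun i => dyadicNode_succ_mem (n + i) y, ?_⟩
  have h1 : μ.real (dyadicCube d (n + k) y) ≤ μ.real (dyadicCube d (n + j) y) :=
    measureReal_mono (antitone_dyadicCube y (by omega))
  have h2 := ENNReal.toReal_mono (by finiteness) hμ
  rw [ENNReal.toReal_mul, ENNReal.toReal_ofReal hε0] at h2
  exact h1.trans h2

open Classical in
/-- If porous cubes get weight `2 ^ (-sθ)` and all others `2 ^ (-dθ)`, then almost every point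
has, at every large level, a cube of mass bounded below by the product of the weights above it. -/
theorem ae_eventually_log_measureReal_ge [IsProbabilityMeasure μ] {k : ℕ} {ε s δ : ℝ}
    (hk : 1 ≤ k) (hε0 : 0 ≤ ε) (hε1 : ε < 1) (hd : 1 ≤ d) (hs0 : 0 ≤ s) (hsd : s ≤ d)
    (hεs : ε ≤ ((2 : ℝ) ^ (-s)) ^ k)
    (hs : (1 - ε) * Real.log (((2 : ℝ) ^ d - 1) *
        (∑ i ∈ Finset.range k, ((2 : ℝ) ^ (-s)) ^ (i + 1)) / (1 - ε))
      + ε * Real.log (1 / ε) = -(ε * Real.log (((2 : ℝ) ^ (-s)) ^ k)))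
    (hsupp : μ (unitCube d) = 1) (hδ : 0 < δ) :
    ∀ᵐ x ∂μ, ∀ᶠ n : ℕ in atTop, 0 < μ.real (dyadicCube d n x) ∧
      -Real.log (μ.real (dyadicCube d n x)) ≤
        (d * n - (d - s) * (Set.ncard {i : ℕ | i < n ∧ por2Le μ x i k ε} : ℝ)) * Real.log 2
          + n * δ := by
  set b : ℝ := (2 : ℝ) ^ (-s) with hb
  have hb0 : 0 < b := by positivity
  have hb1 : b ≤ 1 := Real.rpow_le_one_of_one_le_of_nonpos (by norm_num) (by linarith)
  have hN := one_le_two_pow_sub_one hd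
  have hσ : 0 < ∑ i ∈ Finset.range k, b ^ (i + 1) :=
    Finset.sum_pos (fun i _ => by positivity) (Finset.nonempty_range_iff.2 (by omega))
  obtain ⟨θ, h0, h1, hθ⟩ := exists_rpow_add_rpow_le hε0 hε1
    (mul_pos (by linarith) hσ : 0 < ((2 : ℝ) ^ d - 1) * ∑ i ∈ Finset.range k, b ^ (i + 1))
    (pow_pos hb0 k) hεs hs (half_pos hδ)
  set K : ℝ := 1 + δ / 2 * θ with hK
  have hK1 : 1 < K := by
    have : 0 < δ / 2 * θ := by positivity
    linarith
  have hK0 : 0 < K := by linarith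
  set w : ℕ × (Fin d → ℤ) → ℝ := fun v =>
    if ∃ x, x ∈ nodeCube v ∧ por2Le μ x v.1 k ε then b ^ θ else (((2 : ℝ) ^ d)⁻¹) ^ θ with hw
  have hwpos : ∀ v, 0 < w v := fun v => by
    simp only [hw]
    split_ifs <;> positivity
  have hwnode : ∀ n x, w (dyadicNode n x) =
      if por2Le μ x n k ε then b ^ θ else (((2 : ℝ) ^ d)⁻¹) ^ θ := fun n x => by
    have : (∃ y, y ∈ nodeCube (dyadicNode n x) ∧ por2Le μ y n k ε) ↔ por2Le μ x n k ε :=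
      ⟨fun ⟨y, hy, h⟩ => h.of_mem_dyadicCube hy, fun h => ⟨x, mem_dyadicCube_self x, h⟩⟩
    exact if_congr this rfl rfl
  have hNb : ((2 ^ d : ℕ) : ℝ)⁻¹ ≤ b := by
    rw [hb, Real.rpow_neg (by norm_num)]
    push_cast
    rw [← Real.rpow_natCast]
    gcongr
    norm_num
  have hsum : ∀ m, treeSum nodeChildren w (fun v => μ.real (nodeCube v) ^ (1 - θ)) m (0, 0) ≤
      ((2 : ℝ) ^ d) ^ k * K ^ m := fun m => by
    have h := treeSum_le (ch := nodeChildren (d := d)) (w := w) (f := fun v => μ.real (nodeCube v))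
      (ε := ε) h0 h1 hb0 hb1 Nat.one_le_two_pow hk hK1.le hNb (fun v => measureReal_nonneg)
      (sum_nodeChildren_le μ) card_nodeChildren ?_ (by simpa using hθ) m (0, 0)
    · have h2 : μ.real (nodeCube ((0, 0) : ℕ × (Fin d → ℤ))) = 1 := by
        rw [← unitCube_eq, Measure.real, hsupp, ENNReal.toReal_one]
      rw [h2, Real.one_rpow, mul_one] at h
      exact_mod_cast h
    · intro v
      by_cases hv : ∃ x, x ∈ nodeCube v ∧ por2Le μ x v.1 k ε
      · right
        refine ⟨if_pos hv, ?_⟩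
        obtain ⟨x, hx, hpor⟩ := hv
        obtain ⟨a, ha0, ha, hak⟩ := hpor.exists_path hε0
        rw [← nodeCube_dyadicNode, dyadicNode_eq hx] at hak
        exact ⟨a, ha0.trans (dyadicNode_eq hx), ha, hak⟩
      · left
        push_cast
        exact if_neg hv
  set s' : ℕ → Set (EuclideanSpace ℝ (Fin d)) := fun n =>
    {x | x ∈ nodeCube (0, 0) ∧ K ^ (2 * n) * μ.real (dyadicCube d (0 + n) x) ^ θ ≤
      ∏ i ∈ Finset.range n, w (dyadicNode (0 + i) x)} with hs'
  have hbad : ∀ n, μ (s' n) ≤ ENNReal.ofReal (((2 : ℝ) ^ d) ^ k * K⁻¹ ^ n) := fun n => by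
    rw [← ofReal_measureReal]
    refine ENNReal.ofReal_le_ofReal ?_
    have h := (mul_measureReal_le_treeSum μ h0 h1 w hwpos n (0, 0) (K ^ (2 * n))).trans (hsum n)
    rw [← le_div_iff₀' (by positivity)] at h
    refine h.trans_eq ?_
    rw [two_mul, pow_add, inv_pow]
    field_simp
  have hsummable : Summable fun n : ℕ => ((2 : ℝ) ^ d) ^ k * K⁻¹ ^ n :=
    (summable_geometric_of_lt_one (by positivity) (inv_lt_one_of_one_lt₀ hK1)).mul_left _
  have hBC : ∀ᵐ x ∂μ, ∀ᶠ n in atTop, x ∉ s' n :=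
    ae_eventually_notMem (ne_top_of_le_ne_top hsummable.tsum_ofReal_ne_top
      (ENNReal.tsum_le_tsum hbad))
  have hunit : ∀ᵐ x ∂μ, x ∈ nodeCube ((0, 0) : ℕ × (Fin d → ℤ)) :=
    (mem_ae_iff_prob_eq_one (measurableSet_nodeCube _)).2 (by rw [← unitCube_eq, hsupp])
  filter_upwards [hBC, hunit] with x hx hxu
  filter_upwards [hx] with n hn
  have hn' : ∏ i ∈ Finset.range n, w (dyadicNode i x) <
      K ^ (2 * n) * μ.real (dyadicCube d n x) ^ θ := by
    by_contra! hcon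
    exact hn ⟨hxu, by simpa using hcon⟩
  have hprod : 0 < ∏ i ∈ Finset.range n, w (dyadicNode i x) := Finset.prod_pos fun i _ => hwpos _
  have hpos : 0 < μ.real (dyadicCube d n x) := by
    refine measureReal_nonneg.lt_of_ne fun hz => ?_
    rw [← hz, Real.zero_rpow h0.ne', mul_zero] at hn'
    linarith
  refine ⟨hpos, ?_⟩
  have hlog := Real.log_le_log hprod hn'.le
  rw [Real.log_mul (by positivity) (by positivity), Real.log_rpow hpos, Real.log_pow,
    Real.log_prod fun i _ => (hwpos _).ne'] at hlog
  have hlogw : ∀ i, Real.log (w (dyadicNode i x)) =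
      -(θ * Real.log 2) * (d - (d - s) * if por2Le μ x i k ε then 1 else 0) := fun i => by
    rw [hwnode]
    split_ifs
    · rw [Real.log_rpow hb0, hb, Real.log_rpow (by norm_num)]
      ring
    · rw [Real.log_rpow (by positivity), Real.log_inv, Real.log_pow]
      ring
  have hcard : (∑ i ∈ Finset.range n, if por2Le μ x i k ε then (1 : ℝ) else 0) =
      (Set.ncard {i : ℕ | i < n ∧ por2Le μ x i k ε} : ℝ) := by
    rw [Finset.sum_boole, ← Set.ncard_coe_finset]
    simp
  simp only [hlogw] at hlog
  rw [← Finset.mul_sum, Finset.sum_sub_distrib, ← Finset.mul_sum, hcard, Finset.sum_const,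
    Finset.card_range, nsmul_eq_mul] at hlog
  have hlogK : Real.log K ≤ δ / 2 * θ := by
    have := Real.log_le_sub_one_of_pos hK0
    linarith
  have hnK : (2 * n : ℝ) * Real.log K ≤ 2 * n * (δ / 2 * θ) := by gcongr
  push_cast at hlog
  refine le_of_mul_le_mul_left ?_ h0
  linarith

end Porous

/-- Let `d, k ≥ 1` and `ε ∈ [0, 2^{-kd}]`. If `μ` is a dyadic mean
`(k,η,ε)`-porous Borel probability measure on `[0,1)^d` with `0 < η ≤ 1`, then
`dim_P(μ) ≤ d − η·t_{d,k}(ε)`. -/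
theorem packingDim_le_of_dyadicMeanPorousWith (d k : ℕ) (hd : 1 ≤ d) (hk : 1 ≤ k)
    (ε η : ℝ) (hε0 : 0 ≤ ε) (hε : ε ≤ ((2 : ℝ) ^ (k * d))⁻¹) (hη : 0 < η) (hη' : η ≤ 1)
    (μ : Measure (EuclideanSpace ℝ (Fin d))) [IsProbabilityMeasure μ]
    (hsupp : μ (unitCube d) = 1)
    (hpor : DyadicMeanPorousWith μ k η ε) :
    packingDim μ ≤ (((d : ℝ) - η * tdk d k ε : ℝ) : EReal) := by
  obtain ⟨hs0, hsd, hs⟩ := sdk_spec hd hk hε0 hε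
  have hε1 := lt_one_of_le_two_pow_inv hd hk hε
  rw [tdk]
  set s := sdk d k ε
  have hpow : ∀ i : ℕ, ((2 : ℝ) ^ (-s)) ^ i = (2 : ℝ) ^ (-(s * i)) := fun i => by
    rw [← Real.rpow_natCast, ← Real.rpow_mul (by norm_num), neg_mul]
  have hεs : ε ≤ ((2 : ℝ) ^ (-s)) ^ k := by
    refine hε.trans ?_
    rw [hpow, ← Real.rpow_natCast, ← Real.rpow_neg (by norm_num)]
    refine Real.rpow_le_rpow_of_exponent_le (by norm_num) (neg_le_neg ?_)
    push_cast
    rw [mul_comm]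
    gcongr
  have hs' : (1 - ε) * Real.log (((2 : ℝ) ^ d - 1) *
        (∑ i ∈ Finset.range k, ((2 : ℝ) ^ (-s)) ^ (i + 1)) / (1 - ε))
      + ε * Real.log (1 / ε) = -(ε * Real.log (((2 : ℝ) ^ (-s)) ^ k)) := by
    simp only [hpow, Nat.cast_add, Nat.cast_one]
    rw [hs, Real.log_rpow (by norm_num), Real.log_pow]
    ring
  have hlog2 : 0 < Real.log 2 := Real.log_pos (by norm_num)
  refine EReal.le_of_forall_lt_iff_le.1 fun z hz => ?_
  have hcz : d - η * (d - s) < z := EReal.coe_lt_coe_iff.1 hz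
  have hM : 0 < (d - s) + 1 / Real.log 2 := add_pos_of_nonneg_of_pos (by linarith) (by positivity)
  set δ := (z - (d - η * (d - s))) / ((d - s) + 1 / Real.log 2) with hδ
  have hδ0 : 0 < δ := div_pos (by linarith) hM
  have hδz : δ * ((d - s) + 1 / Real.log 2) = z - (d - η * (d - s)) := div_mul_cancel₀ _ hM.ne'
  have hδz' : z * Real.log 2 = (d - (d - s) * (η - δ)) * Real.log 2 + δ := by
    have : 1 / Real.log 2 * Real.log 2 = 1 := by field_simp
    linear_combination (-Real.log 2) * hδz + δ * this
  have hz0 : 0 ≤ z := by nlinarith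
  refine essSup_le_of_ae_le _ ?_
  filter_upwards [hpor,
    ae_eventually_log_measureReal_ge hk hε0 hε1 hd hs0 hsd hεs hs' hsupp hδ0] with x hx hx'
  refine upperLocalDim_le hd μ x hz0 ?_
  have hlim := eventually_lt_of_lt_liminf ((sub_lt_self η hδ0).trans_le hx)
    (isBoundedUnder_of ⟨0, fun n => by positivity⟩)
  filter_upwards [hx', hlim, eventually_gt_atTop 0] with n ⟨hpos, hle⟩ hn hn0
  refine ⟨hpos, hle.trans ?_⟩
  rw [lt_div_iff₀ (by exact_mod_cast hn0)] at hn
  have h1 := mul_le_mul_of_nonneg_left hn.le (sub_nonneg.2 hsd)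
  have h2 := mul_le_mul_of_nonneg_right h1 hlog2.le
  rw [hδz']
  linarith
end

section
/- Let d, k ≥ 1 be integers. Then t_{d,k}(ε) > 0 for every ε with 0 ≤ ε < 2^{-kd}; equivalently, s_{d,k}(ε) < d for all such ε. -/
open MeasureTheory Filter Metric Set
open scoped ENNReal NNReal

/-- The difference of the two sides of the equation defining `s_{d,k}(ε)`. -/
noncomputable def sdkGap (d k : ℕ) (ε s : ℝ) : ℝ :=
  (1 - ε) * Real.log (((2 : ℝ) ^ d - 1) *
      (∑ i ∈ Finset.range k, (2 : ℝ) ^ (-(s * ((i : ℝ) + 1)))) / (1 - ε))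
    + ε * Real.log (1 / ε) - s * ε * Real.log ((2 : ℝ) ^ k)

theorem sdkGap_strictAnti {d k : ℕ} (hd : 1 ≤ d) (hk : 1 ≤ k) {ε : ℝ}
    (hε0 : 0 ≤ ε) (hε1 : ε < 1) : StrictAnti (sdkGap d k ε) := by
  intro s t hst
  have hne : (Finset.range k).Nonempty := Finset.nonempty_range_iff.2 (by omega)
  have hpow : (0 : ℝ) < 2 ^ d - 1 := sub_pos.2 (one_lt_pow₀ one_lt_two (by omega))
  have hsum : ∑ i ∈ Finset.range k, (2 : ℝ) ^ (-(t * ((i : ℝ) + 1))) <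
      ∑ i ∈ Finset.range k, (2 : ℝ) ^ (-(s * ((i : ℝ) + 1))) := by
    refine Finset.sum_lt_sum_of_nonempty hne fun i _ => ?_
    exact Real.rpow_lt_rpow_of_exponent_lt one_lt_two
      (neg_lt_neg (mul_lt_mul_of_pos_right hst (by positivity)))
  have hpos : 0 < ∑ i ∈ Finset.range k, (2 : ℝ) ^ (-(t * ((i : ℝ) + 1))) :=
    Finset.sum_pos (fun i _ => by positivity) hne
  have h1 : 0 < 1 - ε := sub_pos.2 hε1
  have hlog := mul_lt_mul_of_pos_left (Real.log_lt_log (by positivity)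
    (div_lt_div_of_pos_right (mul_lt_mul_of_pos_left hsum hpow) h1)) h1
  have hlin : s * ε * Real.log ((2 : ℝ) ^ k) ≤ t * ε * Real.log ((2 : ℝ) ^ k) := by
    have : 0 ≤ Real.log ((2 : ℝ) ^ k) := Real.log_nonneg (one_le_pow₀ one_le_two)
    gcongr
  unfold sdkGap
  linarith

theorem sum_two_rpow_neg_mul (d k : ℕ) :
    ((2 : ℝ) ^ d - 1) * ∑ i ∈ Finset.range k, (2 : ℝ) ^ (-((d : ℝ) * ((i : ℝ) + 1))) =
      1 - ((2 : ℝ) ^ (k * d))⁻¹ := by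
  have hterm (i : ℕ) : (2 : ℝ) ^ (-((d : ℝ) * ((i : ℝ) + 1))) =
      ((2 : ℝ) ^ ((i + 1) * d))⁻¹ := by
    rw [Real.rpow_neg zero_le_two, ← Real.rpow_natCast]
    push_cast
    rw [mul_comm]
  simp_rw [hterm]
  induction k with
  | zero => simp
  | succ n ih =>
    rw [Finset.sum_range_succ, mul_add, ih, add_mul, one_mul, pow_add]
    field_simp
    ring

/-- Gibbs' inequality for two Bernoulli distributions, strict form. -/
theorem bernoulli_gibbs_neg {ε δ : ℝ} (hε0 : 0 ≤ ε) (hεδ : ε < δ) (hδ : δ < 1) :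
    (1 - ε) * Real.log ((1 - δ) / (1 - ε)) + ε * Real.log (1 / ε) + ε * Real.log δ < 0 := by
  have h1 : 0 < 1 - ε := by linarith
  have h2 : 0 < 1 - δ := by linarith
  have hfst : (1 - ε) * Real.log ((1 - δ) / (1 - ε)) < ε - δ := by
    have hne : (1 - δ) / (1 - ε) ≠ 1 := by
      rw [Ne, div_eq_one_iff_eq h1.ne']
      linarith
    have h := mul_lt_mul_of_pos_left (Real.log_lt_sub_one_of_pos (div_pos h2 h1) hne) h1
    rw [mul_sub, mul_div_cancel₀ _ h1.ne'] at h
    linarith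
  have hsnd : ε * Real.log (1 / ε) + ε * Real.log δ ≤ δ - ε := by
    rcases hε0.eq_or_lt with rfl | hpos
    · simpa using hεδ.le
    · have h := mul_le_mul_of_nonneg_left
        (Real.log_le_sub_one_of_pos (div_pos (hpos.trans hεδ) hpos)) hε0
      rw [mul_sub, mul_div_cancel₀ _ hpos.ne', Real.log_div (hpos.trans hεδ).ne' hpos.ne'] at h
      rw [one_div, Real.log_inv]
      linarith
  linarith

theorem sdkGap_self_neg {d k : ℕ} (hd : 1 ≤ d) (hk : 1 ≤ k) {ε : ℝ}
    (hε0 : 0 ≤ ε) (hε : ε < ((2 : ℝ) ^ (k * d))⁻¹) : sdkGap d k ε d < 0 := by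
  have hδ : ((2 : ℝ) ^ (k * d))⁻¹ < 1 :=
    inv_lt_one_of_one_lt₀ (one_lt_pow₀ one_lt_two (by positivity))
  have h := bernoulli_gibbs_neg hε0 hε hδ
  have hlog : Real.log ((2 : ℝ) ^ (k * d))⁻¹ = -(d * Real.log ((2 : ℝ) ^ k)) := by
    rw [Real.log_inv, pow_mul, Real.log_pow]
  rw [hlog] at h
  rw [sdkGap, sum_two_rpow_neg_mul]
  linarith

/-- For integers `d, k ≥ 1` and `0 ≤ ε < 2^{-kd}` one has `t_{d,k}(ε) > 0`;
equivalently `s_{d,k}(ε) < d`. -/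
theorem tdk_pos (d k : ℕ) (hd : 1 ≤ d) (hk : 1 ≤ k) (ε : ℝ)
    (hε0 : 0 ≤ ε) (hε : ε < ((2 : ℝ) ^ (k * d))⁻¹) :
    0 < tdk d k ε ∧ sdk d k ε < d := by
  have hε1 : ε < 1 := hε.trans_le (inv_le_one_of_one_le₀ (one_le_pow₀ one_le_two))
  have hanti := sdkGap_strictAnti hd hk hε0 hε1
  have hset : sdk d k ε = sSup {s | sdkGap d k ε s = 0} := by
    simp only [sdk, sdkGap, sub_eq_zero]
  have hlt : sdk d k ε < d := by
    rw [hset]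
    have hsub : {s | sdkGap d k ε s = 0}.Subsingleton := fun s hs t ht =>
      hanti.injective (hs.trans ht.symm)
    rcases hsub.eq_empty_or_singleton with h | ⟨s, h⟩
    · rw [h, Real.sSup_empty]
      exact_mod_cast hd
    · have hs : sdkGap d k ε s = 0 := h.ge (mem_singleton s)
      rw [h, csSup_singleton]
      exact hanti.lt_iff_gt.1 ((sdkGap_self_neg hd hk hε0 hε).trans_eq hs.symm)
  exact ⟨sub_pos.2 hlt, hlt⟩
end

section
/- Let δ > 0, let R* be a δ-regular tree of cubes with root [0,1)^d, and let μ be a Borel probability measure on [0,1)^d. Then dim_P(μ) equals the μ-essential supremum over x of limsup_{n→∞} ( Σ_{i=0}^{n-1} H(R_i(x)) ) / log(1/ℓ(R_n(x))). -/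
open MeasureTheory Filter Metric Set
open scoped ENNReal NNReal

/-- The half-open axis-parallel cube with corner `a` and side `l`. -/
def cubeSet {d : ℕ} (a : EuclideanSpace ℝ (Fin d)) (l : ℝ) : Set (EuclideanSpace ℝ (Fin d)) :=
  {y | ∀ j : Fin d, a j ≤ y j ∧ y j < a j + l}

/-- A `δ`-regular tree of half-open cubes with root `[0,1)^d`, encoded by the functions
`x ↦ R_n(x)` (given by a corner and a side length). At each level the cubes containing
points of the unit cube form a partition of their parent into finitely many cubes,
and all side ratios lie in `[δ, 1−δ]`. -/
structure CubeTree (d : ℕ) (δ : ℝ) where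
  corner : ℕ → EuclideanSpace ℝ (Fin d) → EuclideanSpace ℝ (Fin d)
  side : ℕ → EuclideanSpace ℝ (Fin d) → ℝ
  corner_zero : ∀ x ∈ unitCube d, corner 0 x = 0
  side_zero : ∀ x ∈ unitCube d, side 0 x = 1
  mem_node : ∀ n, ∀ x ∈ unitCube d, x ∈ cubeSet (corner n x) (side n x)
  side_pos : ∀ n, ∀ x ∈ unitCube d, 0 < side n x
  compat : ∀ n, ∀ x ∈ unitCube d, ∀ y ∈ unitCube d,
    y ∈ cubeSet (corner n x) (side n x) → corner n y = corner n x ∧ side n y = side n x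
  nested : ∀ n, ∀ x ∈ unitCube d,
    cubeSet (corner (n + 1) x) (side (n + 1) x) ⊆ cubeSet (corner n x) (side n x)
  regular : ∀ n, ∀ x ∈ unitCube d,
    δ ≤ side (n + 1) x / side n x ∧ side (n + 1) x / side n x ≤ 1 - δ
  finiteChildren : ∀ n, ∀ x ∈ unitCube d,
    Set.Finite {c : EuclideanSpace ℝ (Fin d) × ℝ |
      ∃ y ∈ unitCube d, y ∈ cubeSet (corner n x) (side n x) ∧
        c = (corner (n + 1) y, side (n + 1) y)}

/-- The cube `R_n(x)` of the tree, as a set. -/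
def CubeTree.node {d : ℕ} {δ : ℝ} (T : CubeTree d δ) (n : ℕ)
    (x : EuclideanSpace ℝ (Fin d)) : Set (EuclideanSpace ℝ (Fin d)) :=
  cubeSet (T.corner n x) (T.side n x)

/-- The offspring of the cube `R_n(x)`, as (corner, side) pairs. -/
def CubeTree.children {d : ℕ} {δ : ℝ} (T : CubeTree d δ) (n : ℕ)
    (x : EuclideanSpace ℝ (Fin d)) : Set (EuclideanSpace ℝ (Fin d) × ℝ) :=
  {c | ∃ y ∈ unitCube d, y ∈ T.node n x ∧ c = (T.corner (n + 1) y, T.side (n + 1) y)}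

/-- The entropy `H(R_n(x)) = Σ_{R ∈ R(Q)} μ^Q(R)·log(1/μ^Q(R))` where `μ^Q(R) = μ(R)/μ(Q)`. -/
noncomputable def treeEntropy {d : ℕ} {δ : ℝ} (μ : Measure (EuclideanSpace ℝ (Fin d)))
    (T : CubeTree d δ) (n : ℕ) (x : EuclideanSpace ℝ (Fin d)) : ℝ :=
  ∑ᶠ c ∈ T.children n x,
    Real.negMulLog ((μ (cubeSet c.1 c.2)).toReal / (μ (T.node n x)).toReal)

/-- The Lyapunov exponent `λ(R_n(x)) = Σ_{R ∈ R(Q)} μ^Q(R)·log(ℓ(Q)/ℓ(R))`. -/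
noncomputable def treeLyap {d : ℕ} {δ : ℝ} (μ : Measure (EuclideanSpace ℝ (Fin d)))
    (T : CubeTree d δ) (n : ℕ) (x : EuclideanSpace ℝ (Fin d)) : ℝ :=
  ∑ᶠ c ∈ T.children n x,
    ((μ (cubeSet c.1 c.2)).toReal / (μ (T.node n x)).toReal) * Real.log (T.side n x / c.2)

namespace CubeTree

variable {d : ℕ} {δ : ℝ} (T : CubeTree d δ)

/-- The pair (corner, side) describing the cube `R_n(x)`. -/
def key (n : ℕ) (x : EuclideanSpace ℝ (Fin d)) : EuclideanSpace ℝ (Fin d) × ℝ :=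
  (T.corner n x, T.side n x)

theorem node_zero {x : EuclideanSpace ℝ (Fin d)} (hx : x ∈ unitCube d) :
    T.node 0 x = unitCube d := by
  ext y
  simp [node, cubeSet, unitCube, T.corner_zero x hx, T.side_zero x hx]

theorem node_subset_unitCube (n : ℕ) {x : EuclideanSpace ℝ (Fin d)} (hx : x ∈ unitCube d) :
    T.node n x ⊆ unitCube d := by
  induction n with
  | zero => exact (T.node_zero hx).subset
  | succ n ih => exact (T.nested n x hx).trans ih

theorem mem_node_self (n : ℕ) {x : EuclideanSpace ℝ (Fin d)} (hx : x ∈ unitCube d) :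
    x ∈ T.node n x := T.mem_node n x hx

theorem node_succ_subset (n : ℕ) {x : EuclideanSpace ℝ (Fin d)} (hx : x ∈ unitCube d) :
    T.node (n + 1) x ⊆ T.node n x := T.nested n x hx

theorem key_eq_of_mem {n : ℕ} {x y : EuclideanSpace ℝ (Fin d)} (hx : x ∈ unitCube d)
    (hy : y ∈ T.node n x) : T.key n y = T.key n x := by
  obtain ⟨h1, h2⟩ := T.compat n x hx y (T.node_subset_unitCube n hx hy) hy
  simp [key, h1, h2]

theorem node_eq_of_key_eq {n : ℕ} {x y : EuclideanSpace ℝ (Fin d)}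
    (h : T.key n y = T.key n x) : T.node n y = T.node n x := by
  simp only [key, Prod.mk.injEq] at h
  simp [node, h.1, h.2]

theorem node_eq_of_mem {n : ℕ} {x y : EuclideanSpace ℝ (Fin d)} (hx : x ∈ unitCube d)
    (hy : y ∈ T.node n x) : T.node n y = T.node n x :=
  T.node_eq_of_key_eq (T.key_eq_of_mem hx hy)

theorem children_eq_of_mem {n : ℕ} {x y : EuclideanSpace ℝ (Fin d)} (hx : x ∈ unitCube d)
    (hy : y ∈ T.node n x) : T.children n y = T.children n x := by
  simp [children, T.node_eq_of_mem hx hy]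

theorem children_finite (n : ℕ) {x : EuclideanSpace ℝ (Fin d)} (hx : x ∈ unitCube d) :
    (T.children n x).Finite := T.finiteChildren n x hx

theorem mem_children_iff {n : ℕ} {x : EuclideanSpace ℝ (Fin d)}
    {c : EuclideanSpace ℝ (Fin d) × ℝ} (hx : x ∈ unitCube d) :
    c ∈ T.children n x ↔ ∃ y ∈ T.node n x, c = T.key (n + 1) y :=
  ⟨fun ⟨y, _, hy, h⟩ => ⟨y, hy, h⟩,
    fun ⟨y, hy, h⟩ => ⟨y, T.node_subset_unitCube n hx hy, hy, h⟩⟩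

/-- Every child of a node is the next-level node of each of its points. -/
theorem key_eq_of_mem_child {n : ℕ} {x z : EuclideanSpace ℝ (Fin d)}
    {c : EuclideanSpace ℝ (Fin d) × ℝ} (hx : x ∈ unitCube d) (hc : c ∈ T.children n x)
    (hz : z ∈ cubeSet c.1 c.2) : T.key (n + 1) z = c := by
  obtain ⟨y, hy, rfl⟩ := (T.mem_children_iff hx).1 hc
  exact T.key_eq_of_mem (T.node_subset_unitCube n hx hy) hz

theorem child_subset {n : ℕ} {x : EuclideanSpace ℝ (Fin d)}
    {c : EuclideanSpace ℝ (Fin d) × ℝ} (hx : x ∈ unitCube d) (hc : c ∈ T.children n x) :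
    cubeSet c.1 c.2 ⊆ T.node n x := by
  obtain ⟨y, hy, rfl⟩ := (T.mem_children_iff hx).1 hc
  rw [← T.node_eq_of_mem hx hy]
  exact T.node_succ_subset n (T.node_subset_unitCube n hx hy)

theorem exists_mem_child {n : ℕ} {x : EuclideanSpace ℝ (Fin d)}
    {c : EuclideanSpace ℝ (Fin d) × ℝ} (hx : x ∈ unitCube d) (hc : c ∈ T.children n x) :
    ∃ z ∈ unitCube d, z ∈ T.node n x ∧ T.key (n + 1) z = c ∧
      T.node (n + 1) z = cubeSet c.1 c.2 := by
  obtain ⟨y, hy, rfl⟩ := (T.mem_children_iff hx).1 hc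
  exact ⟨y, T.node_subset_unitCube n hx hy, hy, rfl, rfl⟩

theorem node_eq_biUnion (n : ℕ) {x : EuclideanSpace ℝ (Fin d)} (hx : x ∈ unitCube d) :
    T.node n x = ⋃ c ∈ (T.children_finite n hx).toFinset, cubeSet c.1 c.2 := by
  ext y
  simp only [Set.Finite.mem_toFinset, Set.mem_iUnion, exists_prop]
  constructor
  · intro hy
    exact ⟨T.key (n + 1) y, (T.mem_children_iff hx).2 ⟨y, hy, rfl⟩,
      T.mem_node_self (n + 1) (T.node_subset_unitCube n hx hy)⟩
  · rintro ⟨c, hc, hy⟩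
    exact T.child_subset hx hc hy

theorem pairwiseDisjoint_children (n : ℕ) {x : EuclideanSpace ℝ (Fin d)}
    (hx : x ∈ unitCube d) :
    ((T.children_finite n hx).toFinset : Set (EuclideanSpace ℝ (Fin d) × ℝ)).PairwiseDisjoint
      (fun c : EuclideanSpace ℝ (Fin d) × ℝ => cubeSet c.1 c.2) := by
  intro c hc c' hc' hne
  simp only [Set.Finite.coe_toFinset] at hc hc'
  refine Set.disjoint_left.2 fun z hz hz' => hne ?_
  rw [← T.key_eq_of_mem_child hx hc hz, T.key_eq_of_mem_child hx hc' hz']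

end CubeTree

theorem measurableSet_cubeSet {d : ℕ} (a : EuclideanSpace ℝ (Fin d)) (l : ℝ) :
    MeasurableSet (cubeSet a l) := by
  have : cubeSet a l =
      ⋂ j, ((fun y : EuclideanSpace ℝ (Fin d) => y j) ⁻¹' Set.Ico (a j) (a j + l)) := by
    ext y; simp [cubeSet]
  rw [this]
  refine MeasurableSet.iInter fun j => ?_
  exact (by fun_prop : Measurable fun y : EuclideanSpace ℝ (Fin d) => y j) measurableSet_Ico

theorem measurableSet_unitCube (d : ℕ) : MeasurableSet (unitCube d) := by
  have : unitCube d = cubeSet 0 1 := by ext y; simp [unitCube, cubeSet]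
  exact this ▸ measurableSet_cubeSet 0 1

theorem zero_mem_unitCube (d : ℕ) : (0 : EuclideanSpace ℝ (Fin d)) ∈ unitCube d := by
  simp [unitCube]

/-- The lattice point of mesh `h` with integer coordinates `m`. -/
noncomputable def latticePoint {d : ℕ} (h : ℝ) (m : Fin d → ℤ) : EuclideanSpace ℝ (Fin d) :=
  WithLp.toLp 2 fun i => h * m i

theorem latticePoint_mem_cubeSet {d : ℕ} {h l : ℝ} (hh : 0 < h) (hl : h ≤ l)
    (a : EuclideanSpace ℝ (Fin d)) :
    latticePoint h (fun i => ⌈a i / h⌉) ∈ cubeSet a l := by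
  intro i
  have h1 := Int.le_ceil (a i / h)
  have h2 := Int.ceil_lt_add_one (a i / h)
  rw [div_le_iff₀ hh] at h1
  have h3 : (a i / h + 1) * h = a i + h := by field_simp
  have h4 := mul_lt_mul_of_pos_right h2 hh
  simp only [latticePoint]
  constructor <;> linarith

namespace CubeTree

variable {d : ℕ} {δ : ℝ} (T : CubeTree d δ)

include T in
theorem delta_le_half : δ ≤ 1 / 2 := by
  have := T.regular 0 0 (zero_mem_unitCube d)
  linarith [this.1.trans this.2]

theorem side_succ_bounds (n : ℕ) {x : EuclideanSpace ℝ (Fin d)} (hx : x ∈ unitCube d) :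
    δ * T.side n x ≤ T.side (n + 1) x ∧ T.side (n + 1) x ≤ (1 - δ) * T.side n x := by
  have := T.regular n x hx
  have hp := T.side_pos n x hx
  rwa [le_div_iff₀ hp, div_le_iff₀ hp] at this

/-- A bound for the number of children of any node. -/
theorem exists_card_children_le (hδ : 0 < δ) : ∃ N : ℕ, ∀ n, ∀ x, ∀ hx : x ∈ unitCube d,
    (T.children_finite n hx).toFinset.card ≤ N := by
  refine ⟨∏ _i : Fin d, (⌈1 / δ⌉ + 1).toNat, fun n x hx => ?_⟩
  have hp := T.side_pos n x hx
  set h := δ * T.side n x with hh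
  have hh0 : 0 < h := by positivity
  let A : Fin d → ℤ := fun i => ⌈T.corner n x i / h⌉
  have key : ∀ c ∈ T.children n x,
      latticePoint h (fun i => ⌈c.1 i / h⌉) ∈ cubeSet c.1 c.2 := by
    intro c hc
    obtain ⟨z, hz, hz', rfl, -⟩ := T.exists_mem_child hx hc
    refine latticePoint_mem_cubeSet hh0 ?_ _
    have := (T.side_succ_bounds n hz).1
    have e : T.side n z = T.side n x := congrArg Prod.snd (T.key_eq_of_mem hx hz')
    rwa [e] at this
  have : (T.children_finite n hx).toFinset.card ≤
      (Finset.Icc A (fun i => A i + ⌈1 / δ⌉)).card := by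
    refine Finset.card_le_card_of_injOn (fun c i => ⌈c.1 i / h⌉) ?_ ?_
    · intro c hc
      simp only [Set.Finite.coe_toFinset] at hc
      have hm := T.child_subset hx hc (key c hc)
      simp only [Finset.coe_Icc, Set.mem_Icc, Pi.le_def]
      constructor
      · intro i
        have h1 := (hm i).1
        simp only [latticePoint] at h1
        rw [Int.ceil_le, div_le_iff₀ hh0]
        linarith
      · intro i
        have h1 := (hm i).2
        simp only [latticePoint] at h1
        have h2 := Int.le_ceil (T.corner n x i / h)
        have h3 := Int.le_ceil (1 / δ)
        rw [← Int.lt_add_one_iff, ← Int.cast_lt (R := ℝ)]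
        push_cast
        have h4 : (⌈c.1 i / h⌉ : ℝ) < T.corner n x i / h + 1 / δ := by
          rw [← mul_lt_mul_iff_right₀ hh0]
          calc h * (⌈c.1 i / h⌉ : ℝ) < _ := h1
            _ = _ := by rw [hh]; field_simp
        linarith
    · intro c hc c' hc' heq
      simp only [Set.Finite.coe_toFinset] at hc hc'
      have k1 := key c hc
      have k2 := key c' hc'
      simp only at heq
      rw [← heq] at k2
      rw [← T.key_eq_of_mem_child hx hc k1, T.key_eq_of_mem_child hx hc' k2]
  refine this.trans (le_of_eq ?_)
  rw [Pi.card_Icc]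
  refine Finset.prod_congr rfl fun i _ => ?_
  rw [Int.card_Icc]
  congr 1
  ring

end CubeTree

theorem mul_sq_log_le {p : ℝ} (h0 : 0 ≤ p) (h1 : p ≤ 1) : p * (-Real.log p) ^ 2 ≤ 4 := by
  rcases h0.eq_or_lt with rfl | hp
  · norm_num
  have h2 := Real.abs_log_mul_self_lt (√p) (Real.sqrt_pos.2 hp) (Real.sqrt_le_one.2 h1)
  have h3 : (Real.log (√p) * √p) ^ 2 < 1 := by
    rw [← sq_abs]
    exact pow_lt_one₀ (abs_nonneg _) h2 two_ne_zero
  rw [Real.log_sqrt hp.le, mul_pow, Real.sq_sqrt hp.le] at h3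
  nlinarith

namespace CubeTree

variable {d : ℕ} {δ : ℝ} (T : CubeTree d δ) (μ : Measure (EuclideanSpace ℝ (Fin d)))

/-- The information `log (1 / μ^Q(R))` of the child `R = R_{n+1}(y)` of `Q = R_n(y)`. -/
noncomputable def info (n : ℕ) (y : EuclideanSpace ℝ (Fin d)) : ℝ :=
  -Real.log (μ.real (T.node (n + 1) y) / μ.real (T.node n y))

/-- The sum of the `m` information deviations starting at level `n`. -/
noncomputable def deviation (m n : ℕ) (y : EuclideanSpace ℝ (Fin d)) : ℝ :=
  ∑ i ∈ Finset.range m, (T.info μ (n + i) y - treeEntropy μ T (n + i) y)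

theorem deviation_succ (m n : ℕ) (y : EuclideanSpace ℝ (Fin d)) :
    T.deviation μ (m + 1) n y =
      (T.info μ n y - treeEntropy μ T n y) + T.deviation μ m (n + 1) y := by
  rw [deviation, Finset.sum_range_succ', add_comm, deviation]
  simp [add_assoc, add_comm 1]

variable {μ}

theorem treeEntropy_eq_sum (n : ℕ) {x : EuclideanSpace ℝ (Fin d)} (hx : x ∈ unitCube d) :
    treeEntropy μ T n x = ∑ c ∈ (T.children_finite n hx).toFinset,
      Real.negMulLog (μ.real (cubeSet c.1 c.2) / μ.real (T.node n x)) := by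
  rw [treeEntropy, finsum_mem_eq_finite_toFinset_sum _ (T.children_finite n hx)]
  rfl

theorem treeEntropy_eq_of_mem {n : ℕ} {x y : EuclideanSpace ℝ (Fin d)} (hx : x ∈ unitCube d)
    (hy : y ∈ T.node n x) : treeEntropy μ T n y = treeEntropy μ T n x := by
  simp [treeEntropy, T.node_eq_of_mem hx hy, T.children_eq_of_mem hx hy]

theorem info_eq_of_mem_child {n : ℕ} {x z : EuclideanSpace ℝ (Fin d)}
    {c : EuclideanSpace ℝ (Fin d) × ℝ} (hx : x ∈ unitCube d) (hc : c ∈ T.children n x)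
    (hz : z ∈ cubeSet c.1 c.2) :
    T.info μ n z = -Real.log (μ.real (cubeSet c.1 c.2) / μ.real (T.node n x)) := by
  rw [info, T.node_eq_of_mem hx (T.child_subset hx hc hz)]
  have : T.node (n + 1) z = cubeSet c.1 c.2 := by
    rw [← T.key_eq_of_mem_child hx hc hz]; rfl
  rw [this]

variable [IsProbabilityMeasure μ]

theorem measureReal_node_eq_sum (n : ℕ) {x : EuclideanSpace ℝ (Fin d)} (hx : x ∈ unitCube d) :
    μ.real (T.node n x) =
      ∑ c ∈ (T.children_finite n hx).toFinset, μ.real (cubeSet c.1 c.2) := by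
  rw [T.node_eq_biUnion n hx]
  exact measureReal_biUnion_finset (T.pairwiseDisjoint_children n hx)
    fun c _ => measurableSet_cubeSet _ _

theorem prob_mem_Icc (n : ℕ) {x : EuclideanSpace ℝ (Fin d)} (hx : x ∈ unitCube d)
    {c : EuclideanSpace ℝ (Fin d) × ℝ} (hc : c ∈ T.children n x) :
    μ.real (cubeSet c.1 c.2) / μ.real (T.node n x) ∈ Set.Icc (0 : ℝ) 1 :=
  ⟨by positivity, div_le_one_of_le₀ (measureReal_mono (T.child_subset hx hc)) (by positivity)⟩

theorem treeEntropy_nonneg (n : ℕ) {x : EuclideanSpace ℝ (Fin d)} (hx : x ∈ unitCube d) :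
    0 ≤ treeEntropy μ T n x := by
  rw [T.treeEntropy_eq_sum n hx]
  refine Finset.sum_nonneg fun c hc => ?_
  have := T.prob_mem_Icc (μ := μ) n hx ((Set.Finite.mem_toFinset _).1 hc)
  exact Real.negMulLog_nonneg this.1 this.2

theorem treeEntropy_le {N : ℕ} (n : ℕ) {x : EuclideanSpace ℝ (Fin d)} (hx : x ∈ unitCube d)
    (hN : (T.children_finite n hx).toFinset.card ≤ N) : treeEntropy μ T n x ≤ N := by
  rw [T.treeEntropy_eq_sum n hx]
  refine (Finset.sum_le_card_nsmul _ _ 1 fun c hc => ?_).trans ?_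
  · have := T.prob_mem_Icc (μ := μ) n hx ((Set.Finite.mem_toFinset _).1 hc)
    linarith [Real.negMulLog_le_one_sub_self this.1, this.1]
  · simpa using hN

theorem measureReal_child_eq (n : ℕ) {x : EuclideanSpace ℝ (Fin d)} (hx : x ∈ unitCube d)
    {c : EuclideanSpace ℝ (Fin d) × ℝ} (hc : c ∈ T.children n x) :
    μ.real (cubeSet c.1 c.2) =
      μ.real (T.node n x) * (μ.real (cubeSet c.1 c.2) / μ.real (T.node n x)) := by
  rcases eq_or_ne (μ.real (T.node n x)) 0 with h | h
  · have : μ.real (cubeSet c.1 c.2) ≤ μ.real (T.node n x) :=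
      measureReal_mono (T.child_subset hx hc)
    rw [h] at this ⊢
    simp [le_antisymm this measureReal_nonneg]
  · field_simp

theorem sum_measure_mul_deviation (n : ℕ) {x : EuclideanSpace ℝ (Fin d)} (hx : x ∈ unitCube d) :
    ∑ c ∈ (T.children_finite n hx).toFinset, μ.real (cubeSet c.1 c.2) *
      (-Real.log (μ.real (cubeSet c.1 c.2) / μ.real (T.node n x)) - treeEntropy μ T n x) = 0 := by
  have h1 : ∑ c ∈ (T.children_finite n hx).toFinset, μ.real (cubeSet c.1 c.2) *
      (-Real.log (μ.real (cubeSet c.1 c.2) / μ.real (T.node n x))) =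
      μ.real (T.node n x) * treeEntropy μ T n x := by
    rw [T.treeEntropy_eq_sum n hx, Finset.mul_sum]
    refine Finset.sum_congr rfl fun c hc => ?_
    nth_rewrite 1 [T.measureReal_child_eq n hx ((Set.Finite.mem_toFinset _).1 hc)]
    rw [Real.negMulLog]
    ring
  simp only [mul_sub, Finset.sum_sub_distrib, ← Finset.sum_mul,
    ← T.measureReal_node_eq_sum n hx, h1, sub_self]

theorem sum_measure_mul_sq_deviation_le {N : ℕ} (n : ℕ) {x : EuclideanSpace ℝ (Fin d)}
    (hx : x ∈ unitCube d) (hN : (T.children_finite n hx).toFinset.card ≤ N) :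
    ∑ c ∈ (T.children_finite n hx).toFinset, μ.real (cubeSet c.1 c.2) *
      (-Real.log (μ.real (cubeSet c.1 c.2) / μ.real (T.node n x)) - treeEntropy μ T n x) ^ 2
      ≤ 4 * N * μ.real (T.node n x) := by
  set H := treeEntropy μ T n x with hH
  have h0 := T.sum_measure_mul_deviation (μ := μ) n hx
  rw [← hH] at h0
  have h1 : ∑ c ∈ (T.children_finite n hx).toFinset, μ.real (cubeSet c.1 c.2) *
      (-Real.log (μ.real (cubeSet c.1 c.2) / μ.real (T.node n x))) ^ 2 ≤
      4 * N * μ.real (T.node n x) := by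
    have : ∀ c ∈ (T.children_finite n hx).toFinset, μ.real (cubeSet c.1 c.2) *
      (-Real.log (μ.real (cubeSet c.1 c.2) / μ.real (T.node n x))) ^ 2 ≤
        4 * μ.real (T.node n x) := by
      intro c hc
      have hc' := (Set.Finite.mem_toFinset _).1 hc
      have hp := T.prob_mem_Icc (μ := μ) n hx hc'
      have := mul_le_mul_of_nonneg_left (mul_sq_log_le hp.1 hp.2)
        (measureReal_nonneg (μ := μ) (s := T.node n x))
      rw [← mul_assoc, ← T.measureReal_child_eq n hx hc'] at this
      linarith
    refine (Finset.sum_le_card_nsmul _ _ _ this).trans ?_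
    rw [nsmul_eq_mul]
    have : ((T.children_finite n hx).toFinset.card : ℝ) ≤ N := by exact_mod_cast hN
    have := mul_le_mul_of_nonneg_right this
      (by positivity : 0 ≤ 4 * μ.real (T.node n x))
    linarith
  refine le_trans ?_ h1
  have h2 : ∀ c : EuclideanSpace ℝ (Fin d) × ℝ, μ.real (cubeSet c.1 c.2) *
      (-Real.log (μ.real (cubeSet c.1 c.2) / μ.real (T.node n x)) - H) ^ 2 =
      μ.real (cubeSet c.1 c.2) *
        (-Real.log (μ.real (cubeSet c.1 c.2) / μ.real (T.node n x))) ^ 2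
      - 2 * H * (μ.real (cubeSet c.1 c.2) *
        (-Real.log (μ.real (cubeSet c.1 c.2) / μ.real (T.node n x)) - H))
      - H ^ 2 * μ.real (cubeSet c.1 c.2) := fun c => by ring
  simp only [h2, Finset.sum_sub_distrib, ← Finset.mul_sum, h0]
  have : 0 ≤ H ^ 2 * ∑ c ∈ (T.children_finite n hx).toFinset, μ.real (cubeSet c.1 c.2) := by
    positivity
  linarith

/-- Deviations over disjoint ranges of levels are centred and orthogonal on every node. -/
theorem deviation_moments {N : ℕ}
    (hN : ∀ n, ∀ x, ∀ hx : x ∈ unitCube d, (T.children_finite n hx).toFinset.card ≤ N)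
    (m : ℕ) : ∀ n, ∀ x ∈ unitCube d,
      IntegrableOn (T.deviation μ m n) (T.node n x) μ ∧
      IntegrableOn (fun y => T.deviation μ m n y ^ 2) (T.node n x) μ ∧
      ∫ y in T.node n x, T.deviation μ m n y ∂μ = 0 ∧
      ∫ y in T.node n x, T.deviation μ m n y ^ 2 ∂μ ≤ m * (4 * N * μ.real (T.node n x)) := by
  induction m with
  | zero =>
    intro n x hx
    have h0 : T.deviation μ 0 n = fun _ => 0 := by ext y; simp [deviation]
    simp [h0]
  | succ m ih =>
    intro n x hx
    let D : EuclideanSpace ℝ (Fin d) × ℝ → ℝ := fun c =>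
      -Real.log (μ.real (cubeSet c.1 c.2) / μ.real (T.node n x)) - treeEntropy μ T n x
    have hdev : ∀ c ∈ T.children n x, Set.EqOn (T.deviation μ (m + 1) n)
        (fun y => D c + T.deviation μ m (n + 1) y) (cubeSet c.1 c.2) := by
      intro c hc y hy
      simp only [T.deviation_succ, D]
      rw [T.info_eq_of_mem_child hx hc hy,
        T.treeEntropy_eq_of_mem hx (T.child_subset hx hc hy)]
    have hchild : ∀ c ∈ T.children n x,
        IntegrableOn (T.deviation μ (m + 1) n) (cubeSet c.1 c.2) μ ∧
        IntegrableOn (fun y => T.deviation μ (m + 1) n y ^ 2) (cubeSet c.1 c.2) μ ∧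
        ∫ y in cubeSet c.1 c.2, T.deviation μ (m + 1) n y ∂μ =
          μ.real (cubeSet c.1 c.2) * D c ∧
        ∫ y in cubeSet c.1 c.2, T.deviation μ (m + 1) n y ^ 2 ∂μ ≤
          μ.real (cubeSet c.1 c.2) * D c ^ 2 + m * (4 * N * μ.real (cubeSet c.1 c.2)) := by
      intro c hc
      have hm := measurableSet_cubeSet c.1 c.2
      obtain ⟨z, hz, -, -, hzc⟩ := T.exists_mem_child hx hc
      obtain ⟨i1, i2, i3, i4⟩ := ih (n + 1) z hz
      rw [hzc] at i1 i2 i3 i4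
      have e1 := hdev c hc
      have e2 : Set.EqOn (fun y => T.deviation μ (m + 1) n y ^ 2)
          (fun y => (D c ^ 2 + 2 * D c * T.deviation μ m (n + 1) y) +
            T.deviation μ m (n + 1) y ^ 2) (cubeSet c.1 c.2) := by
        intro y hy
        simp only [e1 hy]
        ring
      have k1 : IntegrableOn (fun _ => D c) (cubeSet c.1 c.2) μ := integrableOn_const
      have k2 : IntegrableOn (fun _ => D c ^ 2) (cubeSet c.1 c.2) μ := integrableOn_const
      have k3 : IntegrableOn (fun y => 2 * D c * T.deviation μ m (n + 1) y)
        (cubeSet c.1 c.2) μ := i1.const_mul _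
      have k4 : IntegrableOn (fun y => D c ^ 2 + 2 * D c * T.deviation μ m (n + 1) y)
        (cubeSet c.1 c.2) μ := k2.add k3
      refine ⟨(k1.add i1).congr_fun e1.symm hm, (k4.add i2).congr_fun e2.symm hm, ?_, ?_⟩
      · rw [setIntegral_congr_fun hm e1, integral_add k1 i1, i3]
        simp
      · rw [setIntegral_congr_fun hm e2, integral_add k4 i2, integral_add k2 k3,
          integral_const_mul, i3]
        simpa using i4
    have hm : ∀ c ∈ (T.children_finite n hx).toFinset, MeasurableSet (cubeSet c.1 c.2) :=
      fun c _ => measurableSet_cubeSet _ _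
    have hd := T.pairwiseDisjoint_children n hx
    have hI1 : ∀ c ∈ (T.children_finite n hx).toFinset,
        IntegrableOn (T.deviation μ (m + 1) n) (cubeSet c.1 c.2) μ :=
      fun c hc => (hchild c ((Set.Finite.mem_toFinset _).1 hc)).1
    have hI2 : ∀ c ∈ (T.children_finite n hx).toFinset,
        IntegrableOn (fun y => T.deviation μ (m + 1) n y ^ 2) (cubeSet c.1 c.2) μ :=
      fun c hc => (hchild c ((Set.Finite.mem_toFinset _).1 hc)).2.1
    have hU := T.node_eq_biUnion n hx
    refine ⟨?_, ?_, ?_, ?_⟩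
    · rw [hU]; exact integrableOn_finset_iUnion.2 hI1
    · rw [hU]; exact integrableOn_finset_iUnion.2 hI2
    · rw [hU, integral_biUnion_finset _ hm hd hI1, ← T.sum_measure_mul_deviation (μ := μ) n hx]
      exact Finset.sum_congr rfl fun c hc =>
        (hchild c ((Set.Finite.mem_toFinset _).1 hc)).2.2.1
    · have hs := T.sum_measure_mul_sq_deviation_le (μ := μ) n hx (hN n x hx)
      have hU' := T.measureReal_node_eq_sum (μ := μ) n hx
      calc ∫ y in T.node n x, T.deviation μ (m + 1) n y ^ 2 ∂μ
          = ∑ c ∈ (T.children_finite n hx).toFinset,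
            ∫ y in cubeSet c.1 c.2, T.deviation μ (m + 1) n y ^ 2 ∂μ := by
              nth_rewrite 1 [hU]; rw [integral_biUnion_finset _ hm hd hI2]
        _ ≤ ∑ c ∈ (T.children_finite n hx).toFinset,
            (μ.real (cubeSet c.1 c.2) * D c ^ 2 + m * (4 * N * μ.real (cubeSet c.1 c.2))) :=
              Finset.sum_le_sum fun c hc =>
                (hchild c ((Set.Finite.mem_toFinset _).1 hc)).2.2.2
        _ ≤ 4 * N * μ.real (T.node n x) + m * (4 * N * μ.real (T.node n x)) := by
              rw [Finset.sum_add_distrib, ← Finset.mul_sum, ← Finset.mul_sum, ← hU']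
              gcongr
        _ = _ := by push_cast; ring

end CubeTree

/-- If two increasing sequences are asymptotically equal along the squares, up to a relative error
tending to zero, and one of them has bounded increments, then they are so along all integers. -/
theorem tendsto_sub_div_of_tendsto_sq {A B : ℕ → ℝ} {N : ℝ} (hA : Monotone A) (hB : Monotone B)
    (hN : ∀ n, B (n + 1) ≤ B n + N)
    (h : Tendsto (fun k : ℕ => (A ((k + 1) ^ 2) - B ((k + 1) ^ 2)) / ((k : ℝ) + 1) ^ 2) atTop
      (nhds 0)) :
    Tendsto (fun n : ℕ => (A n - B n) / n) atTop (nhds 0) := by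
  set g : ℕ → ℝ := fun k => (A (k ^ 2) - B (k ^ 2)) / (k : ℝ) ^ 2 with hg
  have hg1 : Tendsto (fun k => g (k + 1)) atTop (nhds 0) := by
    simpa [hg] using h
  have hg0 : Tendsto g atTop (nhds 0) := (tendsto_add_atTop_iff_nat 1).1 hg1
  have hBm : ∀ n m, B (n + m) ≤ B n + m * N := by
    intro n m
    induction m with
    | zero => simp
    | succ m ih =>
      have := hN (n + m)
      push_cast
      rw [← add_assoc]
      linarith
  have hsq : Tendsto Nat.sqrt atTop atTop :=
    tendsto_atTop_atTop.2 fun b => ⟨b * b, fun a ha => Nat.le_sqrt.2 ha⟩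
  have hlim : Tendsto (fun k : ℕ => 4 * |g (k + 1)| + |g k| + 3 * N / k) atTop (nhds 0) := by
    have h3 : Tendsto (fun k : ℕ => 3 * N / (k : ℝ)) atTop (nhds 0) :=
      tendsto_const_div_atTop_nhds_zero_nat _
    simpa using ((hg1.abs.const_mul 4).add hg0.abs).add h3
  refine squeeze_zero_norm' ?_ (hlim.comp hsq)
  filter_upwards [eventually_ge_atTop 1] with n hn
  simp only [Function.comp]
  set k := Nat.sqrt n with hk
  have hk1 : 1 ≤ k := Nat.le_sqrt.2 (by simpa using hn)
  have hkn : k ^ 2 ≤ n := by rw [sq]; exact Nat.sqrt_le n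
  have hnk : n ≤ (k + 1) ^ 2 := by rw [sq]; exact (Nat.lt_succ_sqrt n).le
  have hN0 : 0 ≤ N := by linarith [hN 0, hB (Nat.zero_le 1)]
  have hkr : (1 : ℝ) ≤ k := by exact_mod_cast hk1
  have hnr : (0 : ℝ) < n := by exact_mod_cast hn
  have hknr : (k : ℝ) ^ 2 ≤ n := by exact_mod_cast hkn
  have e0 : A (k ^ 2) - B (k ^ 2) = g k * (k : ℝ) ^ 2 := by
    simp only [hg]; field_simp
  have e1 : A ((k + 1) ^ 2) - B ((k + 1) ^ 2) = g (k + 1) * ((k : ℝ) + 1) ^ 2 := by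
    simp only [hg]; push_cast; field_simp
  have hBk : B ((k + 1) ^ 2) ≤ B (k ^ 2) + (2 * k + 1) * N := by
    have := hBm (k ^ 2) (2 * k + 1)
    rw [show k ^ 2 + (2 * k + 1) = (k + 1) ^ 2 by ring] at this
    push_cast at this
    exact this
  have m1 := hA hkn
  have m2 := hA hnk
  have m3 := hB hkn
  have m4 := hB hnk
  have a1 : |g k * (k : ℝ) ^ 2| ≤ |g k| * n := by
    rw [abs_mul, abs_of_nonneg (sq_nonneg (k : ℝ))]
    gcongr
  have a2 : |g (k + 1) * ((k : ℝ) + 1) ^ 2| ≤ 4 * |g (k + 1)| * n := by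
    rw [abs_mul, abs_of_nonneg (sq_nonneg ((k : ℝ) + 1))]
    have : ((k : ℝ) + 1) ^ 2 ≤ 4 * n := by nlinarith
    nlinarith [mul_le_mul_of_nonneg_left this (abs_nonneg (g (k + 1)))]
  have a3 : (2 * k + 1) * N ≤ 3 * N / k * n := by
    have : (2 * k + 1) * N ≤ 3 * N / k * (k : ℝ) ^ 2 := by
      rw [show 3 * N / k * (k : ℝ) ^ 2 = 3 * k * N by field_simp]
      nlinarith
    exact this.trans (by gcongr)
  have b0 := abs_nonneg (g k)
  have b1 := abs_nonneg (g (k + 1))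
  rw [Real.norm_eq_abs, abs_div, Nat.abs_cast, div_le_iff₀ hnr, abs_le]
  have p0 : 0 ≤ |g k| * n := by positivity
  have p1 : 0 ≤ 4 * |g (k + 1)| * n := by positivity
  constructor
  · have := neg_abs_le (g k * (k : ℝ) ^ 2)
    nlinarith
  · have := le_abs_self (g (k + 1) * ((k : ℝ) + 1) ^ 2)
    nlinarith

namespace CubeTree

variable {d : ℕ} {δ : ℝ} (T : CubeTree d δ) {μ : Measure (EuclideanSpace ℝ (Fin d))}

theorem measure_inter_unitCube_eq_zero {P : Set (EuclideanSpace ℝ (Fin d))} (n : ℕ)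
    (h : ∀ x ∈ unitCube d, μ (P ∩ T.node n x) = 0) : μ (P ∩ unitCube d) = 0 := by
  induction n with
  | zero =>
    rw [← T.node_zero (zero_mem_unitCube d)]
    exact h 0 (zero_mem_unitCube d)
  | succ n ih =>
    refine ih fun x hx => ?_
    rw [T.node_eq_biUnion n hx, Set.inter_iUnion₂]
    refine (measure_biUnion_null_iff (Finset.countable_toSet _)).2 fun c hc => ?_
    obtain ⟨z, hz, -, -, hzc⟩ := T.exists_mem_child hx ((Set.Finite.mem_toFinset _).1 hc)
    rw [← hzc]
    exact h z hz

theorem sum_info_eq (hsupp : μ (unitCube d) = 1) {y : EuclideanSpace ℝ (Fin d)}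
    (hy : y ∈ unitCube d) (hpos : ∀ n, 0 < μ.real (T.node n y)) (n : ℕ) :
    ∑ i ∈ Finset.range n, T.info μ i y = -Real.log (μ.real (T.node n y)) := by
  induction n with
  | zero => simp [T.node_zero hy, measureReal_def, hsupp]
  | succ n ih =>
    rw [Finset.sum_range_succ, ih, info, Real.log_div (hpos _).ne' (hpos _).ne']
    ring

variable [IsProbabilityMeasure μ]

theorem ae_mem_unitCube (hsupp : μ (unitCube d) = 1) : ∀ᵐ y ∂μ, y ∈ unitCube d :=
  (prob_compl_eq_zero_iff (measurableSet_unitCube d)).2 hsupp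

theorem ae_measureReal_node_pos (hsupp : μ (unitCube d) = 1) :
    ∀ᵐ y ∂μ, ∀ n, 0 < μ.real (T.node n y) := by
  rw [ae_all_iff]
  intro n
  have h0 : μ ({y | μ (T.node n y) = 0} ∩ unitCube d) = 0 := by
    refine T.measure_inter_unitCube_eq_zero n fun x hx => ?_
    by_cases hz : μ (T.node n x) = 0
    · exact measure_mono_null Set.inter_subset_right hz
    · convert measure_empty (μ := μ)
      refine Set.eq_empty_of_forall_notMem fun y hy => hz ?_
      rw [← T.node_eq_of_mem hx hy.2]
      exact hy.1
  filter_upwards [measure_eq_zero_iff_ae_notMem.1 h0, ae_mem_unitCube hsupp] with y hy hyU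
  exact ENNReal.toReal_pos (fun h => hy ⟨h, hyU⟩) (measure_ne_top _ _)

theorem info_nonneg (n : ℕ) {y : EuclideanSpace ℝ (Fin d)} (hy : y ∈ unitCube d) :
    0 ≤ T.info μ n y :=
  neg_nonneg.2 <| Real.log_nonpos (by positivity) <|
    div_le_one_of_le₀ (measureReal_mono (T.node_succ_subset n hy)) (by positivity)

/-- Along the squares, the averaged deviations tend to zero almost surely. -/
theorem ae_tendsto_deviation_sq (hδ : 0 < δ) (hsupp : μ (unitCube d) = 1) :
    ∀ᵐ y ∂μ, Tendsto (fun k : ℕ => T.deviation μ ((k + 1) ^ 2) 0 y / ((k : ℝ) + 1) ^ 2) atTop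
      (nhds 0) := by
  obtain ⟨N, hN⟩ := T.exists_card_children_le hδ
  have hμ : μ.restrict (unitCube d) = μ :=
    Measure.restrict_eq_self_of_ae_mem (ae_mem_unitCube hsupp)
  have hmom := fun m => T.deviation_moments (μ := μ) hN m 0 0 (zero_mem_unitCube d)
  simp only [T.node_zero (zero_mem_unitCube d), IntegrableOn, hμ, measureReal_def, hsupp,
    ENNReal.toReal_one, mul_one] at hmom
  let F : ℕ → EuclideanSpace ℝ (Fin d) → ℝ := fun k y =>
    T.deviation μ ((k + 1) ^ 2) 0 y ^ 2 / (((k : ℝ) + 1) ^ 2) ^ 2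
  have hF : ∀ k, Integrable (F k) μ := fun k => (hmom _).2.1.div_const _
  have hF0 : ∀ k y, 0 ≤ F k y := fun k y => by positivity
  have hFle : ∀ k, ∫ y, F k y ∂μ ≤ 4 * N * (1 / ((k : ℝ) + 1) ^ 2) := by
    intro k
    have := (hmom ((k + 1) ^ 2)).2.2.2
    simp only [F]
    rw [integral_div, div_le_iff₀ (by positivity)]
    refine this.trans (le_of_eq ?_)
    push_cast
    field_simp
  have hsum : Summable fun k : ℕ => 4 * (N : ℝ) * (1 / ((k : ℝ) + 1) ^ 2) := by
    refine Summable.mul_left _ ?_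
    have := (summable_nat_add_iff 1).2 (Real.summable_one_div_nat_pow.2 (one_lt_two))
    simpa using this
  have hfin : ∫⁻ y, ∑' k, ENNReal.ofReal (F k y) ∂μ ≠ ⊤ := by
    rw [lintegral_tsum fun k => (hF k).aestronglyMeasurable.aemeasurable.ennreal_ofReal]
    refine ne_top_of_le_ne_top hsum.tsum_ofReal_ne_top (ENNReal.tsum_le_tsum fun k => ?_)
    rw [← ofReal_integral_eq_lintegral_ofReal (hF k) (Eventually.of_forall (hF0 k))]
    exact ENNReal.ofReal_le_ofReal (hFle k)
  filter_upwards [ae_lt_top' (AEMeasurable.tsum fun k =>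
    (hF k).aestronglyMeasurable.aemeasurable.ennreal_ofReal) hfin] with y hy
  have h1 := ENNReal.tendsto_atTop_zero_of_tsum_ne_top hy.ne
  have h2 : Tendsto (fun k => F k y) atTop (nhds 0) := by
    have := (ENNReal.tendsto_toReal ENNReal.zero_ne_top).comp h1
    simpa [Function.comp_def, ENNReal.toReal_ofReal (hF0 _ y)] using this
  have h3 := h2.sqrt
  rw [Real.sqrt_zero] at h3
  rw [tendsto_zero_iff_abs_tendsto_zero]
  refine h3.congr fun k => ?_
  simp only [F, Function.comp]
  rw [← div_pow, Real.sqrt_sq_eq_abs]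

/-- A Shannon–McMillan–Breiman type statement: the information of `R_n(y)` and the sum of the
entropies along the branch of `y` differ by `o(n)`. -/
theorem ae_tendsto_log_measure_sub_entropy (hδ : 0 < δ) (hsupp : μ (unitCube d) = 1) :
    ∀ᵐ y ∂μ, Tendsto (fun n : ℕ => (-Real.log (μ.real (T.node n y)) -
      ∑ i ∈ Finset.range n, treeEntropy μ T i y) / n) atTop (nhds 0) := by
  obtain ⟨N, hN⟩ := T.exists_card_children_le hδ
  filter_upwards [T.ae_tendsto_deviation_sq hδ hsupp, T.ae_measureReal_node_pos hsupp,
    ae_mem_unitCube hsupp] with y hy hpos hyU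
  simp only [← T.sum_info_eq hsupp hyU hpos]
  refine tendsto_sub_div_of_tendsto_sq (N := N)
    (A := fun n => ∑ i ∈ Finset.range n, T.info μ i y)
    (B := fun n => ∑ i ∈ Finset.range n, treeEntropy μ T i y) ?_ ?_ ?_ ?_
  · refine monotone_nat_of_le_succ fun n => ?_
    rw [Finset.sum_range_succ]
    linarith [T.info_nonneg (μ := μ) n hyU]
  · refine monotone_nat_of_le_succ fun n => ?_
    rw [Finset.sum_range_succ]
    linarith [T.treeEntropy_nonneg (μ := μ) n hyU]
  · intro n
    simp only [Finset.sum_range_succ]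
    linarith [T.treeEntropy_le (μ := μ) n hyU (hN n y hyU)]
  · simpa [deviation] using hy

end CubeTree

namespace CubeTree

variable {d : ℕ} {δ : ℝ} (T : CubeTree d δ) {μ : Measure (EuclideanSpace ℝ (Fin d))}
  [IsProbabilityMeasure μ]

/-- The set of points whose level-`n` cube has side comparable to `h`, but much smaller measure
than a concentric ball of comparable size. -/
def badSet (μ : Measure (EuclideanSpace ℝ (Fin d))) (n : ℕ) (h : ℝ) (w : ℝ≥0∞) :
    Set (EuclideanSpace ℝ (Fin d)) :=
  {x | x ∈ unitCube d ∧ h ≤ T.side n x ∧ T.side n x ≤ 3 * h ∧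
    w * μ (T.node n x) < μ (closedBall x (3 * h))}

theorem mul_measure_badSet_le (n : ℕ) {h : ℝ} (hh : 0 < h) (w : ℝ≥0∞) :
    w * μ (T.badSet μ n h w) ≤ 13 ^ d := by
  let f : EuclideanSpace ℝ (Fin d) → (Fin d → ℤ) := fun z i => ⌊z i / h⌋
  have hf : Measurable f := by
    refine measurable_pi_lambda _ fun i => Int.measurable_floor.comp ?_
    fun_prop
  let K : Finset (Fin d → ℤ) := Finset.Icc (fun _ => -6) (fun _ => 6)
  have hK : K.card = 13 ^ d := by
    simp [K, Pi.card_Icc]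
  let E : (Fin d → ℤ) → Set (EuclideanSpace ℝ (Fin d)) := fun m => ⋃ k ∈ K, f ⁻¹' {m + k}
  let S : (Fin d → ℤ) → Set (EuclideanSpace ℝ (Fin d)) := fun m =>
    {x | x ∈ T.badSet μ n h w ∧ latticePoint h m ∈ T.node n x}
  have hcover : T.badSet μ n h w ⊆ ⋃ m, S m := by
    intro x hx
    exact Set.mem_iUnion.2 ⟨_, hx, latticePoint_mem_cubeSet hh hx.2.1 _⟩
  have hball : ∀ m, ∀ x ∈ S m, closedBall x (3 * h) ⊆ E m := by
    intro m x hx z hz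
    have hzi : ∀ i, |z i - x i| ≤ 3 * h := by
      intro i
      have h1 := PiLp.norm_apply_le (z - x) i
      rw [mem_closedBall, dist_eq_norm] at hz
      simpa using h1.trans hz
    refine Set.mem_iUnion₂.2 ⟨f z - m, ?_, by simp⟩
    have hside := hx.1.2.2.1
    have hxi : ∀ i, |x i - h * m i| ≤ 3 * h := by
      intro i
      have h1 := T.mem_node_self n hx.1.1 i
      have h2 := hx.2 i
      simp only [latticePoint] at h2
      rw [abs_le]
      constructor <;> linarith
    rw [Finset.mem_Icc, Pi.le_def, Pi.le_def]
    have hbd : ∀ i, h * m i - 6 * h ≤ z i ∧ z i ≤ h * m i + 6 * h := by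
      intro i
      have h1 := abs_le.1 (hzi i)
      have h2 := abs_le.1 (hxi i)
      constructor <;> linarith
    constructor
    · intro i
      have : m i - 6 ≤ f z i := by
        refine Int.le_floor.2 ((le_div_iff₀ hh).2 ?_)
        push_cast
        linarith [(hbd i).1]
      simp only [Pi.sub_apply]
      linarith
    · intro i
      have : f z i ≤ m i + 6 := by
        refine Int.floor_le_iff.2 ((div_lt_iff₀ hh).2 ?_)
        push_cast
        linarith [(hbd i).2]
      simp only [Pi.sub_apply]
      linarith
  have hS : ∀ m, w * μ (S m) ≤ μ (E m) := by
    intro m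
    rcases (S m).eq_empty_or_nonempty with he | ⟨x, hx⟩
    · simp [he]
    · have hsub : S m ⊆ T.node n x := by
        intro y hy
        have e1 := T.node_eq_of_mem hx.1.1 hx.2
        have e2 := T.node_eq_of_mem hy.1.1 hy.2
        rw [← e1, e2]
        exact T.mem_node_self n hy.1.1
      calc w * μ (S m) ≤ w * μ (T.node n x) := by gcongr
        _ ≤ μ (closedBall x (3 * h)) := hx.1.2.2.2.le
        _ ≤ μ (E m) := measure_mono (hball m x hx)
  have htot : ∑' m, μ (f ⁻¹' {m}) ≤ 1 := by
    rw [← measure_univ (μ := μ)]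
    refine tsum_measure_le_measure_univ
      (fun m => (hf (measurableSet_singleton m)).nullMeasurableSet) fun m m' hne => ?_
    exact (Disjoint.preimage f (Set.disjoint_singleton.2 hne)).aedisjoint
  calc w * μ (T.badSet μ n h w) ≤ w * ∑' m, μ (S m) := by
        gcongr
        exact (measure_mono hcover).trans (measure_iUnion_le _)
    _ = ∑' m, w * μ (S m) := ENNReal.tsum_mul_left.symm
    _ ≤ ∑' m, ∑ k ∈ K, μ (f ⁻¹' {m + k}) :=
        ENNReal.tsum_le_tsum fun m => (hS m).trans (measure_biUnion_finset_le _ _)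
    _ = ∑ k ∈ K, ∑' m, μ (f ⁻¹' {m + k}) :=
        Summable.tsum_finsetSum fun _ _ => ENNReal.summable
    _ = ∑ k ∈ K, ∑' m, μ (f ⁻¹' {m}) :=
        Finset.sum_congr rfl fun k _ => (Equiv.addRight k).tsum_eq fun m => μ (f ⁻¹' {m})
    _ ≤ ∑ _k ∈ K, 1 := Finset.sum_le_sum fun _ _ => htot
    _ = 13 ^ d := by simp [hK]

theorem side_bounds (n : ℕ) (hδ : 0 < δ) {x : EuclideanSpace ℝ (Fin d)} (hx : x ∈ unitCube d) :
    δ ^ n ≤ T.side n x ∧ T.side n x ≤ (1 - δ) ^ n := by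
  induction n with
  | zero => simp [T.side_zero x hx]
  | succ n ih =>
    have h1 := T.side_succ_bounds n hx
    have h2 := T.delta_le_half
    rw [pow_succ', pow_succ']
    exact ⟨(mul_le_mul_of_nonneg_left ih.1 hδ.le).trans h1.1,
      h1.2.trans (mul_le_mul_of_nonneg_left ih.2 (by linarith))⟩

theorem tsum_measure_badSet_ne_top :
    ∑' p : ℕ × ℕ, μ (T.badSet μ p.1 (Real.exp (-((p.2 : ℝ) + 1)))
      (ENNReal.ofReal (((p.1 : ℝ) + 1) ^ 2 * ((p.2 : ℝ) + 1) ^ 2))) ≠ ⊤ := by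
  have hs : ∑' n : ℕ, ENNReal.ofReal (1 / ((n : ℝ) + 1) ^ 2) ≠ ⊤ := by
    refine Summable.tsum_ofReal_ne_top ?_
    have := (summable_nat_add_iff 1).2 (Real.summable_one_div_nat_pow.2 (one_lt_two))
    simpa using this
  have hle : ∀ p : ℕ × ℕ, μ (T.badSet μ p.1 (Real.exp (-((p.2 : ℝ) + 1)))
      (ENNReal.ofReal (((p.1 : ℝ) + 1) ^ 2 * ((p.2 : ℝ) + 1) ^ 2))) ≤
      13 ^ d * (ENNReal.ofReal (1 / ((p.1 : ℝ) + 1) ^ 2) *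
        ENNReal.ofReal (1 / ((p.2 : ℝ) + 1) ^ 2)) := by
    intro p
    have h1 := T.mul_measure_badSet_le (μ := μ) p.1 (Real.exp_pos (-((p.2 : ℝ) + 1)))
      (ENNReal.ofReal (((p.1 : ℝ) + 1) ^ 2 * ((p.2 : ℝ) + 1) ^ 2))
    have hw : 0 < ((p.1 : ℝ) + 1) ^ 2 * ((p.2 : ℝ) + 1) ^ 2 := by positivity
    rw [← ENNReal.ofReal_mul (by positivity), one_div_mul_one_div, one_div,
      ENNReal.ofReal_inv_of_pos hw, ← div_eq_mul_inv,
      ENNReal.le_div_iff_mul_le (Or.inl (by simpa using hw)) (Or.inl ENNReal.ofReal_ne_top),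
      mul_comm]
    exact h1
  refine ne_top_of_le_ne_top ?_ (ENNReal.tsum_le_tsum hle)
  rw [ENNReal.tsum_mul_left, ENNReal.tsum_prod']
  simp only [ENNReal.tsum_mul_left, ENNReal.tsum_mul_right]
  exact ENNReal.mul_ne_top (by simp) (ENNReal.mul_ne_top hs hs)

/-- Almost surely, the balls around a point of radius the side of the cube `R_n(x)`
have measure at most a polynomial multiple of that of the cube. -/
theorem ae_eventually_measureReal_closedBall_le (hδ : 0 < δ) (hsupp : μ (unitCube d) = 1) :
    ∀ᵐ x ∂μ, ∀ᶠ n : ℕ in atTop, μ.real (closedBall x (T.side n x)) ≤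
      ((n : ℝ) + 1) ^ 2 * (-Real.log (T.side n x) + 1) ^ 2 * μ.real (T.node n x) := by
  filter_upwards [ae_finite_setOfPred_mem (T.tsum_measure_badSet_ne_top (μ := μ)),
    ae_mem_unitCube hsupp] with x hfin hx
  have hfin' := (hfin.image Prod.fst).eventually_cofinite_notMem
  rw [Nat.cofinite_eq_atTop] at hfin'
  filter_upwards [hfin'] with n hn
  have hpos := T.side_pos n x hx
  have hle1 : T.side n x ≤ 1 :=
    (T.side_bounds n hδ hx).2.trans (pow_le_one₀ (by linarith [T.delta_le_half]) (by linarith))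
  set L := -Real.log (T.side n x) with hL
  have hL0 : 0 ≤ L := neg_nonneg.2 (Real.log_nonpos hpos.le hle1)
  have hside : T.side n x = Real.exp (-L) := by rw [hL, neg_neg, Real.exp_log hpos]
  set j := ⌊L⌋₊ with hj
  have hj1 : (j : ℝ) ≤ L := Nat.floor_le hL0
  have hj2 : L < j + 1 := Nat.lt_floor_add_one L
  by_contra! hcon
  refine hn ⟨(n, j), ?_, rfl⟩
  have h3 : T.side n x ≤ 3 * Real.exp (-((j : ℝ) + 1)) := by
    calc T.side n x ≤ Real.exp (1 + -((j : ℝ) + 1)) := by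
          rw [hside]; exact Real.exp_le_exp.2 (by linarith)
      _ = Real.exp 1 * Real.exp (-((j : ℝ) + 1)) := Real.exp_add _ _
      _ ≤ _ := by gcongr; exact Real.exp_one_lt_three.le
  refine ⟨hx, ?_, h3, ?_⟩
  · rw [hside]; exact Real.exp_le_exp.2 (by linarith)
  · refine lt_of_lt_of_le ?_ (measure_mono (closedBall_subset_closedBall h3))
    rw [← ofReal_measureReal (s := closedBall x (T.side n x)),
      ← ofReal_measureReal (s := T.node n x),
      ← ENNReal.ofReal_mul (by positivity), ENNReal.ofReal_lt_ofReal_iff_of_nonneg (by positivity)]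
    refine lt_of_le_of_lt ?_ hcon
    gcongr

end CubeTree

/-- A perturbation tending to zero does not increase an extended real limit superior. -/
theorem limsup_coe_le_of_le_add {u v e : ℕ → ℝ} (h : ∀ᶠ n in atTop, u n ≤ v n + e n)
    (he : Tendsto e atTop (nhds 0)) :
    limsup (fun n => (u n : EReal)) atTop ≤ limsup (fun n => (v n : EReal)) atTop := by
  have he' : limsup (fun n => (e n : EReal)) atTop = 0 :=
    ((continuous_coe_real_ereal.tendsto 0).comp he).limsup_eq
  calc limsup (fun n => (u n : EReal)) atTop
      ≤ limsup ((fun n => (v n : EReal)) + fun n => (e n : EReal)) atTop := by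
        refine limsup_le_limsup ?_
        filter_upwards [h] with n hn
        simp only [Pi.add_apply, ← EReal.coe_add]
        exact EReal.coe_le_coe_iff.2 hn
    _ ≤ limsup (fun n => (v n : EReal)) atTop + limsup (fun n => (e n : EReal)) atTop :=
        EReal.limsup_add_le (Or.inr (by simp [he'])) (Or.inr (by simp [he']))
    _ = _ := by simp [he']

namespace CubeTree

variable {d : ℕ} {δ : ℝ} (T : CubeTree d δ) {μ : Measure (EuclideanSpace ℝ (Fin d))}

theorem neg_log_side_bounds (hδ : 0 < δ) (n : ℕ) {x : EuclideanSpace ℝ (Fin d)}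
    (hx : x ∈ unitCube d) :
    n * -Real.log (1 - δ) ≤ -Real.log (T.side n x) ∧
      -Real.log (T.side n x) ≤ n * -Real.log δ := by
  have h := T.side_bounds n hδ hx
  have h1 := Real.log_le_log (by positivity) h.1
  have h2 := Real.log_le_log (T.side_pos n x hx) h.2
  rw [Real.log_pow] at h1 h2
  constructor <;> linarith

include T in
theorem neg_log_one_sub_pos (hδ : 0 < δ) : 0 < -Real.log (1 - δ) :=
  neg_pos.2 (Real.log_neg (by linarith [T.delta_le_half]) (by linarith))

theorem tendsto_neg_log_side (hδ : 0 < δ) {x : EuclideanSpace ℝ (Fin d)}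
    (hx : x ∈ unitCube d) : Tendsto (fun n => -Real.log (T.side n x)) atTop atTop :=
  tendsto_atTop_mono (fun n => (T.neg_log_side_bounds hδ n hx).1)
    (tendsto_natCast_atTop_atTop.atTop_mul_const (T.neg_log_one_sub_pos hδ))

theorem tendsto_side (hδ : 0 < δ) {x : EuclideanSpace ℝ (Fin d)} (hx : x ∈ unitCube d) :
    Tendsto (fun n => T.side n x) atTop (nhdsWithin 0 (Set.Ioi 0)) := by
  have hd := T.delta_le_half
  refine tendsto_nhdsWithin_iff.2
    ⟨squeeze_zero (fun n => (T.side_pos n x hx).le) (fun n => (T.side_bounds n hδ hx).2)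
      (tendsto_pow_atTop_nhds_zero_of_lt_one (by linarith) (by linarith)),
      Eventually.of_forall fun n => T.side_pos n x hx⟩

theorem node_subset_closedBall (n : ℕ) {x : EuclideanSpace ℝ (Fin d)} (hx : x ∈ unitCube d) :
    T.node n x ⊆ closedBall x ((d + 1) * T.side n x) := by
  intro y hy
  have hp := T.side_pos n x hx
  rw [mem_closedBall, EuclideanSpace.dist_eq, Real.sqrt_le_left (by positivity)]
  calc ∑ i, dist (y i) (x i) ^ 2 ≤ ∑ _i : Fin d, T.side n x ^ 2 := by
        refine Finset.sum_le_sum fun i _ => ?_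
        have h1 := hy i
        have h2 := T.mem_node_self n hx i
        gcongr
        rw [Real.dist_eq, abs_le]
        constructor <;> linarith
    _ = d * T.side n x ^ 2 := by simp
    _ ≤ ((d + 1) * T.side n x) ^ 2 := by
        rw [mul_pow]
        gcongr
        nlinarith [(Nat.cast_nonneg d : (0 : ℝ) ≤ d)]

theorem exists_side_le (hδ : 0 < δ) {x : EuclideanSpace ℝ (Fin d)} (hx : x ∈ unitCube d)
    {r : ℝ} (hr : 0 < r) : ∃ n, (d + 1) * T.side n x ≤ r := by
  have h := ((T.tendsto_side hδ hx).mono_right nhdsWithin_le_nhds).const_mul ((d : ℝ) + 1)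
  rw [mul_zero] at h
  exact (h.eventually_le_const hr).exists

variable [IsProbabilityMeasure μ]

theorem measureReal_closedBall_pos (hδ : 0 < δ) {x : EuclideanSpace ℝ (Fin d)}
    (hx : x ∈ unitCube d) (hpos : ∀ n, 0 < μ.real (T.node n x)) {r : ℝ} (hr : 0 < r) :
    0 < μ.real (closedBall x r) := by
  obtain ⟨n, hn⟩ := T.exists_side_le hδ hx hr
  exact (hpos n).trans_le (measureReal_mono
    ((T.node_subset_closedBall n hx).trans (closedBall_subset_closedBall hn)))

/-- At a point where the cube measures decay at most exponentially, the upper local dimension is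
bounded by the one computed along the cubes of the tree. -/
theorem upperLocalDim_le_limsup (hδ : 0 < δ) {x : EuclideanSpace ℝ (Fin d)}
    (hx : x ∈ unitCube d) (hpos : ∀ n, 0 < μ.real (T.node n x)) {C : ℝ}
    (hC : ∀ᶠ n in atTop, -Real.log (μ.real (T.node n x)) ≤ C * -Real.log (T.side n x)) :
    upperLocalDim μ x ≤ limsup (fun n : ℕ =>
      ((-Real.log (μ.real (T.node n x)) / -Real.log (T.side n x) : ℝ) : EReal)) atTop := by
  set L : ℕ → ℝ := fun n => -Real.log (T.side n x) with hL
  set a : ℕ → ℝ := fun n => -Real.log (μ.real (T.node n x)) with ha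
  set K : ℝ := Real.log (d + 1) - Real.log δ with hK
  have hLtop : Tendsto L atTop atTop := T.tendsto_neg_log_side hδ hx
  have ha0 : ∀ n, 0 ≤ a n := fun n =>
    neg_nonneg.2 (Real.log_nonpos measureReal_nonneg measureReal_le_one)
  have hlim : Tendsto (fun n => C * |K / (L n - K)|) atTop (nhds 0) := by
    have h1 : Tendsto (fun n => K / (L n - K)) atTop (nhds 0) :=
      (tendsto_atTop_add_const_right _ (-K) hLtop).const_div_atTop K
    simpa using h1.abs.const_mul C
  have hshift : limsup (fun n => ((a n / (L n - K) : ℝ) : EReal)) atTop ≤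
      limsup (fun n => ((a n / L n : ℝ) : EReal)) atTop := by
    refine limsup_coe_le_of_le_add ?_ hlim
    filter_upwards [hC, hLtop.eventually_gt_atTop K, hLtop.eventually_gt_atTop 0]
      with n hn hnK hn0
    have h1 : a n / L n ≤ C := (div_le_iff₀ hn0).2 hn
    have h2 : 0 ≤ a n / L n := div_nonneg (ha0 n) hn0.le
    have h3 : 0 < L n - K := by linarith
    have h4 : a n / (L n - K) = a n / L n + a n / L n * (K / (L n - K)) := by
      field_simp
      ring
    rw [h4]
    refine add_le_add_right ?_ _
    calc a n / L n * (K / (L n - K)) ≤ a n / L n * |K / (L n - K)| := by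
          gcongr; exact le_abs_self _
      _ ≤ _ := by gcongr
  refine le_trans (le_of_forall_gt_imp_ge_of_dense fun b hb => ?_) hshift
  have hev := (eventually_lt_of_limsup_lt hb).and (hLtop.eventually_gt_atTop K)
  obtain ⟨n₀, hn₀⟩ := eventually_atTop.1 hev
  refine limsup_le_of_le (h := ?_)
  have hs : 0 < ((d : ℝ) + 1) * T.side n₀ x :=
    mul_pos (by positivity) (T.side_pos n₀ x hx)
  filter_upwards [Ioo_mem_nhdsGT hs, Ioo_mem_nhdsGT (zero_lt_one (α := ℝ))] with r hr hr1
  classical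
  have hex := T.exists_side_le hδ hx hr.1
  obtain ⟨n, hn⟩ : ∃ n, n = Nat.find hex := ⟨_, rfl⟩
  have hspec : ((d : ℝ) + 1) * T.side n x ≤ r := hn ▸ Nat.find_spec hex
  have hanti : Antitone fun n => T.side n x := antitone_nat_of_succ_le fun m => by
    have h1 := (T.side_succ_bounds m hx).2
    nlinarith [T.side_pos m x hx]
  have hnn : n₀ ≤ n := by
    by_contra! hlt
    have := mul_le_mul_of_nonneg_left (hanti hlt.le) (by positivity : (0 : ℝ) ≤ d + 1)
    simp only at this
    linarith [hr.2]
  have hnpos : n ≠ 0 := by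
    rintro h0
    rw [h0, T.side_zero x hx] at hspec
    linarith [hr1.2, (Nat.cast_nonneg d : (0 : ℝ) ≤ d)]
  obtain ⟨m, rfl⟩ := Nat.exists_eq_succ_of_ne_zero hnpos
  have hm : r < ((d : ℝ) + 1) * T.side m x :=
    not_le.1 (Nat.find_min hex (by omega))
  obtain ⟨hb1, hb2⟩ := hn₀ _ hnn
  have hpm := T.side_pos m x hx
  have hpm' := T.side_pos (m + 1) x hx
  have hlogr : L (m + 1) - K < -Real.log r := by
    have h1 : δ * r < ((d : ℝ) + 1) * T.side (m + 1) x := by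
      have h2 := mul_lt_mul_of_pos_left hm hδ
      have h3 := mul_le_mul_of_nonneg_left (T.side_succ_bounds m hx).1
        (by positivity : (0 : ℝ) ≤ d + 1)
      linarith
    have h4 := Real.log_lt_log (mul_pos hδ hr.1) h1
    rw [Real.log_mul hδ.ne' hr.1.ne', Real.log_mul (by positivity) hpm'.ne'] at h4
    simp only [hL, hK]
    linarith
  have hmeas : -Real.log (μ.real (closedBall x r)) ≤ a (m + 1) := by
    refine neg_le_neg (Real.log_le_log (hpos _) (measureReal_mono ?_))
    exact (T.node_subset_closedBall (m + 1) hx).trans (closedBall_subset_closedBall hspec)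
  refine le_trans (EReal.coe_le_coe_iff.2 ?_) hb1.le
  rw [← neg_div_neg_eq]
  exact div_le_div₀ (ha0 _) hmeas (by linarith) hlogr.le

/-- At a point where balls are at most polynomially heavier than cubes, the upper local dimension
dominates the one computed along the cubes of the tree. -/
theorem limsup_le_upperLocalDim (hδ : 0 < δ) {x : EuclideanSpace ℝ (Fin d)}
    (hx : x ∈ unitCube d) (hpos : ∀ n, 0 < μ.real (T.node n x))
    (hball : ∀ᶠ n : ℕ in atTop, μ.real (closedBall x (T.side n x)) ≤
      ((n : ℝ) + 1) ^ 2 * (-Real.log (T.side n x) + 1) ^ 2 * μ.real (T.node n x)) :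
    limsup (fun n : ℕ =>
      ((-Real.log (μ.real (T.node n x)) / -Real.log (T.side n x) : ℝ) : EReal)) atTop ≤
      upperLocalDim μ x := by
  set c : ℝ := -Real.log (1 - δ) with hc
  set D : ℝ := -Real.log δ with hD
  have hc0 : 0 < c := T.neg_log_one_sub_pos hδ
  have hD0 : 0 < D := neg_pos.2 (Real.log_neg hδ (by linarith [T.delta_le_half]))
  have he : Tendsto (fun n : ℕ => (4 * Real.log (n + 1) + 2 * Real.log (D + 1)) / (n * c))
      atTop (nhds 0) := by
    have h1 : Tendsto (fun n : ℕ => Real.log (n + 1) / n) atTop (nhds 0) := by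
      have := (Real.tendsto_pow_log_div_mul_add_atTop 1 (-1) 1 one_ne_zero).comp
        (tendsto_atTop_add_const_right _ 1 (tendsto_natCast_atTop_atTop (R := ℝ)))
      simpa [Function.comp_def] using this
    have h2 : Tendsto (fun n : ℕ => 2 * Real.log (D + 1) / c / (n : ℝ)) atTop (nhds 0) :=
      tendsto_const_div_atTop_nhds_zero_nat _
    have h3 := (h1.const_mul (4 / c)).add h2
    rw [mul_zero, add_zero] at h3
    refine h3.congr fun n => ?_
    rcases eq_or_ne n 0 with rfl | hn
    · simp
    · field_simp
  refine le_trans (limsup_coe_le_of_le_add (v := fun n =>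
    Real.log (μ.real (closedBall x (T.side n x))) / Real.log (T.side n x)) ?_ he) ?_
  · filter_upwards [hball, eventually_ge_atTop 1] with n hn hn1
    obtain ⟨hL1, hL2⟩ := T.neg_log_side_bounds hδ n hx
    set L := -Real.log (T.side n x) with hL
    have hnr : (1 : ℝ) ≤ n := by exact_mod_cast hn1
    have hnc : 0 < n * c := by positivity
    have hLpos : 0 < L := hnc.trans_le hL1
    have hBpos := T.measureReal_closedBall_pos hδ hx hpos (T.side_pos n x hx)
    have h1 := Real.log_le_log hBpos hn
    rw [Real.log_mul (by positivity) (hpos n).ne', Real.log_mul (by positivity) (by positivity),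
      Real.log_pow, Real.log_pow] at h1
    have h2 : Real.log (L + 1) ≤ Real.log (D + 1) + Real.log (n + 1) := by
      rw [← Real.log_mul (by positivity) (by positivity)]
      refine Real.log_le_log (by positivity) ?_
      nlinarith
    have h3 : 0 ≤ 4 * Real.log ((n : ℝ) + 1) + 2 * Real.log (D + 1) := by
      have := Real.log_nonneg (by linarith : (1 : ℝ) ≤ n + 1)
      have := Real.log_nonneg (by linarith : (1 : ℝ) ≤ D + 1)
      linarith
    calc -Real.log (μ.real (T.node n x)) / L
        ≤ (-Real.log (μ.real (closedBall x (T.side n x))) +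
          (4 * Real.log ((n : ℝ) + 1) + 2 * Real.log (D + 1))) / L := by
          push_cast at h1
          gcongr
          linarith
      _ = Real.log (μ.real (closedBall x (T.side n x))) / Real.log (T.side n x) +
          (4 * Real.log ((n : ℝ) + 1) + 2 * Real.log (D + 1)) / L := by
          rw [add_div, hL, neg_div_neg_eq]
      _ ≤ _ := by gcongr
  · have := (limsup_comp (fun r : ℝ =>
      ((Real.log (μ.real (closedBall x r)) / Real.log r : ℝ) : EReal)) (fun n => T.side n x)
      atTop).trans_le (limsup_le_limsup_of_le (T.tendsto_side hδ hx))
    exact this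

/-- Almost everywhere, the upper local dimension is the upper average of the entropies. -/
theorem ae_upperLocalDim_eq (hδ : 0 < δ) (hsupp : μ (unitCube d) = 1) :
    ∀ᵐ x ∂μ, upperLocalDim μ x = limsup (fun n : ℕ =>
      (((∑ i ∈ Finset.range n, treeEntropy μ T i x) / Real.log (1 / T.side n x) : ℝ)
        : EReal)) atTop := by
  obtain ⟨N, hN⟩ := T.exists_card_children_le hδ
  filter_upwards [ae_mem_unitCube hsupp, T.ae_measureReal_node_pos hsupp,
    T.ae_tendsto_log_measure_sub_entropy hδ hsupp,
    T.ae_eventually_measureReal_closedBall_le hδ hsupp] with x hx hpos hsmb hball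
  have hc0 := T.neg_log_one_sub_pos hδ
  set c : ℝ := -Real.log (1 - δ) with hc
  set a : ℕ → ℝ := fun n => -Real.log (μ.real (T.node n x)) with ha
  set s : ℕ → ℝ := fun n => ∑ i ∈ Finset.range n, treeEntropy μ T i x with hs
  have hs_le : ∀ n, s n ≤ n * N := fun n => by
    refine (Finset.sum_le_card_nsmul _ _ _
      fun i _ => T.treeEntropy_le (μ := μ) i hx (hN i x hx)).trans ?_
    simp
  have hdiff : Tendsto (fun n => |(a n - s n) / n| / c) atTop (nhds 0) := by
    simpa using hsmb.abs.div_const c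
  have hle : ∀ᶠ n : ℕ in atTop,
      |a n / -Real.log (T.side n x) - s n / -Real.log (T.side n x)| ≤ |(a n - s n) / n| / c := by
    filter_upwards [eventually_ge_atTop 1] with n hn
    have hL := (T.neg_log_side_bounds hδ n hx).1
    have hnr : (1 : ℝ) ≤ n := by exact_mod_cast hn
    have hnc : 0 < n * c := by positivity
    rw [← sub_div, abs_div, abs_div, Nat.abs_cast, div_div, abs_of_pos (hnc.trans_le hL)]
    gcongr
  have hC : ∀ᶠ n in atTop, a n ≤ ((N + 1) / c) * -Real.log (T.side n x) := by
    filter_upwards [hsmb.eventually_lt_const zero_lt_one, eventually_ge_atTop 1] with n h1 hn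
    have hL := (T.neg_log_side_bounds hδ n hx).1
    have hnr : (0 : ℝ) < n := by exact_mod_cast hn
    rw [div_lt_one hnr] at h1
    calc a n ≤ (N + 1) * n := by linarith [hs_le n]
      _ = (N + 1) / c * (n * c) := by field_simp
      _ ≤ _ := by gcongr
  simp only [one_div, Real.log_inv]
  apply le_antisymm
  · refine (T.upperLocalDim_le_limsup hδ hx hpos hC).trans (limsup_coe_le_of_le_add ?_ hdiff)
    filter_upwards [hle] with n hn
    linarith [(abs_le.1 hn).2]
  · refine (limsup_coe_le_of_le_add ?_ hdiff).trans (T.limsup_le_upperLocalDim hδ hx hpos hball)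
    filter_upwards [hle] with n hn
    linarith [(abs_le.1 hn).1]

end CubeTree

/-- For a `δ`-regular tree of cubes `R*` with root `[0,1)^d` and a Borel
probability measure `μ` on `[0,1)^d`, the packing dimension of `μ` equals the `μ`-essential
supremum of `limsup_n (Σ_{i<n} H(R_i(x))) / log(1/ℓ(R_n(x)))`. -/
theorem packingDim_eq_essSup_entropy_average (d : ℕ) (hd : 1 ≤ d) (δ : ℝ) (hδ : 0 < δ)
    (T : CubeTree d δ) (μ : Measure (EuclideanSpace ℝ (Fin d))) [IsProbabilityMeasure μ]
    (hsupp : μ (unitCube d) = 1) :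
    packingDim μ = essSup (fun x =>
      Filter.limsup (fun n : ℕ =>
        (((∑ i ∈ Finset.range n, treeEntropy μ T i x) / Real.log (1 / T.side n x) : ℝ)
          : EReal)) Filter.atTop) μ := by
  exact essSup_congr_ae (T.ae_upperLocalDim_eq hδ hsupp)
end

section
/- Let μ be a mean (α,η,ε)-porous Borel probability measure on ℝ^d supported in [0,1)^d, and fix r ∈ (0,1/2). Then for Lebesgue-almost every t ∈ [0,1/2)^d, the pushforward of μ under the map x ↦ r·x + t is a dyadic mean (k, (1−2r)^d·η, ε)-porous measure on [0,1)^d, where k = ⌈|log₂(αr/√d)|⌉. -/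
open MeasureTheory Filter Metric Set
open scoped ENNReal NNReal

/-- The porosity `por(μ,x,r,ε)`: the supremum of all `α ≥ 0` such that there is `y` with
`B(y,αr) ⊆ B(x,r)` and `μ(B(y,αr)) ≤ ε·μ(B(x,r))` (closed balls). -/
noncomputable def por {d : ℕ} (μ : Measure (EuclideanSpace ℝ (Fin d)))
    (x : EuclideanSpace ℝ (Fin d)) (r ε : ℝ) : ℝ :=
  sSup {α : ℝ | 0 ≤ α ∧ ∃ y, Metric.closedBall y (α * r) ⊆ Metric.closedBall x r ∧
    μ (Metric.closedBall y (α * r)) ≤ ENNReal.ofReal ε * μ (Metric.closedBall x r)}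

/-- `μ` is mean `(α,η,ε)`-porous: for `μ`-a.e. `x`,
`liminf_n (1/n)·#{i < n : por(μ,x,2^{-i},ε) ≥ α} ≥ η`. -/
def MeanPorousWith {d : ℕ} (μ : Measure (EuclideanSpace ℝ (Fin d))) (α η ε : ℝ) : Prop :=
  ∀ᵐ x ∂μ, η ≤ Filter.liminf
    (fun n : ℕ =>
      (Set.ncard {i : ℕ | i < n ∧ α ≤ por μ x ((2 : ℝ) ^ (-(i : ℝ))) ε} : ℝ) / n)
    Filter.atTop

/-- `μ` is mean `(α,η)`-porous: it is mean `(α,η,ε)`-porous for all `ε > 0`. -/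
def MeanPorous {d : ℕ} (μ : Measure (EuclideanSpace ℝ (Fin d))) (α η : ℝ) : Prop :=
  ∀ ε > 0, MeanPorousWith μ α η ε

section Pores

variable {X : Type*} [PseudoMetricSpace X] [MeasurableSpace X]

theorem lowerSemicontinuous_measure_ball (μ : Measure X) :
    LowerSemicontinuous fun p : X × ℝ => μ (ball p.1 p.2) := by
  rintro ⟨y, s⟩ b hb
  have hU : ball y s = ⋃ n : ℕ, ball y (s - 1 / ((n : ℝ) + 1)) := by
    ext z
    simp only [mem_ball, mem_iUnion]
    constructor
    · intro hz
      obtain ⟨n, hn⟩ := exists_nat_one_div_lt (sub_pos.2 hz)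
      exact ⟨n, by linarith⟩
    · rintro ⟨n, hn⟩
      have : (0 : ℝ) < 1 / ((n : ℝ) + 1) := by positivity
      linarith
  have hmono : Monotone fun n : ℕ => ball y (s - 1 / ((n : ℝ) + 1)) := fun m n hmn =>
    ball_subset_ball (sub_le_sub_left (one_div_le_one_div_of_le (by positivity)
      (by exact_mod_cast Nat.succ_le_succ hmn)) s)
  have hlim := tendsto_measure_iUnion_atTop (μ := μ) hmono
  rw [← hU] at hlim
  obtain ⟨n, hn⟩ := (hlim.eventually (lt_mem_nhds hb)).exists
  have hpos : (0 : ℝ) < 1 / ((n : ℝ) + 1) := by positivity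
  have hopen : IsOpen {q : X × ℝ | s - 1 / ((n : ℝ) + 1) + dist y q.1 < q.2} :=
    isOpen_lt (by fun_prop) (by fun_prop)
  filter_upwards [hopen.mem_nhds (show (y, s) ∈ _ by simpa using (by positivity))] with q hq
  exact hn.trans_le (measure_mono (ball_subset_ball' hq.le))

theorem upperSemicontinuous_measure_closedBall [OpensMeasurableSpace X] (μ : Measure X)
    [IsFiniteMeasure μ] (R : ℝ) :
    UpperSemicontinuous fun x : X => μ (closedBall x R) := by
  intro x b hb
  have hI : closedBall x R = ⋂ n : ℕ, closedBall x (R + 1 / ((n : ℝ) + 1)) := by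
    ext z
    simp only [mem_closedBall, mem_iInter]
    constructor
    · intro hz n
      have : (0 : ℝ) < 1 / ((n : ℝ) + 1) := by positivity
      linarith
    · intro h
      by_contra! hz
      obtain ⟨n, hn⟩ := exists_nat_one_div_lt (sub_pos.2 hz)
      linarith [h n]
  have hanti : Antitone fun n : ℕ => closedBall x (R + 1 / ((n : ℝ) + 1)) := fun m n hmn =>
    closedBall_subset_closedBall (add_le_add_right (one_div_le_one_div_of_le (by positivity)
      (by exact_mod_cast Nat.succ_le_succ hmn)) R)
  have hlim := tendsto_measure_iInter_atTop (μ := μ)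
    (fun n => isClosed_closedBall.measurableSet.nullMeasurableSet) hanti ⟨0, measure_ne_top _ _⟩
  rw [← hI] at hlim
  obtain ⟨n, hn⟩ := (hlim.eventually (gt_mem_nhds hb)).exists
  have hpos : (0 : ℝ) < 1 / ((n : ℝ) + 1) := by positivity
  filter_upwards [ball_mem_nhds x hpos] with z hz
  refine (measure_mono (closedBall_subset_closedBall' ?_)).trans_lt hn
  linarith [mem_ball.1 hz]

/-- Configurations `(x, y, s)` in which `y` is the centre of a pore of radius `s` at scale `R`
around `x`. The pore is an open ball, which makes the set of configurations closed. -/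
def poreConfig (μ : Measure X) (R ε : ℝ) : Set (X × X × ℝ) :=
  {p | dist p.2.1 p.1 + p.2.2 ≤ R ∧
    μ (ball p.2.1 p.2.2) ≤ ENNReal.ofReal ε * μ (closedBall p.1 R)}

theorem isClosed_poreConfig [OpensMeasurableSpace X] (μ : Measure X) [IsFiniteMeasure μ]
    (R ε : ℝ) : IsClosed (poreConfig μ R ε) := by
  have hdist : IsClosed {p : X × X × ℝ | dist p.2.1 p.1 + p.2.2 ≤ R} :=
    isClosed_le (by fun_prop) (by fun_prop)
  suffices h : IsClosed {p : X × X × ℝ |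
      μ (ball p.2.1 p.2.2) ≤ ENNReal.ofReal ε * μ (closedBall p.1 R)} from hdist.inter h
  rw [← isOpen_compl_iff, isOpen_iff_mem_nhds]
  rintro ⟨x, y, s⟩ h
  simp only [mem_compl_iff, mem_ofPred_eq, not_le] at h
  obtain ⟨b, hb1, hb2⟩ := exists_between h
  have h1 : ∀ᶠ p : X × X × ℝ in nhds (x, y, s), b < μ (ball p.2.1 p.2.2) :=
    (continuous_snd.tendsto (x, y, s)).eventually (lowerSemicontinuous_measure_ball μ (y, s) b hb2)
  have husc : ∀ᶠ x' in nhds x, ENNReal.ofReal ε * μ (closedBall x' R) < b := by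
    rcases eq_or_ne (ENNReal.ofReal ε) 0 with h0 | h0
    · exact Eventually.of_forall fun x' => by simpa [h0] using hb1
    · have : μ (closedBall x R) < b / ENNReal.ofReal ε := by
        rw [ENNReal.lt_div_iff_mul_lt (.inl h0) (.inl ENNReal.ofReal_ne_top), mul_comm]
        exact hb1
      filter_upwards [upperSemicontinuous_measure_closedBall μ R x _ this] with x' hx'
      rwa [ENNReal.lt_div_iff_mul_lt (.inl h0) (.inl ENNReal.ofReal_ne_top), mul_comm] at hx'
  filter_upwards [h1, (continuous_fst.tendsto (x, y, s)).eventually husc] with p hp1 hp2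
  simpa using hp2.trans hp1

/-- Points having a pore of radius `s` at scale `R`. -/
def poreSet (μ : Measure X) (s R ε : ℝ) : Set X :=
  {x | ∃ y, (x, y, s) ∈ poreConfig μ R ε}

theorem isClosed_poreSet [OpensMeasurableSpace X] [ProperSpace X] (μ : Measure X)
    [IsFiniteMeasure μ] {s : ℝ} (hs : 0 ≤ s) (R ε : ℝ) : IsClosed (poreSet μ s R ε) := by
  refine IsSeqClosed.isClosed fun u x hu hx => ?_
  choose y hy using hu
  obtain ⟨C, hC⟩ := (Metric.isBounded_range_of_tendsto u hx).subset_closedBall x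
  have hyb : ∀ n, y n ∈ closedBall x (C + R) := fun n => by
    have h1 : dist (u n) x ≤ C := hC (mem_range_self n)
    have h2 := (hy n).1
    have h3 := dist_triangle (y n) (u n) x
    simp only [mem_closedBall] at *
    linarith
  obtain ⟨w, -, φ, hφ, hw⟩ := (isCompact_closedBall x (C + R)).tendsto_subseq hyb
  exact ⟨w, (isClosed_poreConfig μ R ε).mem_of_tendsto
    ((hx.comp hφ.tendsto_atTop).prodMk_nhds (hw.prodMk_nhds tendsto_const_nhds))
    (Eventually.of_forall fun n => hy (φ n))⟩

end Pores

theorem dist_add_le_of_closedBall_subset {E : Type*} [NormedAddCommGroup E] [NormedSpace ℝ E]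
    [Nontrivial E] {x y : E} {s R : ℝ} (hs : 0 ≤ s) (h : closedBall y s ⊆ closedBall x R) :
    dist y x + s ≤ R := by
  rcases eq_or_ne y x with rfl | hne
  · obtain ⟨v, hv⟩ := exists_norm_eq E hs
    have := h (show y + v ∈ closedBall y s by simp [hv])
    simpa [hv] using this
  · have hn : ‖y - x‖ ≠ 0 := norm_ne_zero_iff.2 (sub_ne_zero.2 hne)
    have hmem : y + (s / ‖y - x‖) • (y - x) ∈ closedBall y s := by
      simp [norm_smul, hn, abs_of_nonneg hs]
    have := h hmem
    rw [mem_closedBall, dist_eq_norm,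
      show y + (s / ‖y - x‖) • (y - x) - x = (1 + s / ‖y - x‖) • (y - x) by module, norm_smul,
      Real.norm_of_nonneg (by positivity), add_mul, div_mul_cancel₀ _ hn, one_mul] at this
    rwa [dist_eq_norm]

theorem mem_poreSet_of_le_por {d : ℕ} [Nonempty (Fin d)] (μ : Measure (EuclideanSpace ℝ (Fin d)))
    [IsFiniteMeasure μ] {x : EuclideanSpace ℝ (Fin d)} {α R ε : ℝ} (hα : 0 < α) (hR : 0 < R)
    (h : α ≤ por μ x R ε) : x ∈ poreSet μ (α * R) R ε := by
  have hcomp : IsCompact ({q : EuclideanSpace ℝ (Fin d) × ℝ | (x, q) ∈ poreConfig μ R ε} ∩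
      closedBall x R ×ˢ Icc 0 R) :=
    ((isCompact_closedBall x R).prod isCompact_Icc).inter_left
      ((isClosed_poreConfig μ R ε).preimage (by fun_prop))
  unfold por at h
  set S := {α : ℝ | 0 ≤ α ∧ ∃ y, Metric.closedBall y (α * R) ⊆ Metric.closedBall x R ∧
    μ (Metric.closedBall y (α * R)) ≤ ENNReal.ofReal ε * μ (Metric.closedBall x R)} with hS
  have hmem : ∀ a ∈ S, ∃ y, (y, a * R) ∈ ({q : EuclideanSpace ℝ (Fin d) × ℝ |
      (x, q) ∈ poreConfig μ R ε} ∩ closedBall x R ×ˢ Icc 0 R) := by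
    rintro a ⟨ha, y, hy, hμ⟩
    have haR : 0 ≤ a * R := by positivity
    have hd := dist_add_le_of_closedBall_subset haR hy
    have := dist_nonneg (x := y) (y := x)
    exact ⟨y, ⟨hd, (measure_mono ball_subset_closedBall).trans hμ⟩,
      mem_closedBall.2 (by linarith), haR, by linarith⟩
  have hne : S.Nonempty := by
    by_contra hne
    rw [not_nonempty_iff_eq_empty.1 hne, Real.sSup_empty] at h
    linarith
  obtain ⟨a, ha⟩ := hne
  obtain ⟨y₀, hy₀⟩ := hmem a ha
  obtain ⟨⟨y, s⟩, ⟨⟨hy1, hy2⟩, -⟩, hmax⟩ := hcomp.exists_isMaxOn ⟨_, hy₀⟩ continuous_snd.continuousOn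
  have hsup : sSup S ≤ s / R := csSup_le ⟨a, ha⟩ fun b hb => by
    obtain ⟨z, hz⟩ := hmem b hb
    exact (le_div_iff₀ hR).2 (hmax hz)
  have hs : α * R ≤ s := (le_div_iff₀ hR).1 (h.trans hsup)
  exact ⟨y, by simp only at hy1 ⊢; linarith, (measure_mono (ball_subset_ball hs)).trans hy2⟩

/-- A Cesàro average of terms bounded by `1` converges as soon as it does along squares. -/
theorem tendsto_average_of_tendsto_average_sq {f : ℕ → ℝ} (hf : ∀ i, |f i| ≤ 1)
    (h : Tendsto (fun k : ℕ => (∑ i ∈ Finset.range (k ^ 2), f i) / (k : ℝ) ^ 2) atTop (nhds 0)) :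
    Tendsto (fun n : ℕ => (∑ i ∈ Finset.range n, f i) / (n : ℝ)) atTop (nhds 0) := by
  have hsq : Tendsto Nat.sqrt atTop atTop := tendsto_atTop_atTop.2 fun b =>
    ⟨b ^ 2, fun n hn => Nat.le_sqrt'.2 hn⟩
  have h2 : Tendsto (fun k : ℕ => |(∑ i ∈ Finset.range (k ^ 2), f i) / (k : ℝ) ^ 2| + 2 / (k : ℝ))
      atTop (nhds 0) := by
    simpa using h.abs.add (tendsto_const_div_atTop_nhds_zero_nat (2 : ℝ))
  refine squeeze_zero_norm' ?_ (h2.comp hsq)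
  filter_upwards [eventually_ge_atTop 1] with n hn
  have hk1 : 1 ≤ Nat.sqrt n := Nat.le_sqrt'.2 (by simpa using hn)
  have hkn : Nat.sqrt n ^ 2 ≤ n := Nat.sqrt_le' n
  have hnk : n ≤ Nat.sqrt n ^ 2 + 2 * Nat.sqrt n := by
    have := Nat.lt_succ_sqrt' n
    rw [Nat.succ_eq_add_one] at this
    nlinarith
  simp only [Function.comp]
  set k := Nat.sqrt n
  have hk : (0 : ℝ) < k := by exact_mod_cast hk1
  have hkn' : (k : ℝ) ^ 2 ≤ n := by exact_mod_cast hkn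
  have hnk' : (n : ℝ) ≤ (k : ℝ) ^ 2 + 2 * k := by exact_mod_cast hnk
  have hsplit : ∑ i ∈ Finset.range n, f i =
      ∑ i ∈ Finset.range (k ^ 2), f i + ∑ i ∈ Finset.Ico (k ^ 2) n, f i :=
    (Finset.sum_range_add_sum_Ico f hkn).symm
  have htail : |∑ i ∈ Finset.Ico (k ^ 2) n, f i| ≤ 2 * k := by
    refine (Finset.abs_sum_le_sum_abs _ _).trans ((Finset.sum_le_sum fun i _ => hf i).trans ?_)
    rw [Finset.sum_const, Nat.card_Ico, nsmul_eq_mul, mul_one, Nat.cast_sub hkn]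
    push_cast
    linarith
  rw [Real.norm_eq_abs, abs_div, abs_div, abs_of_pos (by positivity : (0 : ℝ) < (k : ℝ) ^ 2),
    Nat.abs_cast, hsplit]
  calc |∑ i ∈ Finset.range (k ^ 2), f i + ∑ i ∈ Finset.Ico (k ^ 2) n, f i| / (n : ℝ)
      ≤ (|∑ i ∈ Finset.range (k ^ 2), f i| + 2 * k) / (k : ℝ) ^ 2 := by
        gcongr
        exact (abs_add_le _ _).trans (by gcongr)
    _ = _ := by field_simp

/-- Second moment of a sum of bounded random variables which are orthogonal at distance `m`. -/
theorem integral_sum_sq_le {Ω : Type*} [MeasurableSpace Ω] (P : Measure Ω) [IsProbabilityMeasure P]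
    {f : ℕ → Ω → ℝ} (hmeas : ∀ i, Measurable (f i)) (hf : ∀ i ω, |f i ω| ≤ 1) (m : ℕ)
    (horth : ∀ i j, i + m ≤ j → ∫ ω, f i ω * f j ω ∂P = 0) (n : ℕ) :
    ∫ ω, (∑ i ∈ Finset.range n, f i ω) ^ 2 ∂P ≤ 2 * m * n := by
  have hbd : ∀ i j ω, |f i ω * f j ω| ≤ 1 := fun i j ω => by
    rw [abs_mul]
    exact mul_le_one₀ (hf i ω) (abs_nonneg _) (hf j ω)
  have hint : ∀ i j, Integrable (fun ω => f i ω * f j ω) P := fun i j =>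
    Integrable.of_bound ((hmeas i).mul (hmeas j)).aestronglyMeasurable 1
      (Eventually.of_forall fun ω => hbd i j ω)
  have hle : ∀ i j, ∫ ω, f i ω * f j ω ∂P ≤ 1 := fun i j => by
    calc ∫ ω, f i ω * f j ω ∂P ≤ ∫ _, (1 : ℝ) ∂P :=
          integral_mono (hint i j) (integrable_const _) fun ω => (le_abs_self _).trans (hbd i j ω)
      _ = 1 := by simp
  simp only [sq, Finset.sum_mul_sum]
  rw [integral_finsetSum _ fun i _ => integrable_finsetSum _ fun j _ => hint i j]
  have hrow : ∀ i ∈ Finset.range n,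
      ∫ ω, ∑ j ∈ Finset.range n, f i ω * f j ω ∂P ≤ 2 * m := fun i _ => by
    rw [integral_finsetSum _ fun j _ => hint i j]
    calc ∑ j ∈ Finset.range n, ∫ ω, f i ω * f j ω ∂P
        ≤ ∑ j ∈ Finset.range n, if j ∈ Finset.Ico (i + 1 - m) (i + m) then (1 : ℝ) else 0 := by
          refine Finset.sum_le_sum fun j _ => ?_
          split_ifs with hj
          · exact hle i j
          · rw [Finset.mem_Ico, not_and_or, not_le, not_lt] at hj
            rcases hj with hj | hj
            · simp_rw [mul_comm (f i _)]
              exact (horth j i (by omega)).le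
            · exact (horth i j hj).le
      _ ≤ ((Finset.Ico (i + 1 - m) (i + m)).card : ℝ) := by
          rw [Finset.sum_ite_mem, Finset.sum_const, nsmul_eq_mul, mul_one]
          exact_mod_cast Finset.card_le_card Finset.inter_subset_right
      _ ≤ 2 * m := by
          rw [Nat.card_Ico]
          exact_mod_cast (by omega : i + m - (i + 1 - m) ≤ 2 * m)
  calc _ ≤ ∑ _ ∈ Finset.range n, (2 * m : ℝ) := Finset.sum_le_sum hrow
    _ = 2 * m * n := by simp; ring

/-- Strong law of large numbers for bounded random variables which are orthogonal at
distance `m`. -/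
theorem ae_tendsto_average_of_orthogonal {Ω : Type*} [MeasurableSpace Ω] (P : Measure Ω)
    [IsProbabilityMeasure P] {f : ℕ → Ω → ℝ} (hmeas : ∀ i, Measurable (f i))
    (hf : ∀ i ω, |f i ω| ≤ 1) (m : ℕ)
    (horth : ∀ i j, i + m ≤ j → ∫ ω, f i ω * f j ω ∂P = 0) :
    ∀ᵐ ω ∂P, Tendsto (fun n : ℕ => (∑ i ∈ Finset.range n, f i ω) / (n : ℝ)) atTop (nhds 0) := by
  set g : ℕ → Ω → ℝ := fun k ω => ((∑ i ∈ Finset.range (k ^ 2), f i ω) / (k : ℝ) ^ 2) ^ 2 with hg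
  have hsum_meas : ∀ n, Measurable fun ω => ∑ i ∈ Finset.range n, f i ω := fun n =>
    Finset.measurable_fun_sum _ fun i _ => hmeas i
  have hgm : ∀ k, Measurable (g k) := fun k => ((hsum_meas _).div_const _).pow_const 2
  have hsum_bd : ∀ n ω, |∑ i ∈ Finset.range n, f i ω| ≤ n := fun n ω =>
    (Finset.abs_sum_le_sum_abs _ _).trans ((Finset.sum_le_sum fun i _ => hf i ω).trans (by simp))
  have hgi : ∀ k, ∫⁻ ω, ENNReal.ofReal (g k ω) ∂P ≤
      ENNReal.ofReal (2 * m * (1 / (k : ℝ) ^ 2)) := fun k => by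
    have hsqint : Integrable (fun ω => (∑ i ∈ Finset.range (k ^ 2), f i ω) ^ 2) P :=
      Integrable.of_bound ((hsum_meas _).pow_const 2).aestronglyMeasurable (((k ^ 2 : ℕ) : ℝ) ^ 2)
        (Eventually.of_forall fun ω => by
          rw [Real.norm_eq_abs, abs_pow]
          exact pow_le_pow_left₀ (abs_nonneg _) (hsum_bd _ ω) 2)
    simp only [hg, div_pow]
    rw [← ofReal_integral_eq_lintegral_ofReal (hsqint.div_const _)
      (Eventually.of_forall fun ω => by positivity), integral_div]
    refine ENNReal.ofReal_le_ofReal ?_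
    rcases Nat.eq_zero_or_pos k with rfl | hk
    · simp
    · have hk' : (0 : ℝ) < k := by exact_mod_cast hk
      rw [div_le_iff₀ (by positivity)]
      refine (integral_sum_sq_le P hmeas hf m horth (k ^ 2)).trans (le_of_eq ?_)
      push_cast
      field_simp
  have htsum : ∫⁻ ω, ∑' k, ENNReal.ofReal (g k ω) ∂P ≠ ⊤ := by
    rw [lintegral_tsum fun k => (hgm k).ennreal_ofReal.aemeasurable]
    refine ne_top_of_le_ne_top ?_ (ENNReal.tsum_le_tsum hgi)
    have hs : Summable fun k : ℕ => 2 * (m : ℝ) * (1 / (k : ℝ) ^ 2) :=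
      (Real.summable_one_div_nat_pow.2 one_lt_two).mul_left _
    rw [← ENNReal.ofReal_tsum_of_nonneg (fun k => by positivity) hs]
    exact ENNReal.ofReal_ne_top
  filter_upwards [ae_lt_top (Measurable.tsum fun k => (hgm k).ennreal_ofReal) htsum]
    with ω hω
  refine tendsto_average_of_tendsto_average_sq (fun i => hf i ω) ?_
  have h1 := ENNReal.tendsto_atTop_zero_of_tsum_ne_top hω.ne
  have h2 : Tendsto (fun k => g k ω) atTop (nhds 0) := by
    have := (ENNReal.tendsto_toReal ENNReal.zero_ne_top).comp h1
    simpa [Function.comp_def, ENNReal.toReal_ofReal (sq_nonneg _), hg] using this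
  have h3 := h2.sqrt
  simp only [hg, Real.sqrt_sq_eq_abs, Real.sqrt_zero] at h3
  exact (tendsto_zero_iff_abs_tendsto_zero _).2 h3

section PeriodicIntegrals

theorem integral_periodic_comp_two_pow {h : ℝ → ℝ} (hper : Function.Periodic h 1)
    (hint : ∀ s t, IntervalIntegrable h volume s t) {q k : ℕ} (hqk : q ≤ k) (p p' : ℤ) :
    ∫ u in (p / 2 ^ q : ℝ)..(p' / 2 ^ q : ℝ), h ((2 : ℝ) ^ k * u) =
      (p' / 2 ^ q - p / 2 ^ q) * ∫ u in (0 : ℝ)..1, h u := by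
  obtain ⟨e, rfl⟩ := Nat.exists_eq_add_of_le hqk
  have hend : (2 : ℝ) ^ (q + e) * (p' / 2 ^ q) =
      (2 : ℝ) ^ (q + e) * (p / 2 ^ q) + (((p' - p) * 2 ^ e : ℤ)) • (1 : ℝ) := by
    rw [zsmul_eq_mul, pow_add]
    push_cast
    field_simp
    ring
  rw [intervalIntegral.integral_comp_mul_left _ (by positivity), hend,
    hper.intervalIntegral_add_zsmul_eq _ _ hint, hper.intervalIntegral_add_eq _ 0, zero_add,
    zsmul_eq_mul, smul_eq_mul, pow_add]
  push_cast
  field_simp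

/-- The indicator function of the `1`-periodic extension of `[a, b)`. -/
noncomputable def periodicIndicator (a b : ℝ) : ℝ → ℝ :=
  {u : ℝ | Int.fract u ∈ Ico a b}.indicator 1

variable {a b : ℝ}

theorem periodicIndicator_periodic (a b : ℝ) : Function.Periodic (periodicIndicator a b) 1 :=
  fun u => by simp [periodicIndicator, indicator]

@[fun_prop]
theorem measurable_periodicIndicator (a b : ℝ) : Measurable (periodicIndicator a b) :=
  measurable_one.indicator (measurable_fract measurableSet_Ico)

theorem periodicIndicator_nonneg (u : ℝ) : 0 ≤ periodicIndicator a b u :=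
  indicator_nonneg (fun _ _ => zero_le_one) u

theorem periodicIndicator_le_one (u : ℝ) : periodicIndicator a b u ≤ 1 :=
  indicator_le_self' (fun _ _ => zero_le_one) u

theorem intervalIntegrable_of_measurable_of_bound {h : ℝ → ℝ} (hm : Measurable h)
    (hb : ∀ u, |h u| ≤ 1) (s t : ℝ) : IntervalIntegrable h volume s t :=
  (intervalIntegrable_const (c := (1 : ℝ))).mono_fun hm.aestronglyMeasurable
    (Eventually.of_forall fun u => by simpa using hb u)

theorem integral_periodicIndicator_mul (ha : 0 ≤ a) (hab : a ≤ b) (hb : b ≤ 1) (g : ℝ → ℝ) :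
    ∫ u in (0 : ℝ)..1, periodicIndicator a b u * g u = ∫ u in a..b, g u := by
  rw [intervalIntegral.integral_of_le zero_le_one, intervalIntegral.integral_of_le hab,
    ← integral_Ico_eq_integral_Ioc, ← integral_Ico_eq_integral_Ioc]
  have : ∀ u ∈ Ico (0 : ℝ) 1, periodicIndicator a b u * g u = (Ico a b).indicator g u := by
    intro u hu
    simp only [periodicIndicator, indicator, mem_ofPred_eq, Int.fract_eq_self.2 hu]
    split_ifs <;> simp
  rw [setIntegral_congr_fun measurableSet_Ico this, setIntegral_indicator measurableSet_Ico,
    inter_eq_right.2 (Ico_subset_Ico ha hb)]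

theorem abs_periodicIndicator_le (u : ℝ) : |periodicIndicator a b u| ≤ 1 := by
  rw [abs_of_nonneg (periodicIndicator_nonneg u)]
  exact periodicIndicator_le_one u

theorem intervalIntegrable_periodicIndicator (s t : ℝ) :
    IntervalIntegrable (periodicIndicator a b) volume s t :=
  intervalIntegrable_of_measurable_of_bound (measurable_periodicIndicator a b)
    abs_periodicIndicator_le s t

theorem integral_periodicIndicator (ha : 0 ≤ a) (hab : a ≤ b) (hb : b ≤ 1) :
    ∫ u in (0 : ℝ)..1, periodicIndicator a b u = b - a := by
  simpa using integral_periodicIndicator_mul ha hab hb 1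

theorem integral_periodic_comp_two_pow_unit {h : ℝ → ℝ} (hper : Function.Periodic h 1)
    (hint : ∀ s t, IntervalIntegrable h volume s t) (k : ℕ) (z : ℤ) :
    ∫ u in (z : ℝ)..(z + 1 : ℝ), h ((2 : ℝ) ^ k * u) = ∫ u in (0 : ℝ)..1, h u := by
  simpa using integral_periodic_comp_two_pow hper hint (Nat.zero_le k) z (z + 1)

theorem integral_periodicIndicator_comp (ha : 0 ≤ a) (hab : a ≤ b) (hb : b ≤ 1) (k : ℕ) (z : ℤ) :
    ∫ u in (z : ℝ)..(z + 1 : ℝ), periodicIndicator a b ((2 : ℝ) ^ k * u) = b - a := by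
  rw [integral_periodic_comp_two_pow_unit (periodicIndicator_periodic a b)
    intervalIntegrable_periodicIndicator, integral_periodicIndicator ha hab hb]

/-- The binary digits read by the two factors are disjoint, so the factors are independent. -/
theorem integral_periodicIndicator_mul_comp {m : ℕ} {p p' : ℤ} (ha : (0 : ℝ) ≤ p / 2 ^ m)
    (hab : (p / 2 ^ m : ℝ) ≤ p' / 2 ^ m) (hb : (p' / 2 ^ m : ℝ) ≤ 1) {i j : ℕ} (hij : i + m ≤ j)
    (z : ℤ) :
    ∫ u in (z : ℝ)..(z + 1 : ℝ), periodicIndicator (p / 2 ^ m) (p' / 2 ^ m) ((2 : ℝ) ^ i * u) *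
        periodicIndicator (p / 2 ^ m) (p' / 2 ^ m) ((2 : ℝ) ^ j * u) =
      (p' / 2 ^ m - p / 2 ^ m) ^ 2 := by
  obtain ⟨e, rfl⟩ := Nat.exists_eq_add_of_le hij
  set χ := periodicIndicator (p / 2 ^ m) (p' / 2 ^ m) with hχ
  set H : ℝ → ℝ := fun v => χ v * χ ((2 : ℝ) ^ (m + e) * v) with hH
  have hper : Function.Periodic H 1 := fun v => by
    have h1 := periodicIndicator_periodic (p / 2 ^ m) (p' / 2 ^ m) v
    have h2 := (periodicIndicator_periodic (p / 2 ^ m) (p' / 2 ^ m)).nat_mul (2 ^ (m + e))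
      ((2 : ℝ) ^ (m + e) * v)
    push_cast at h2
    simp only [hH, mul_add, hχ]
    rw [h1, h2]
  have hmeas : Measurable H := by fun_prop
  have hbd : ∀ v, |H v| ≤ 1 := fun v => by
    rw [abs_mul]
    exact mul_le_one₀ (abs_periodicIndicator_le _) (abs_nonneg _) (abs_periodicIndicator_le _)
  have := integral_periodic_comp_two_pow_unit hper
    (intervalIntegrable_of_measurable_of_bound hmeas hbd) i z
  calc _ = ∫ u in (z : ℝ)..(z + 1 : ℝ), H ((2 : ℝ) ^ i * u) := by
        refine intervalIntegral.integral_congr fun u _ => ?_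
        simp only [hH]
        rw [← mul_assoc, ← pow_add, show m + e + i = i + m + e by ring]
    _ = _ := by
        rw [this]
        simp only [hH, hχ]
        rw [integral_periodicIndicator_mul ha hab hb, integral_periodic_comp_two_pow
          (periodicIndicator_periodic _ _) intervalIntegrable_periodicIndicator
          (Nat.le_add_right m e), integral_periodicIndicator ha hab hb, sq]

end PeriodicIntegrals

/-- Frequency of visits of `2 ^ i θ` to a dyadic cube mod `1`, along arbitrary bounded weights. -/
theorem ae_tendsto_average_prod_periodicIndicator {d m : ℕ} {p p' : ℤ}
    (ha : (0 : ℝ) ≤ p / 2 ^ m) (hab : (p / 2 ^ m : ℝ) ≤ p' / 2 ^ m)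
    (hb : (p' / 2 ^ m : ℝ) ≤ 1) {w : ℕ → ℝ} (hw : ∀ i, |w i| ≤ 1) :
    ∀ᵐ θ ∂(volume : Measure (Fin d → ℝ)), Tendsto (fun n : ℕ => (∑ i ∈ Finset.range n,
      w i * (∏ j, periodicIndicator (p / 2 ^ m) (p' / 2 ^ m) ((2 : ℝ) ^ i * θ j) -
        (p' / 2 ^ m - p / 2 ^ m) ^ d)) / (n : ℝ)) atTop (nhds 0) := by
  set c : ℝ := p' / 2 ^ m - p / 2 ^ m with hc
  set χ := periodicIndicator (p / 2 ^ m) (p' / 2 ^ m) with hχ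
  have hc0 : 0 ≤ c := sub_nonneg.2 hab
  have hc1 : c ≤ 1 := by linarith
  set G : ℕ → (Fin d → ℝ) → ℝ := fun i θ => ∏ j, χ ((2 : ℝ) ^ i * θ j) with hG
  have hGm : ∀ i, Measurable (G i) := fun i =>
    Finset.measurable_fun_prod _ fun j _ => by fun_prop
  have hG0 : ∀ i θ, 0 ≤ G i θ := fun i θ => Finset.prod_nonneg fun j _ => periodicIndicator_nonneg _
  have hG1 : ∀ i θ, G i θ ≤ 1 := fun i θ =>
    Finset.prod_le_one (fun j _ => periodicIndicator_nonneg _) fun j _ => periodicIndicator_le_one _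
  have hcd0 : 0 ≤ c ^ d := pow_nonneg hc0 d
  have hcd1 : c ^ d ≤ 1 := pow_le_one₀ hc0 hc1
  have key : ∀ z : Fin d → ℤ, ∀ᵐ θ ∂(volume : Measure (Fin d → ℝ)),
      θ ∈ univ.pi (fun j => Ioc (z j : ℝ) (z j + 1)) →
      Tendsto (fun n : ℕ => (∑ i ∈ Finset.range n, w i * (G i θ - c ^ d)) / (n : ℝ))
        atTop (nhds 0) := by
    intro z
    rw [← ae_restrict_iff' (MeasurableSet.univ_pi fun j => measurableSet_Ioc), volume_pi,
      Measure.restrict_pi_pi]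
    have hprob : ∀ j, IsProbabilityMeasure
        ((volume : Measure ℝ).restrict (Ioc (z j : ℝ) (z j + 1))) := fun j =>
      ⟨by simp⟩
    set P := Measure.pi fun j => (volume : Measure ℝ).restrict (Ioc (z j : ℝ) (z j + 1)) with hP
    have hGint : ∀ i, Integrable (G i) P := fun i =>
      Integrable.of_bound (hGm i).aestronglyMeasurable 1 (Eventually.of_forall fun θ => by
        rw [Real.norm_of_nonneg (hG0 i θ)]; exact hG1 i θ)
    have hGGint : ∀ i j, Integrable (fun θ => G i θ * G j θ) P := fun i j =>
      Integrable.of_bound ((hGm i).mul (hGm j)).aestronglyMeasurable 1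
        (Eventually.of_forall fun θ => by
          rw [Real.norm_of_nonneg (mul_nonneg (hG0 i θ) (hG0 j θ))]
          exact mul_le_one₀ (hG1 i θ) (hG0 j θ) (hG1 j θ))
    have hIG : ∀ i, ∫ θ, G i θ ∂P = c ^ d := fun i => by
      simp only [hG, hP]
      rw [integral_fintype_prod_eq_prod (fun j u => χ ((2 : ℝ) ^ i * u))]
      simp_rw [← intervalIntegral.integral_of_le (le_add_of_nonneg_right (zero_le_one (α := ℝ))),
        hχ, integral_periodicIndicator_comp ha hab hb]
      simp [hc]
    have hIGG : ∀ i j, i + m ≤ j → ∫ θ, G i θ * G j θ ∂P = (c ^ d) ^ 2 := fun i j hij => by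
      simp only [hG, hP, ← Finset.prod_mul_distrib]
      rw [integral_fintype_prod_eq_prod (fun _ u => χ ((2 : ℝ) ^ i * u) * χ ((2 : ℝ) ^ j * u))]
      simp_rw [← intervalIntegral.integral_of_le (le_add_of_nonneg_right (zero_le_one (α := ℝ))),
        hχ, integral_periodicIndicator_mul_comp ha hab hb hij]
      simp [hc, ← pow_mul, mul_comm]
    refine ae_tendsto_average_of_orthogonal P (f := fun i θ => w i * (G i θ - c ^ d))
      (fun i => ((hGm i).sub_const _).const_mul _) (fun i θ => ?_) m fun i j hij => ?_
    · rw [abs_mul]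
      refine mul_le_one₀ (hw i) (abs_nonneg _) (abs_le.2 ⟨?_, ?_⟩) <;>
        linarith [hG0 i θ, hG1 i θ]
    · have hexp : ∀ θ, w i * (G i θ - c ^ d) * (w j * (G j θ - c ^ d)) =
          w i * w j * (G i θ * G j θ - c ^ d * G i θ - c ^ d * G j θ + (c ^ d) ^ 2) :=
        fun θ => by ring
      simp_rw [hexp]
      have hi1 : Integrable (fun θ => c ^ d * G i θ) P := (hGint i).const_mul _
      have hj1 : Integrable (fun θ => c ^ d * G j θ) P := (hGint j).const_mul _
      have h2 : Integrable (fun θ => G i θ * G j θ - c ^ d * G i θ) P := (hGGint i j).sub hi1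
      have h3 : Integrable (fun θ => G i θ * G j θ - c ^ d * G i θ - c ^ d * G j θ) P := h2.sub hj1
      rw [integral_const_mul, integral_add h3 (integrable_const _), integral_sub h2 hj1,
        integral_sub (hGGint i j) hi1, integral_const_mul, integral_const_mul,
        hIG, hIG, hIGG i j hij]
      simp
      right
      ring
  filter_upwards [ae_all_iff.2 key] with θ hθ
  refine hθ (fun j => ⌈θ j⌉ - 1) fun j _ => ⟨?_, ?_⟩
  · push_cast
    linarith [Int.ceil_lt_add_one (θ j)]
  · push_cast
    linarith [Int.le_ceil (θ j)]

section DyadicCubes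

variable {d : ℕ}

theorem dist_lt_of_mem_dyadicCube [Nonempty (Fin d)] {n : ℕ} {x y : EuclideanSpace ℝ (Fin d)}
    (h : y ∈ dyadicCube d n x) : dist y x < Real.sqrt d / 2 ^ n := by
  have hj : ∀ j, dist (y j) (x j) ^ 2 < (1 / 2 ^ n : ℝ) ^ 2 := fun j => by
    have h1 := Int.abs_sub_lt_one_of_floor_eq_floor (h j)
    rw [← mul_sub, abs_mul, abs_of_pos (by positivity : (0 : ℝ) < 2 ^ n)] at h1
    refine pow_lt_pow_left₀ ?_ dist_nonneg two_ne_zero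
    rwa [Real.dist_eq, lt_div_iff₀ (by positivity), mul_comm]
  rw [EuclideanSpace.dist_eq]
  calc Real.sqrt (∑ j, dist (y j) (x j) ^ 2)
      < Real.sqrt (∑ _j : Fin d, (1 / 2 ^ n : ℝ) ^ 2) :=
        Real.sqrt_lt_sqrt (Finset.sum_nonneg fun j _ => sq_nonneg _)
          (Finset.sum_lt_sum_of_nonempty Finset.univ_nonempty fun j _ => hj j)
    _ = Real.sqrt d / 2 ^ n := by
        rw [Finset.sum_const, Finset.card_univ, Fintype.card_fin, nsmul_eq_mul,
          Real.sqrt_mul (Nat.cast_nonneg d), Real.sqrt_sq (by positivity)]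
        ring

theorem closedBall_subset_dyadicCube {n : ℕ} {x : EuclideanSpace ℝ (Fin d)} {r : ℝ}
    (h : ∀ j, Int.fract ((2 : ℝ) ^ n * x j) ∈ Ico r (1 - r)) :
    closedBall x (r / 2 ^ n) ⊆ dyadicCube d n x := by
  intro y hy j
  have h1 : |y j - x j| ≤ r / 2 ^ n := by
    have := PiLp.norm_apply_le (y - x) j
    rw [mem_closedBall, dist_eq_norm] at hy
    simpa using this.trans hy
  rw [le_div_iff₀ (by positivity), mul_comm, ← abs_of_pos (by positivity : (0 : ℝ) < 2 ^ n),
    ← abs_mul, mul_sub, abs_le] at h1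
  obtain ⟨h2, h3⟩ := h j
  have h4 := Int.floor_add_fract ((2 : ℝ) ^ n * x j)
  rw [Int.floor_eq_iff]
  constructor <;> linarith

theorem por2Le_map_of_mem_poreSet [Nonempty (Fin d)] (μ : Measure (EuclideanSpace ℝ (Fin d)))
    {α r ε : ℝ} (hr : 0 < r) {i k : ℕ} (hk1 : 1 ≤ k) (hk : Real.sqrt d / 2 ^ k ≤ α * r)
    {x t : EuclideanSpace ℝ (Fin d)}
    (hT : MeasurableEmbedding fun x : EuclideanSpace ℝ (Fin d) => r • x + t)
    (hx : x ∈ poreSet μ (α * (1 / 2 ^ i)) (1 / 2 ^ i) ε)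
    (hfract : ∀ j, Int.fract ((2 : ℝ) ^ i * (r • x + t) j) ∈ Ico r (1 - r)) :
    por2Le (Measure.map (fun x => r • x + t) μ) (r • x + t) i k ε := by
  obtain ⟨y, hy1, hy2⟩ := hx
  simp only at hy1 hy2
  have hdist : ∀ u v : EuclideanSpace ℝ (Fin d), dist (r • u + t) (r • v + t) = r * dist u v :=
    fun u v => by rw [dist_add_right, dist_smul₀, Real.norm_of_nonneg hr.le]
  have hα : 0 ≤ α := by
    by_contra! h
    have : α * r < 0 := mul_neg_of_neg_of_pos h hr
    have : 0 ≤ Real.sqrt d / 2 ^ k := by positivity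
    linarith
  have hsub := closedBall_subset_dyadicCube hfract
  have hbig : closedBall x (1 / 2 ^ i) ⊆ (fun x => r • x + t) ⁻¹' dyadicCube d i (r • x + t) :=
    fun z hz => hsub <| by
      rw [mem_closedBall, hdist, div_eq_mul_one_div]
      exact mul_le_mul_of_nonneg_left hz hr.le
  have hpos : 0 ≤ α * (1 / 2 ^ i) := by positivity
  refine ⟨k, hk1, le_rfl, r • y + t, hbig (mem_closedBall.2 (by linarith)), ?_⟩
  rw [hT.map_apply, hT.map_apply]
  refine (measure_mono fun z hz => ?_).trans
    (hy2.trans (mul_le_mul_right (measure_mono hbig) _))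
  have h1 := dist_lt_of_mem_dyadicCube hz
  rw [hdist] at h1
  rw [mem_ball]
  refine lt_of_mul_lt_mul_left (h1.trans_le ?_) hr.le
  calc Real.sqrt d / 2 ^ (i + k) = Real.sqrt d / 2 ^ k * (1 / 2 ^ i) := by
        rw [pow_add]; field_simp
    _ ≤ α * r * (1 / 2 ^ i) := by gcongr
    _ = r * (α * (1 / 2 ^ i)) := by ring

end DyadicCubes

theorem sqrt_div_two_pow_ceil_le {d : ℕ} (hd : 1 ≤ d) {β : ℝ} (hβ : 0 < β) :
    Real.sqrt d / 2 ^ ⌈|Real.logb 2 (β / Real.sqrt d)|⌉₊ ≤ β := by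
  have hs : 0 < Real.sqrt d := Real.sqrt_pos.2 (by exact_mod_cast hd)
  set k := ⌈|Real.logb 2 (β / Real.sqrt d)|⌉₊
  have h1 : -(k : ℝ) ≤ Real.logb 2 (β / Real.sqrt d) :=
    (neg_le_neg (Nat.le_ceil _)).trans (neg_abs_le _)
  rw [Real.le_logb_iff_rpow_le one_lt_two (by positivity), Real.rpow_neg zero_le_two,
    Real.rpow_natCast, le_div_iff₀ hs] at h1
  rwa [div_eq_inv_mul]

theorem one_le_ceil_abs_logb {d : ℕ} (hd : 1 ≤ d) {β : ℝ} (hβ : 0 < β) (hβ1 : β < 1) :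
    1 ≤ ⌈|Real.logb 2 (β / Real.sqrt d)|⌉₊ := by
  have hs : 1 ≤ Real.sqrt d := Real.one_le_sqrt.2 (by exact_mod_cast hd)
  refine Nat.ceil_pos.2 (abs_pos.2 (Real.logb_neg one_lt_two (by positivity) ?_).ne)
  exact (div_lt_one (by linarith)).2 (by linarith)

theorem ncard_lt_inter_eq_sum_indicator (T : Set ℕ) (n : ℕ) :
    (Set.ncard {i : ℕ | i < n ∧ i ∈ T} : ℝ) =
      ∑ i ∈ Finset.range n, T.indicator (1 : ℕ → ℝ) i := by
  classical
  have : {i : ℕ | i < n ∧ i ∈ T} = ((Finset.range n).filter (· ∈ T) : Finset ℕ) := by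
    ext i
    simp
  rw [this, Set.ncard_coe_finset]
  simp [indicator]

/-- If the indices in `T` are selected among those of `S` with asymptotic frequency at least
`γ m`, for a sequence `γ m → c`, then the lower density of `T` is at least `c` times that of `S`. -/
theorem mul_le_liminf_density {S T : Set ℕ} {η c : ℝ} (hc : 0 < c) {w : ℕ → ℝ}
    (hw0 : ∀ i, 0 ≤ w i) (hw : ∀ i ∈ S, 1 ≤ w i) {γ : ℕ → ℝ} (hγ : Tendsto γ atTop (nhds c))
    {g : ℕ → ℕ → ℝ} (hg : ∀ᶠ m in atTop, (∀ i, w i * g m i ≤ T.indicator 1 i) ∧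
      Tendsto (fun n : ℕ => (∑ i ∈ Finset.range n, w i * (g m i - γ m)) / (n : ℝ)) atTop (nhds 0))
    (hη : η ≤ liminf (fun n : ℕ => (Set.ncard {i : ℕ | i < n ∧ i ∈ S} : ℝ) / n) atTop) :
    c * η ≤ liminf (fun n : ℕ => (Set.ncard {i : ℕ | i < n ∧ i ∈ T} : ℝ) / n) atTop := by
  simp_rw [ncard_lt_inter_eq_sum_indicator] at hη ⊢
  refine le_of_forall_lt fun L hL => ?_
  obtain ⟨L', hL', hL'2⟩ := exists_between hL
  refine hL'.trans_le ?_
  obtain ⟨m, ⟨hm1, hm2⟩, hm3, hm4⟩ := (hg.and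
    ((hγ.eventually (lt_mem_nhds hc)).and ((hγ.mul_const η).eventually (lt_mem_nhds hL'2)))).exists
  obtain ⟨η', hη'1, hη'2⟩ := exists_between ((div_lt_iff₀' hm3).2 hm4)
  have hS : ∀ᶠ n : ℕ in atTop,
      η' < (∑ i ∈ Finset.range n, S.indicator (1 : ℕ → ℝ) i) / n :=
    eventually_lt_of_lt_liminf (hη'2.trans_le hη) (isBoundedUnder_of ⟨0, fun n =>
      div_nonneg (Finset.sum_nonneg fun i _ => indicator_nonneg (fun _ _ => zero_le_one) i)
        (Nat.cast_nonneg n)⟩)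
  have havg := hm2.eventually (lt_mem_nhds (sub_neg.2 ((div_lt_iff₀' hm3).1 hη'1)))
  have hTle : ∀ i, T.indicator (1 : ℕ → ℝ) i ≤ 1 := fun i =>
    indicator_le_self' (fun _ _ => zero_le_one) i
  have hcob : IsCoboundedUnder (· ≥ ·) atTop fun n : ℕ =>
      (∑ i ∈ Finset.range n, T.indicator (1 : ℕ → ℝ) i) / (n : ℝ) :=
    (isBoundedUnder_of ⟨1, fun n => div_le_one_of_le₀
      ((Finset.sum_le_sum fun i _ => hTle i).trans (by simp))
      (Nat.cast_nonneg n)⟩ : IsBoundedUnder (· ≤ ·) atTop _).isCoboundedUnder_ge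
  refine le_liminf_of_le hcob ?_
  filter_upwards [hS, havg] with n hn1 hn2
  have hSw : (∑ i ∈ Finset.range n, S.indicator (1 : ℕ → ℝ) i) / (n : ℝ) ≤
      (∑ i ∈ Finset.range n, w i) / n := by
    gcongr with i
    by_cases hi : i ∈ S <;> simp [hi, hw0 i, hw]
  have hgT : (∑ i ∈ Finset.range n, w i * g m i) / (n : ℝ) ≤
      (∑ i ∈ Finset.range n, T.indicator (1 : ℕ → ℝ) i) / n := by
    gcongr with i
    exact hm1 i
  have hsplit : (∑ i ∈ Finset.range n, w i * (g m i - γ m)) / (n : ℝ) =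
      (∑ i ∈ Finset.range n, w i * g m i) / n - γ m * ((∑ i ∈ Finset.range n, w i) / n) := by
    simp only [mul_sub, Finset.sum_sub_distrib, ← Finset.sum_mul]
    ring
  have := mul_lt_mul_of_pos_left (hn1.trans_le hSw) hm3
  linarith

theorem ae_ae_tendsto_average_prod_periodicIndicator {d m : ℕ} {p p' : ℤ}
    (ha : (0 : ℝ) ≤ p / 2 ^ m) (hab : (p / 2 ^ m : ℝ) ≤ p' / 2 ^ m)
    (hb : (p' / 2 ^ m : ℝ) ≤ 1) (r : ℝ) (μ : Measure (EuclideanSpace ℝ (Fin d)))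
    [IsProbabilityMeasure μ] {W : ℕ → Set (EuclideanSpace ℝ (Fin d))}
    (hW : ∀ i, MeasurableSet (W i)) :
    ∀ᵐ t ∂(volume : Measure (EuclideanSpace ℝ (Fin d))), ∀ᵐ x ∂μ,
      Tendsto (fun n : ℕ => (∑ i ∈ Finset.range n, (W i).indicator (fun _ => (1 : ℝ)) x *
        (∏ j, periodicIndicator (p / 2 ^ m) (p' / 2 ^ m) ((2 : ℝ) ^ i * (r • x + t) j) -
          (p' / 2 ^ m - p / 2 ^ m) ^ d)) / (n : ℝ)) atTop (nhds 0) := by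
  refine (Measure.ae_ae_comm ?_).1 (Eventually.of_forall fun x => ?_)
  · refine measurableSet_tendsto _ fun n => ?_
    refine (Finset.measurable_fun_sum _ fun i _ => ?_).div_const _
    refine ((measurable_const.indicator (hW i)).comp measurable_fst).mul (Measurable.sub_const ?_ _)
    refine Finset.measurable_fun_prod _ fun j _ => (measurable_periodicIndicator _ _).comp ?_
    fun_prop
  · have h := ae_tendsto_average_prod_periodicIndicator (d := d) ha hab hb
      (w := fun i => (W i).indicator (fun _ => (1 : ℝ)) x) fun i => by
        by_cases hx : x ∈ W i <;> simp [hx]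
    have h2 := (EuclideanSpace.volume_preserving_symm_measurableEquiv_toLp
      (Fin d)).quasiMeasurePreserving.ae h
    exact (measurePreserving_add_left volume (r • x)).quasiMeasurePreserving.ae h2

/-- Let `μ` be a mean `(α,η,ε)`-porous Borel probability measure on `ℝ^d`
supported in `[0,1)^d`, and fix `r ∈ (0,1/2)`. Then for Lebesgue-a.e. `t ∈ [0,1/2)^d`, the
pushforward of `μ` under `x ↦ r·x + t` is dyadic mean `(k, (1−2r)^d·η, ε)`-porous, where
`k = ⌈|log₂(αr/√d)|⌉`. -/
theorem dyadicMeanPorous_of_random_translation (d : ℕ) (hd : 1 ≤ d) (α η ε r : ℝ)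
    (hα : 0 < α) (hα' : α ≤ 1 / 2) (hη : 0 < η) (hη' : η ≤ 1) (hε0 : 0 ≤ ε) (hε1 : ε < 1)
    (hr : 0 < r) (hr' : r < 1 / 2)
    (μ : Measure (EuclideanSpace ℝ (Fin d))) [IsProbabilityMeasure μ]
    (hsupp : μ (unitCube d) = 1) (hpor : MeanPorousWith μ α η ε) :
    ∀ᵐ t ∂(volume : Measure (EuclideanSpace ℝ (Fin d))),
      (∀ j : Fin d, t j ∈ Set.Ico (0 : ℝ) (1 / 2)) →
      DyadicMeanPorousWith (Measure.map (fun x => r • x + t) μ)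
        (⌈|Real.logb 2 (α * r / Real.sqrt d)|⌉₊) ((1 - 2 * r) ^ d * η) ε := by
  have : Nonempty (Fin d) := ⟨⟨0, hd⟩⟩
  have hαr : 0 < α * r := mul_pos hα hr
  have hk := sqrt_div_two_pow_ceil_le hd hαr
  have hk1 := one_le_ceil_abs_logb hd hαr (by nlinarith)
  set k := ⌈|Real.logb 2 (α * r / Real.sqrt d)|⌉₊
  set W : ℕ → Set (EuclideanSpace ℝ (Fin d)) :=
    fun i => poreSet μ (α * (1 / 2 ^ i)) (1 / 2 ^ i) ε with hWdef
  have hW : ∀ i, MeasurableSet (W i) := fun i =>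
    (isClosed_poreSet μ (by positivity) _ _).measurableSet
  set p : ℕ → ℤ := fun m => ⌈r * 2 ^ m⌉₊ with hp
  set q : ℕ → ℤ := fun m => 2 ^ m - p m with hq
  have hplim : Tendsto (fun m => (p m / 2 ^ m : ℝ)) atTop (nhds r) := by
    simpa [hp, Function.comp_def] using (tendsto_nat_ceil_mul_div_atTop hr.le).comp
      (tendsto_pow_atTop_atTop_of_one_lt (one_lt_two (α := ℝ)))
  have hqp : ∀ m, (q m / 2 ^ m : ℝ) = 1 - p m / 2 ^ m := fun m => by
    simp only [hq]
    push_cast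
    field_simp
  have hp0 : ∀ m, (0 : ℝ) ≤ p m / 2 ^ m := fun m => by simp only [hp]; positivity
  have hrp : ∀ m, r ≤ p m / 2 ^ m := fun m => by
    rw [le_div_iff₀ (by positivity)]
    simpa [hp] using Nat.le_ceil (r * 2 ^ m)
  have hae : ∀ m, (p m / 2 ^ m : ℝ) ≤ q m / 2 ^ m → _ := fun m hm =>
    ae_ae_tendsto_average_prod_periodicIndicator (hp0 m) hm
      (by rw [hqp]; linarith [hp0 m]) r μ hW
  filter_upwards [ae_all_iff.2 fun m => ae_all_iff.2 (hae m)] with t ht _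
  have hT : MeasurableEmbedding fun x : EuclideanSpace ℝ (Fin d) => r • x + t :=
    ((Homeomorph.smulOfNeZero r hr.ne').trans (Homeomorph.addRight t)).measurableEmbedding
  unfold DyadicMeanPorousWith
  rw [hT.ae_map_iff]
  filter_upwards [ae_all_iff.2 fun m => ae_all_iff.2 (ht m), hpor] with x hx hxpor
  have hγ : Tendsto (fun m => (q m / 2 ^ m - p m / 2 ^ m : ℝ) ^ d) atTop
      (nhds ((1 - 2 * r) ^ d)) := by
    have h := ((tendsto_const_nhds (x := (1 : ℝ))).sub (hplim.const_mul 2)).pow d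
    refine h.congr fun m => ?_
    rw [hqp]
    ring
  refine mul_le_liminf_density (T := {i | por2Le (Measure.map (fun x => r • x + t) μ)
    (r • x + t) i k ε}) (pow_pos (by linarith) d)
    (w := fun i => (W i).indicator (fun _ => (1 : ℝ)) x)
    (fun i => indicator_nonneg (fun _ _ => zero_le_one) x) (fun i hi => ?_) hγ
    (g := fun m i => ∏ j, periodicIndicator (p m / 2 ^ m) (q m / 2 ^ m)
      ((2 : ℝ) ^ i * (r • x + t) j)) ?_ hxpor
  · have hR : (2 : ℝ) ^ (-(i : ℝ)) = 1 / 2 ^ i := by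
      rw [Real.rpow_neg zero_le_two, Real.rpow_natCast, one_div]
    have hxi : x ∈ W i := mem_poreSet_of_le_por μ hα (by positivity) (hR ▸ hi)
    simp [hxi]
  · filter_upwards [hplim.eventually (gt_mem_nhds hr')] with m hm
    refine ⟨fun i => ?_, hx m (by rw [hqp]; linarith)⟩
    by_cases hxi : x ∈ W i
    swap
    · rw [indicator_of_notMem hxi, zero_mul]
      exact indicator_nonneg (fun _ _ => zero_le_one) i
    by_cases hfr : ∀ j, Int.fract ((2 : ℝ) ^ i * (r • x + t) j) ∈
        Ico (p m / 2 ^ m : ℝ) (q m / 2 ^ m)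
    · have hmem : i ∈ {i | por2Le (Measure.map (fun x => r • x + t) μ) (r • x + t) i k ε} :=
        por2Le_map_of_mem_poreSet μ hr hk1 hk hT hxi fun j =>
          Ico_subset_Ico (hrp m) (by rw [hqp]; linarith [hrp m]) (hfr j)
      rw [indicator_of_mem hmem, indicator_of_mem hxi, one_mul]
      exact Finset.prod_le_one (fun j _ => periodicIndicator_nonneg _)
        fun j _ => periodicIndicator_le_one _
    · push Not at hfr
      obtain ⟨j, hj⟩ := hfr
      have hzero : periodicIndicator (p m / 2 ^ m) (q m / 2 ^ m)
          ((2 : ℝ) ^ i * (r • x + t) j) = 0 := by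
        simp only [periodicIndicator, indicator, mem_ofPred_eq, if_neg hj]
      rw [Finset.prod_eq_zero (Finset.mem_univ j) hzero, mul_zero]
      exact indicator_nonneg (fun _ _ => zero_le_one) i
end
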